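/- Let δ>0, η∈S_δ, and fix m≥2 and B>0. Then there exists a real number λ ∈ [1/(m−1+B), 1/B] with the following property: for any fixed ε>0 there exist a sequence of moduli q_i tending to infinity and associated real numbers x_i such that (log q_i)/(log log x_i) → λ as i→∞ and, for all i, M_{2m}(x_i,q_i;η) ≥ (1−ε)·μ_{2m}·(α(η̂²)·log q_i)^m/φ(q_i)^m. -/

import Mathlib

open MeasureTheory

/-- Real (cosine) Fourier transform; for even real integrable `f` this agrees with
`f̂(ξ) = ∫ f(t) e^{-2πiξt} dt`. -/
noncomputable def fourierR (f : ℝ → ℝ) (ξ : ℝ) : ℝ :=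
  ∫ t : ℝ, f t * Real.cos (2 * Real.pi * ξ * t)

/-- The class `S_δ` of admissible test functions. -/
def MemS (δ : ℝ) (η : ℝ → ℝ) : Prop :=
  η ≠ 0 ∧ Differentiable ℝ η ∧ (∀ t, η (-t) = η t) ∧
  (∃ C > 0, ∀ t : ℝ, |η t| ≤ C * Real.exp (-(1/2 + δ) * |t|) ∧
      |deriv η t| ≤ C * Real.exp (-(1/2 + δ) * |t|)) ∧
  (∀ ξ : ℝ, 0 ≤ fourierR η ξ) ∧
  (∃ C > 0, ∀ ξ : ℝ, fourierR η ξ ≤ C * ((|ξ| + 1)⁻¹ * Real.log (|ξ| + 2) ^ (-(2 + δ))))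

/-- `α(η̂²) = ∫_ℝ η̂(ξ)² dξ`. -/
noncomputable def alphaSq (η : ℝ → ℝ) : ℝ := ∫ ξ : ℝ, (fourierR η ξ) ^ 2
/-- `ψ_η(x;q,a)`. -/
noncomputable def psiAP (η : ℝ → ℝ) (x : ℝ) (q a : ℕ) : ℝ :=
  ∑' n : ℕ, if (n : ZMod q) = (a : ZMod q)
    then ArithmeticFunction.vonMangoldt n / Real.sqrt n * η (Real.log (n / x)) else 0

/-- `ψ_η(x,χ_{0,q})`. -/
noncomputable def psiCop (η : ℝ → ℝ) (x : ℝ) (q : ℕ) : ℝ :=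
  ∑' n : ℕ, if Nat.Coprime n q
    then ArithmeticFunction.vonMangoldt n / Real.sqrt n * η (Real.log (n / x)) else 0

/-- The moment `M_n(x,q;η)`. -/
noncomputable def Mmom (n : ℕ) (x : ℝ) (q : ℕ) (η : ℝ → ℝ) : ℝ :=
  (1 / (q.totient : ℝ)) * ∑ a ∈ (Finset.range q).filter (fun a => Nat.Coprime a q),
    (psiAP η x q a - psiCop η x q / (q.totient : ℝ)) ^ n

open scoped ComplexConjugate
open ArithmeticFunction (vonMangoldt)

/-- Lower bound for even moments, in terms of the partial order defined by a cone `P`. -/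
theorem pow_sum_sub_mem_subsemiring {A ι : Type*} [CommRing A] [DecidableEq ι] (P : Subsemiring A)
    (g : ι → A) (σ : ι → ι) (hσ : ∀ i, σ (σ i) = i) {v : A} (hv : v ∈ P) (k : ℕ) :
    ∀ (S : Finset ι) (n : ℕ), n ≤ S.card → (∀ i ∈ S, σ i ∈ S) → (∀ i ∈ S, g i ∈ P) →
      (∀ i ∈ S, g i * g (σ i) - v ∈ P) →
      (∑ i ∈ S, g i) ^ (2 * k) -
        (((∏ j ∈ Finset.range k, (2 * j + 1)) * ∏ j ∈ Finset.range k, (n - 2 * j) : ℕ) : A)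
          * v ^ k ∈ P := by
  induction k with
  | zero => intro S n _ _ _ _; simp
  | succ k ih =>
    intro S n hn hS hg hgv
    set X := ∑ i ∈ S, g i with hX
    set Z : ι → A := fun i => ∑ j ∈ S \ {i, σ i}, g j with hZ
    set K : A := (((∏ j ∈ Finset.range k, (2 * j + 1)) *
      ∏ j ∈ Finset.range k, ((n - 2) - 2 * j) : ℕ) : A) with hK
    have hZP : ∀ i ∈ S, Z i ∈ P := fun i hi =>
      P.sum_mem fun j hj => hg j (Finset.mem_sdiff.1 hj).1
    have h1 : ∀ i ∈ S, (Z i) ^ (2 * k) - K * v ^ k ∈ P := by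
      intro i hi
      refine ih (S \ {i, σ i}) (n - 2) ?_ ?_ ?_ ?_
      · have := Finset.le_card_sdiff {i, σ i} S
        have h2 : ({i, σ i} : Finset ι).card ≤ 2 := Finset.card_le_two
        omega
      · intro j hj
        simp only [Finset.mem_sdiff, Finset.mem_insert, Finset.mem_singleton, not_or] at hj ⊢
        refine ⟨hS j hj.1, ?_, ?_⟩
        · intro h; exact hj.2.2 (by rw [← h, hσ])
        · intro h; exact hj.2.1 (by rw [← hσ j, h, hσ])
      · exact fun j hj => hg j (Finset.mem_sdiff.1 hj).1
      · exact fun j hj => hgv j (Finset.mem_sdiff.1 hj).1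
    have hXY : ∀ i ∈ S, ∃ p ∈ P, X = g (σ i) + Z i + p := by
      intro i hi
      by_cases h : σ i = i
      · refine ⟨0, P.zero_mem, ?_⟩
        simp only [hX, hZ, h, Finset.pair_eq_singleton, add_zero]
        rw [add_comm, Finset.sum_sdiff_eq_sub (by simpa using hi)]
        simp
      · refine ⟨g i, hg i hi, ?_⟩
        have hsub : ({i, σ i} : Finset ι) ⊆ S := by
          intro j hj
          simp only [Finset.mem_insert, Finset.mem_singleton] at hj
          rcases hj with rfl | rfl
          · exact hi
          · exact hS _ hi
        simp only [hX, hZ]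
        rw [Finset.sum_sdiff_eq_sub hsub, Finset.sum_pair (Ne.symm h)]
        ring
    have h2 : ∀ i ∈ S, X ^ (2 * k + 1) - ((2 * k + 1 : ℕ) : A) * (g (σ i) * (Z i) ^ (2 * k)) ∈ P := by
      intro i hi
      obtain ⟨p, hp, hXp⟩ := hXY i hi
      have hgi := hg _ (hS i hi)
      have e1 : ∀ y z : A, y ∈ P → z ∈ P → ∀ N : ℕ,
          (y + z) ^ (N + 1) - ((N + 1 : ℕ) : A) * (y * z ^ N) ∈ P := by
        intro y z hy hz N
        induction N with
        | zero => simpa using hz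
        | succ N ihN =>
          have e : (y + z) ^ (N + 1 + 1) - ((N + 1 + 1 : ℕ) : A) * (y * z ^ (N + 1)) =
              z * ((y + z) ^ (N + 1) - ((N + 1 : ℕ) : A) * (y * z ^ N)) +
              y * ((y + z) ^ (N + 1) - z ^ (N + 1)) := by
            push_cast; ring
          rw [e]
          refine P.add_mem (P.mul_mem hz ihN) (P.mul_mem hy ?_)
          have : ∀ N : ℕ, (y + z) ^ N - z ^ N ∈ P := by
            intro N
            induction N with
            | zero => simp
            | succ N ih2 =>
              have : (y + z) ^ (N + 1) - z ^ (N + 1) =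
                  y * (y + z) ^ N + z * ((y + z) ^ N - z ^ N) := by ring
              rw [this]
              exact P.add_mem (P.mul_mem hy (P.pow_mem (P.add_mem hy hz) _)) (P.mul_mem hz ih2)
          exact this _
      have e2 := e1 (g (σ i)) (Z i + p) hgi (P.add_mem (hZP i hi) hp) (2 * k)
      have e3 : (Z i + p) ^ (2 * k) - (Z i) ^ (2 * k) ∈ P := by
        have : ∀ N : ℕ, (Z i + p) ^ N - (Z i) ^ N ∈ P := by
          intro N
          induction N with
          | zero => simp
          | succ N ih2 =>
            have : (Z i + p) ^ (N + 1) - (Z i) ^ (N + 1) =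
                p * (Z i + p) ^ N + (Z i) * ((Z i + p) ^ N - (Z i) ^ N) := by ring
            rw [this]
            exact P.add_mem (P.mul_mem hp (P.pow_mem (P.add_mem (hZP i hi) hp) _))
              (P.mul_mem (hZP i hi) ih2)
        exact this _
      have e4 : X ^ (2 * k + 1) - ((2 * k + 1 : ℕ) : A) * (g (σ i) * (Z i) ^ (2 * k)) =
          ((g (σ i) + (Z i + p)) ^ (2 * k + 1) -
            ((2 * k + 1 : ℕ) : A) * (g (σ i) * (Z i + p) ^ (2 * k))) +
          ((2 * k + 1 : ℕ) : A) * (g (σ i) * ((Z i + p) ^ (2 * k) - (Z i) ^ (2 * k))) := by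
        rw [hXp]; ring
      rw [e4]
      exact P.add_mem e2 (P.mul_mem (natCast_mem P _) (P.mul_mem hgi e3))
    have h3 : ∀ i ∈ S, g i * X ^ (2 * k + 1) - ((2 * k + 1 : ℕ) : A) * (K * v ^ (k + 1)) ∈ P := by
      intro i hi
      have e : g i * X ^ (2 * k + 1) - ((2 * k + 1 : ℕ) : A) * (K * v ^ (k + 1)) =
          g i * (X ^ (2 * k + 1) - ((2 * k + 1 : ℕ) : A) * (g (σ i) * (Z i) ^ (2 * k))) +
          ((2 * k + 1 : ℕ) : A) * ((g i * g (σ i) - v) * (Z i) ^ (2 * k)) +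
          ((2 * k + 1 : ℕ) : A) * (v * ((Z i) ^ (2 * k) - K * v ^ k)) := by ring
      rw [e]
      exact P.add_mem (P.add_mem (P.mul_mem (hg i hi) (h2 i hi))
        (P.mul_mem (natCast_mem P _) (P.mul_mem (hgv i hi) (P.pow_mem (hZP i hi) _))))
        (P.mul_mem (natCast_mem P _) (P.mul_mem hv (h1 i hi)))
    have h4 : X ^ (2 * (k + 1)) - (S.card : A) * (((2 * k + 1 : ℕ) : A) * (K * v ^ (k + 1))) ∈ P := by
      have e : X ^ (2 * (k + 1)) - (S.card : A) * (((2 * k + 1 : ℕ) : A) * (K * v ^ (k + 1))) =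
          ∑ i ∈ S, (g i * X ^ (2 * k + 1) - ((2 * k + 1 : ℕ) : A) * (K * v ^ (k + 1))) := by
        rw [Finset.sum_sub_distrib, ← Finset.sum_mul, ← hX, Finset.sum_const, nsmul_eq_mul]
        ring
      rw [e]
      exact P.sum_mem h3
    have h5 : X ^ (2 * (k + 1)) - (((∏ j ∈ Finset.range (k + 1), (2 * j + 1)) *
        ∏ j ∈ Finset.range (k + 1), (n - 2 * j) : ℕ) : A) * v ^ (k + 1) =
        (X ^ (2 * (k + 1)) - (S.card : A) * (((2 * k + 1 : ℕ) : A) * (K * v ^ (k + 1)))) +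
        ((S.card - n : ℕ) : A) * (((2 * k + 1 : ℕ) : A) * (K * v ^ (k + 1))) := by
      rw [Finset.prod_range_succ, Finset.prod_range_succ' (fun j => n - 2 * j)]
      have e : ∀ j, n - 2 * (j + 1) = n - 2 - 2 * j := fun j => by omega
      simp only [e, hK, Nat.cast_sub hn, mul_zero, Nat.sub_zero]
      push_cast
      ring
    rw [h5]
    exact P.add_mem h4 (P.mul_mem (natCast_mem P _)
      (P.mul_mem (natCast_mem P _) (P.mul_mem (natCast_mem P _) (P.pow_mem hv _))))

/-- Nonnegative multiples of the characters of `ℤ × (ZMod q)ˣ`. -/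
def scaledCharacters (q : ℕ) : Submonoid (ℤ × (ZMod q)ˣ → ℂ) where
  carrier := {u | ∃ (c γ : ℝ) (χ : DirichletCharacter ℂ q), 0 ≤ c ∧
    ∀ t a, u (t, a) = c * Complex.exp (Complex.I * γ * t) * χ a}
  one_mem' := ⟨1, 0, 1, zero_le_one, fun t a => by simp⟩
  mul_mem' := by
    rintro u w ⟨c, γ, χ, hc, hu⟩ ⟨c', γ', χ', hc', hw⟩
    refine ⟨c * c', γ + γ', χ * χ', mul_nonneg hc hc', fun t a => ?_⟩
    simp only [Pi.mul_apply, hu, hw, MulChar.mul_apply]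
    push_cast
    rw [show Complex.I * (γ + γ') * t = Complex.I * γ * t + Complex.I * γ' * t by ring,
      Complex.exp_add]
    ring

/-- The closed cone generated by the characters of `ℤ × (ZMod q)ˣ`. -/
noncomputable def posCone (q : ℕ) : Subsemiring (ℤ × (ZMod q)ˣ → ℂ) :=
  (scaledCharacters q).subsemiringClosure.topologicalClosure

theorem mem_posCone_of_mem_scaledCharacters {q : ℕ} {u : ℤ × (ZMod q)ˣ → ℂ}
    (hu : u ∈ scaledCharacters q) : u ∈ posCone q :=
  subset_closure (by
    simpa [Submonoid.subsemiringClosure_eq_closure] using Subsemiring.subset_closure hu)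

theorem mem_posCone_of_hasSum {q : ℕ} {ι : Type*} {F : ι → ℤ × (ZMod q)ˣ → ℂ}
    {u : ℤ × (ZMod q)ˣ → ℂ} (hF : ∀ i, F i ∈ posCone q) (h : ∀ x, HasSum (fun i => F i x) (u x)) :
    u ∈ posCone q := by
  have h' : HasSum F u := Pi.hasSum.2 h
  have hc : IsClosed (posCone q : Set (ℤ × (ZMod q)ˣ → ℂ)) :=
    Subsemiring.isClosed_topologicalClosure _
  exact hc.mem_of_tendsto h' (Filter.Eventually.of_forall fun s => (posCone q).sum_mem
    fun i _ => hF i)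

theorem sum_units_re_nonneg {q : ℕ} [NeZero q] (χ : DirichletCharacter ℂ q) :
    ∃ r : ℝ, 0 ≤ r ∧ ∑ a : (ZMod q)ˣ, χ a = r := by
  by_cases h : ∀ a : (ZMod q)ˣ, χ a = 1
  · exact ⟨Fintype.card (ZMod q)ˣ, by positivity, by simp [h]⟩
  · push Not at h
    obtain ⟨b, hb⟩ := h
    refine ⟨0, le_rfl, ?_⟩
    have h1 : χ b * ∑ a : (ZMod q)ˣ, χ a = ∑ a : (ZMod q)ˣ, χ a := by
      rw [Finset.mul_sum]
      simp only [← map_mul, ← Units.val_mul]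
      exact Equiv.sum_comp (Equiv.mulLeft b) (fun a : (ZMod q)ˣ => χ a)
    have h2 : (χ b - 1) * ∑ a : (ZMod q)ˣ, χ a = 0 := by rw [sub_mul, h1]; ring
    rcases mul_eq_zero.1 h2 with h3 | h3
    · exact absurd (sub_eq_zero.1 h3) hb
    · simpa using h3

theorem posCone_sum_nonneg {q : ℕ} [NeZero q] {u : ℤ × (ZMod q)ˣ → ℂ} (hu : u ∈ posCone q)
    (M : ℕ) : 0 ≤ ∑ j ∈ Finset.range M, ∑ k ∈ Finset.range M, ∑ a : (ZMod q)ˣ,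
      (u ((j : ℤ) - k, a)).re := by
  have hc : IsClosed {u : ℤ × (ZMod q)ˣ → ℂ | 0 ≤ ∑ j ∈ Finset.range M, ∑ k ∈ Finset.range M,
      ∑ a : (ZMod q)ˣ, (u ((j : ℤ) - k, a)).re} := by
    refine isClosed_le continuous_const ?_
    refine continuous_finsetSum _ fun j _ => continuous_finsetSum _ fun k _ =>
      continuous_finsetSum _ fun a _ => Complex.continuous_re.comp (continuous_apply _)
  refine closure_minimal ?_ hc hu
  intro w hw
  replace hw : w ∈ AddSubmonoid.closure (scaledCharacters q : Set (ℤ × (ZMod q)ˣ → ℂ)) := hw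
  simp only [Set.mem_ofPred_eq]
  induction hw using AddSubmonoid.closure_induction with
  | mem w hw =>
    obtain ⟨c, γ, χ, hc, h⟩ := hw
    obtain ⟨r, hr, hs⟩ := sum_units_re_nonneg χ
    set z : ℂ := ∑ j ∈ Finset.range M, Complex.exp (Complex.I * γ * j) with hz
    have e : ∑ j ∈ Finset.range M, ∑ k ∈ Finset.range M, ∑ a : (ZMod q)ˣ, w ((j : ℤ) - k, a)
        = c * r * (z * conj z) := by
      have : ∀ j k : ℕ, ∑ a : (ZMod q)ˣ, w ((j : ℤ) - k, a) =
          c * r * (Complex.exp (Complex.I * γ * j) * conj (Complex.exp (Complex.I * γ * k))) := by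
        intro j k
        simp only [h, ← Finset.mul_sum, hs, ← Complex.exp_conj, ← Complex.exp_add, map_mul,
          Complex.conj_I, Complex.conj_ofReal, Complex.conj_natCast]
        push_cast
        rw [show Complex.I * γ * (j - k) = Complex.I * γ * j + -Complex.I * γ * k by ring]
        ring
      simp only [this, ← Finset.mul_sum, ← Finset.sum_mul, hz, map_sum]
    have e2 := congrArg Complex.re e
    rw [Complex.mul_conj] at e2
    simp only [Complex.re_sum] at e2
    rw [e2]
    have : ((c : ℂ) * r * (Complex.normSq z : ℝ)).re = c * r * Complex.normSq z := by
      norm_cast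
    rw [this]
    exact mul_nonneg (mul_nonneg hc hr) (Complex.normSq_nonneg _)
  | zero => simp
  | add x y _ _ hx hy =>
    simp only [Pi.add_apply, Complex.add_re, Finset.sum_add_distrib]
    exact add_nonneg hx hy

/-- `f` is an absolutely convergent sum of exponentials with nonnegative coefficients whose squares
sum to at least `v`. -/
def IsPosAlmostPeriodic (f : ℝ → ℂ) (v : ℝ) : Prop :=
  ∃ (ι : Type) (c γ : ι → ℝ), (∀ i, 0 ≤ c i) ∧ Summable c ∧
    (∀ t : ℝ, HasSum (fun i => (c i : ℂ) * Complex.exp (Complex.I * γ i * t)) (f t)) ∧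
    v ≤ ∑' i, c i ^ 2

theorem IsPosAlmostPeriodic.conj_eq {f : ℝ → ℂ} {v : ℝ} (h : IsPosAlmostPeriodic f v) (t : ℝ) :
    conj (f t) = f (-t) := by
  obtain ⟨ι, c, γ, hc, hs, hf, hv⟩ := h
  have h1 := Complex.hasSum_conj'.2 (hf t)
  refine h1.unique ?_
  convert hf (-t) using 2 with i
  simp [← Complex.exp_conj]

theorem IsPosAlmostPeriodic.norm_le {f : ℝ → ℂ} {v : ℝ} (h : IsPosAlmostPeriodic f v) (t : ℝ) :
    ‖f t‖ ≤ ‖f 0‖ := by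
  obtain ⟨ι, c, γ, hc, hs, hf, hv⟩ := h
  have h0 : f 0 = ((∑' i, c i : ℝ) : ℂ) := by
    refine (hf 0).unique ?_
    simpa using Complex.hasSum_ofReal.2 hs.hasSum
  rw [h0, Complex.norm_real, ← (hf t).tsum_eq, Real.norm_eq_abs, abs_of_nonneg (tsum_nonneg hc)]
  have e : ∀ i, ‖(c i : ℂ) * Complex.exp (Complex.I * γ i * t)‖ = c i := by
    intro i
    rw [norm_mul, Complex.norm_real, Real.norm_eq_abs, abs_of_nonneg (hc i),
      show Complex.I * γ i * t = ((γ i * t : ℝ) : ℂ) * Complex.I by push_cast; ring,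
      Complex.norm_exp_ofReal_mul_I, mul_one]
  refine (norm_tsum_le_tsum_norm (by simpa only [e] using hs)).trans ?_
  simp only [e]; exact le_rfl

theorem const_mem_posCone {q : ℕ} {c : ℝ} (hc : 0 ≤ c) :
    (fun _ => (c : ℂ) : ℤ × (ZMod q)ˣ → ℂ) ∈ posCone q :=
  mem_posCone_of_mem_scaledCharacters ⟨c, 0, 1, hc, fun t a => by simp⟩

theorem IsPosAlmostPeriodic.twist_mem {f : ℝ → ℂ} {v : ℝ} (h : IsPosAlmostPeriodic f v) {q : ℕ}
    (χ : DirichletCharacter ℂ q) :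
    (fun x => χ x.2 * f x.1 : ℤ × (ZMod q)ˣ → ℂ) ∈ posCone q := by
  obtain ⟨ι, c, γ, hc, hs, hf, hv⟩ := h
  refine mem_posCone_of_hasSum
    (F := fun i x => c i * Complex.exp (Complex.I * γ i * x.1) * χ x.2) ?_ ?_
  · exact fun i => mem_posCone_of_mem_scaledCharacters ⟨c i, γ i, χ, hc i, fun t a => rfl⟩
  · intro x
    have := (hf x.1).mul_right (χ x.2)
    rw [mul_comm (f _)] at this
    simpa using this

theorem hasSum_mul_of_summable_norm {ι : Type*} {f g : ι → ℂ} {s t : ℂ} (hf : HasSum f s)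
    (hg : HasSum g t) (hf' : Summable fun i => ‖f i‖) (hg' : Summable fun i => ‖g i‖) :
    HasSum (fun p : ι × ι => f p.1 * g p.2) (s * t) :=
  hf.mul hg (summable_mul_of_summable_norm hf' hg')

theorem IsPosAlmostPeriodic.mul_conj_sub_mem {f : ℝ → ℂ} {v : ℝ} (h : IsPosAlmostPeriodic f v)
    {q : ℕ} :
    (fun x => f x.1 * conj (f x.1) - v : ℤ × (ZMod q)ˣ → ℂ) ∈ posCone q := by
  obtain ⟨ι, c, γ, hc, hs, hf, hv⟩ := h
  classical
  have hs2 : Summable fun i => c i ^ 2 := by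
    have := hs.mul_of_nonneg hs hc hc
    have hinj : Function.Injective (fun i : ι => (i, i)) := fun i j hij => congrArg Prod.fst hij
    have h2 := this.comp_injective hinj
    simp only [sq]
    exact h2
  set V := ∑' i, c i ^ 2 with hV
  have hmain : (fun x => f x.1 * conj (f x.1) - V : ℤ × (ZMod q)ˣ → ℂ) ∈ posCone q := by
    refine mem_posCone_of_hasSum (F := fun (p : ι × ι) x => ((if p.1 = p.2 then 0 else c p.1 * c p.2 : ℝ) : ℂ)
      * Complex.exp (Complex.I * (γ p.1 - γ p.2 : ℝ) * x.1)) ?_ ?_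
    · intro p
      refine mem_posCone_of_mem_scaledCharacters ⟨_, γ p.1 - γ p.2, 1, ?_, fun t a => by simp; rfl⟩
      split_ifs
      · exact le_rfl
      · exact mul_nonneg (hc _) (hc _)
    · intro x
      have h1 := hf x.1
      have h2 := Complex.hasSum_conj'.2 h1
      have hn : ∀ t : ℝ, Summable fun i => ‖(c i : ℂ) * Complex.exp (Complex.I * γ i * t)‖ := by
        intro t
        convert hs using 2 with i
        rw [norm_mul, Complex.norm_real, Real.norm_eq_abs, abs_of_nonneg (hc i),
          show Complex.I * γ i * t = ((γ i * t : ℝ) : ℂ) * Complex.I by push_cast; ring,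
          Complex.norm_exp_ofReal_mul_I, mul_one]
      have hn' : Summable fun i => ‖conj ((c i : ℂ) * Complex.exp (Complex.I * γ i * (x.1 : ℝ)))‖ := by
        simp only [Complex.norm_conj]
        exact hn x.1
      have h3 := hasSum_mul_of_summable_norm h1 h2 (hn x.1) hn'
      have hd : HasSum (fun p : ι × ι => ((if p.1 = p.2 then c p.1 * c p.2 else 0 : ℝ) : ℂ)) V := by
        rw [Complex.hasSum_ofReal]
        have hinj : Function.Injective (fun i : ι => (i, i)) := fun i j hij => congrArg Prod.fst hij
        refine (hinj.hasSum_iff ?_).1 ?_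
        · rintro ⟨i, j⟩ hij
          refine if_neg fun h => hij ⟨i, ?_⟩
          simp only at h; rw [h]
        · have := hs2.hasSum
          simp only [sq] at this
          simpa only [Function.comp_def, if_true, hV, sq] using this
      refine (congrArg (fun F => HasSum F _) (funext fun p => ?_)).mpr (h3.sub hd)
      rcases p with ⟨i, j⟩
      by_cases hij : i = j
      · subst hij
        simp only [map_mul, Complex.conj_ofReal, ← Complex.exp_conj, Complex.conj_I]
        rw [mul_mul_mul_comm, ← Complex.exp_add]
        simp
      · simp only [if_neg hij, map_mul, Complex.conj_ofReal, ← Complex.exp_conj, Complex.conj_I]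
        rw [mul_mul_mul_comm, ← Complex.exp_add]
        push_cast
        ring_nf
  have := (posCone q).add_mem hmain (const_mem_posCone (q := q) (sub_nonneg.2 hv))
  convert this using 1
  ext x
  simp

theorem card_filter_abs_sub_lt_le (M t₀ j : ℕ) :
    ((Finset.range M).filter (fun k : ℕ => |(j : ℤ) - k| < t₀)).card ≤ 2 * t₀ := by
  have : ((Finset.range M).filter (fun k : ℕ => |(j : ℤ) - k| < t₀)) ⊆ Finset.Ico (j + 1 - t₀) (j + t₀) := by
    intro k hk
    simp only [Finset.mem_filter, Finset.mem_range, Finset.mem_Ico, abs_lt] at hk ⊢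
    omega
  refine (Finset.card_le_card this).trans ?_
  rw [Nat.card_Ico]; omega

theorem exists_nat_ge_of_sum_sub_nonneg {A : ℤ → ℝ} {K D : ℝ} {M t₀ : ℕ} (h0 : t₀ < M)
    (hA : ∀ t, 0 ≤ A t) (hsym : ∀ t, A (-t) = A t) (hD : ∀ t, A t ≤ D)
    (hsum : 0 ≤ ∑ j ∈ Finset.range M, ∑ k ∈ Finset.range M, (A ((j : ℤ) - k) - K)) :
    ∃ t : ℕ, t₀ ≤ t ∧ t < M ∧ K - 2 * t₀ * D / M ≤ A t := by
  obtain ⟨t, ht, hmax⟩ := Finset.exists_max_image (Finset.Ico t₀ M) (fun t : ℕ => A t)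
    ⟨t₀, by simp [h0]⟩
  rw [Finset.mem_Ico] at ht
  refine ⟨t, ht.1, ht.2, ?_⟩
  have hM : (0 : ℝ) < M := by exact_mod_cast (Nat.zero_le _).trans_lt h0
  have hD0 : 0 ≤ D := (hA 0).trans (hD 0)
  have hrow : ∀ j ∈ Finset.range M, ∑ k ∈ Finset.range M, A ((j : ℤ) - k) ≤ 2 * t₀ * D + M * A t := by
    intro j hj
    rw [Finset.mem_range] at hj
    have hle : ∀ k ∈ Finset.range M, A ((j : ℤ) - k) ≤
        (if |(j : ℤ) - k| < t₀ then D else 0) + A t := by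
      intro k hk
      rw [Finset.mem_range] at hk
      split_ifs with h
      · linarith [hD ((j : ℤ) - k), hA t]
      · have h1 : A ((j : ℤ) - k) = A ((((j : ℤ) - k).natAbs : ℕ) : ℤ) := by
          rw [Int.natCast_natAbs]
          rcases abs_choice ((j : ℤ) - k) with h2 | h2
          · rw [h2]
          · rw [h2, hsym]
        rw [h1, zero_add]
        refine hmax _ ?_
        rw [Finset.mem_Ico]
        constructor <;> (rw [abs_lt] at h; omega)
    refine (Finset.sum_le_sum hle).trans ?_
    rw [Finset.sum_add_distrib, ← Finset.sum_filter, Finset.sum_const, Finset.sum_const,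
      Finset.card_range, nsmul_eq_mul, nsmul_eq_mul]
    have := card_filter_abs_sub_lt_le M t₀ j
    have h2 : (((Finset.range M).filter (fun k : ℕ => |(j : ℤ) - k| < t₀)).card : ℝ) ≤ 2 * t₀ := by
      exact_mod_cast this
    gcongr
  have htot := Finset.sum_le_sum hrow
  simp only [Finset.sum_sub_distrib, Finset.sum_const, Finset.card_range, nsmul_eq_mul] at hsum htot
  have h1 : (M : ℝ) * (M * K) ≤ M * (2 * t₀ * D + M * A t) := by linarith
  have h2 : (M : ℝ) * K ≤ 2 * t₀ * D + M * A t := le_of_mul_le_mul_left h1 hM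
  rw [sub_le_iff_le_add, ← sub_le_iff_le_add', le_div_iff₀ hM]
  linarith

theorem sum_units_eq_ite {q : ℕ} [NeZero q] (χ : DirichletCharacter ℂ q) [Decidable (χ = 1)] :
    ∑ a : (ZMod q)ˣ, χ a = if χ = 1 then (q.totient : ℂ) else 0 := by
  split_ifs with h
  · simp [h, ZMod.card_units_eq_totient]
  · obtain ⟨b, hb⟩ := MulChar.ne_one_iff.1 h
    have h1 : χ b * ∑ a : (ZMod q)ˣ, χ a = ∑ a : (ZMod q)ˣ, χ a := by
      rw [Finset.mul_sum]
      simp only [← map_mul, ← Units.val_mul]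
      exact Equiv.sum_comp (Equiv.mulLeft b) (fun a : (ZMod q)ˣ => χ a)
    have h2 : (χ b - 1) * ∑ a : (ZMod q)ˣ, χ a = 0 := by rw [sub_mul, h1]; ring
    exact (mul_eq_zero.1 h2).resolve_left (sub_ne_zero.2 hb)

theorem conj_dirichletCharacter_unit {q : ℕ} [NeZero q] (χ : DirichletCharacter ℂ q)
    (a : (ZMod q)ˣ) : conj (χ a) = χ⁻¹ a := by
  have := MulChar.star_apply' χ (a : ZMod q)
  simpa using this

/-- Parseval's identity for characters. -/
theorem sum_units_mul_conj {q : ℕ} [NeZero q] (S : Finset (DirichletCharacter ℂ q))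
    (f : DirichletCharacter ℂ q → ℂ) :
    ∑ a : (ZMod q)ˣ, (∑ χ ∈ S, χ a * f χ) * conj (∑ χ ∈ S, χ a * f χ) =
      q.totient * ∑ χ ∈ S, f χ * conj (f χ) := by
  classical
  have : ∀ a : (ZMod q)ˣ, (∑ χ ∈ S, χ a * f χ) * conj (∑ χ ∈ S, χ a * f χ) =
      ∑ χ ∈ S, ∑ χ' ∈ S, (f χ * conj (f χ')) * (χ * χ'⁻¹) a := by
    intro a
    rw [map_sum, Finset.sum_mul_sum]
    refine Finset.sum_congr rfl fun χ _ => Finset.sum_congr rfl fun χ' _ => ?_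
    rw [map_mul, conj_dirichletCharacter_unit, MulChar.mul_apply]
    ring
  simp only [this]
  rw [Finset.sum_comm, Finset.mul_sum]
  refine Finset.sum_congr rfl fun χ hχ => ?_
  rw [Finset.sum_comm]
  simp only [← Finset.mul_sum, sum_units_eq_ite, mul_inv_eq_one]
  rw [Finset.sum_eq_single χ]
  · simp [mul_comm]
  · intro b _ hb; simp [hb.symm]
  · intro h; exact absurd hχ h

theorem exists_large_even_moment {q : ℕ} [NeZero q] (f : DirichletCharacter ℂ q → ℝ → ℂ) {v L : ℝ}
    (hv : 0 ≤ v) (hf : ∀ χ ≠ 1, IsPosAlmostPeriodic (f χ) v)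
    (hconj : ∀ χ ≠ 1, ∀ t, f χ⁻¹ t = conj (f χ t)) (hL : ∀ χ ≠ 1, ‖f χ 0‖ ≤ L)
    (m : ℕ) (hm : 1 ≤ m) {M t₀ : ℕ} (h0 : t₀ < M) :
    ∃ t : ℕ, t₀ ≤ t ∧ t < M ∧ ∃ r : (ZMod q)ˣ → ℝ,
      (∀ a : (ZMod q)ˣ, ∑ χ ∈ Finset.univ.erase 1, χ a * f χ t = r a) ∧
      (q.totient : ℝ) * ((((∏ j ∈ Finset.range m, (2 * j + 1)) *
        ∏ j ∈ Finset.range m, ((q.totient - 1) - 2 * j) : ℕ) : ℝ) * v ^ m)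
        - 2 * t₀ * ((q.totient : ℝ) * L) ^ (2 * m) / M ≤ ∑ a, r a ^ (2 * m) := by
  classical
  set S : Finset (DirichletCharacter ℂ q) := Finset.univ.erase 1 with hS
  have hmemS : ∀ χ, χ ∈ S ↔ χ ≠ 1 := fun χ => by simp [hS]
  set X : ℝ → (ZMod q)ˣ → ℂ := fun t a => ∑ χ ∈ S, χ a * f χ t with hX
  have hcardS : S.card = q.totient - 1 := by
    rw [hS, Finset.card_erase_of_mem (Finset.mem_univ _), Finset.card_univ, ← Nat.card_eq_fintype_card,
      DirichletCharacter.card_eq_totient_of_hasEnoughRootsOfUnity]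
  have hinv : ∀ χ ∈ S, χ⁻¹ ∈ S := fun χ hχ => by
    rw [hmemS] at hχ ⊢; simpa using hχ
  have hXreal : ∀ t a, conj (X t a) = X t a := by
    intro t a
    simp only [hX, map_sum, map_mul, conj_dirichletCharacter_unit]
    refine Finset.sum_nbij' (fun χ => χ⁻¹) (fun χ => χ⁻¹) hinv hinv (by simp) (by simp) ?_
    intro χ hχ
    rw [hconj χ ((hmemS χ).1 hχ)]
  have hXneg : ∀ t a, X (-t) a = X t a⁻¹ := by
    intro t a
    rw [← hXreal]
    simp only [hX, map_sum, map_mul, conj_dirichletCharacter_unit]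
    refine Finset.sum_congr rfl fun χ hχ => ?_
    rw [(hf χ ((hmemS χ).1 hχ)).conj_eq, neg_neg, MulChar.inv_apply, Ring.inverse_unit]
  choose r hr using fun t a => Complex.conj_eq_iff_real.1 (hXreal t a)
  have hrneg : ∀ t a, r (-t) a = r t a⁻¹ := by
    intro t a
    have := hXneg t a
    rw [hr, hr] at this
    exact_mod_cast this
  set A : ℤ → ℝ := fun t => ∑ a, r t a ^ (2 * m) with hA
  set K0 : ℝ := (((∏ j ∈ Finset.range m, (2 * j + 1)) *
        ∏ j ∈ Finset.range m, ((q.totient - 1) - 2 * j) : ℕ) : ℝ) * v ^ m with hK0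
  have hL' : ∀ χ ∈ S, ∀ t, ‖f χ t‖ ≤ L := fun χ hχ t =>
    ((hf χ ((hmemS χ).1 hχ)).norm_le t).trans (hL χ ((hmemS χ).1 hχ))
  have hcardle : (S.card : ℝ) ≤ q.totient := by rw [hcardS]; exact_mod_cast Nat.sub_le _ _
  have hDbound : ∀ t : ℤ, A t ≤ ((q.totient : ℝ) * L) ^ (2 * m) := by
    intro t
    rcases S.eq_empty_or_nonempty with hSe | ⟨χ0, hχ0⟩
    · have : ∀ a, r t a = 0 := by
        intro a
        have := hr t a
        simp only [hX, hSe, Finset.sum_empty] at this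
        exact_mod_cast this.symm
      simp only [hA, this]
      rw [zero_pow (by omega), Finset.sum_const_zero]
      exact Even.pow_nonneg (by simp) _
    have hL0 : 0 ≤ L := (norm_nonneg _).trans (hL' χ0 hχ0 0)
    have h1 : ∀ a, |r t a| ≤ q.totient * L := by
      intro a
      rw [← Real.norm_eq_abs, ← Complex.norm_real, ← hr]
      refine (norm_sum_le _ _).trans ?_
      calc ∑ χ ∈ S, ‖χ a * f χ t‖ ≤ ∑ χ ∈ S, L := by
            refine Finset.sum_le_sum fun χ hχ => ?_
            rw [norm_mul]
            calc _ ≤ 1 * L := mul_le_mul (χ.norm_le_one _) (hL' χ hχ t) (norm_nonneg _) zero_le_one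
              _ = L := one_mul _
        _ ≤ _ := by
            rw [Finset.sum_const, nsmul_eq_mul]
            gcongr
    have h2 : ∑ a, r t a ^ 2 ≤ (q.totient * L) ^ 2 := by
      have hp := sum_units_mul_conj S (fun χ => f χ t)
      have e1 : ∀ a : (ZMod q)ˣ, (∑ χ ∈ S, χ a * f χ t) * conj (∑ χ ∈ S, χ a * f χ t) =
          ((r t a ^ 2 : ℝ) : ℂ) := by
        intro a
        have h3 := hXreal t a
        have h4 := hr t a
        simp only [hX] at h3 h4
        rw [h3, h4]; push_cast; ring
      simp only [e1, Complex.mul_conj] at hp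
      have hp' : ∑ a, r t a ^ 2 = q.totient * ∑ χ ∈ S, Complex.normSq (f χ t) := by exact_mod_cast hp
      rw [hp']
      calc (q.totient : ℝ) * ∑ χ ∈ S, Complex.normSq (f χ t) ≤ q.totient * ∑ χ ∈ S, L ^ 2 := by
            gcongr with χ hχ
            rw [Complex.normSq_eq_norm_sq]
            exact pow_le_pow_left₀ (norm_nonneg _) (hL' χ hχ t) 2
        _ ≤ _ := by
            rw [Finset.sum_const, nsmul_eq_mul]
            calc (q.totient : ℝ) * (S.card * L ^ 2) ≤ q.totient * (q.totient * L ^ 2) := by gcongr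
              _ = _ := by ring
    obtain ⟨k, rfl⟩ : ∃ k, m = k + 1 := ⟨m - 1, by omega⟩
    calc A t = ∑ a, |r t a| ^ (2 * k) * r t a ^ 2 := by
          refine Finset.sum_congr rfl fun a _ => ?_
          rw [pow_mul |r t a|, sq_abs]; ring
      _ ≤ ∑ a, (q.totient * L) ^ (2 * k) * r t a ^ 2 := by
          gcongr with a
          exact h1 a
      _ ≤ (q.totient * L) ^ (2 * k) * (q.totient * L) ^ 2 := by
          rw [← Finset.mul_sum]; gcongr
      _ = _ := by ring
  have hcone : (fun x => X x.1 x.2 ^ (2 * m) - K0 : ℤ × (ZMod q)ˣ → ℂ) ∈ posCone q := by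
    have := pow_sum_sub_mem_subsemiring (posCone q)
      (fun (χ : DirichletCharacter ℂ q) (x : ℤ × (ZMod q)ˣ) => χ x.2 * f χ x.1) (fun χ => χ⁻¹)
      inv_inv (const_mem_posCone (q := q) hv) m S (q.totient - 1) hcardS.ge hinv
      (fun χ hχ => (hf χ ((hmemS χ).1 hχ)).twist_mem χ) ?_
    · convert this using 1
      ext x
      simp only [hX, hK0]
      push_cast
      simp [Finset.sum_apply]
    · intro χ hχ
      convert (hf χ ((hmemS χ).1 hχ)).mul_conj_sub_mem (q := q) using 1
      ext x
      simp only [Pi.sub_apply, Pi.mul_apply, sub_left_inj]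
      rw [hconj χ ((hmemS χ).1 hχ), ← conj_dirichletCharacter_unit]
      have : χ x.2 * conj (χ x.2) = 1 := by
        rw [conj_dirichletCharacter_unit, ← MulChar.mul_apply]; simp
      linear_combination (f χ x.1 * conj (f χ x.1)) * this
  have hpos := posCone_sum_nonneg hcone M
  obtain ⟨t, ht1, ht2, ht3⟩ := exists_nat_ge_of_sum_sub_nonneg (A := A)
    (K := q.totient * K0) (D := ((q.totient : ℝ) * L) ^ (2 * m)) h0
    (fun t => Finset.sum_nonneg fun a _ => by rw [pow_mul]; positivity)
    (fun t => by
      simp only [hA]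
      push_cast
      simp only [hrneg]
      exact Equiv.sum_comp (Equiv.inv _) (fun a => r t a ^ (2 * m))) hDbound (by
      convert hpos using 4 with j _ k _
      rw [show (q.totient : ℝ) * K0 = ∑ a : (ZMod q)ˣ, K0 by
        simp [ZMod.card_units_eq_totient], ← Finset.sum_sub_distrib]
      refine Finset.sum_congr rfl fun a _ => ?_
      simp only [hr]
      norm_cast)
  refine ⟨t, ht1, ht2, r t, fun a => hr t a, ?_⟩
  simpa [hA] using ht3

/-- The bilateral Laplace transform. -/
noncomputable def bilap (f : ℝ → ℂ) (w : ℂ) : ℂ := ∫ t : ℝ, Complex.exp (-w * t) * f t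

theorem norm_exp_neg_mul_ofReal (w : ℂ) (t : ℝ) :
    ‖Complex.exp (-w * t)‖ = Real.exp (-w.re * t) := by
  rw [Complex.norm_exp]; simp

theorem bilap_differentiableOn {f : ℝ → ℂ} {a b : ℝ} (hf : AEStronglyMeasurable f)
    (h : ∀ σ ∈ Set.Ioo a b, Integrable fun t : ℝ => Real.exp (-σ * t) * ‖f t‖) :
    DifferentiableOn ℂ (bilap f) {w | w.re ∈ Set.Ioo a b} := by
  intro w₀ hw₀
  have hw : a < w₀.re ∧ w₀.re < b := hw₀
  obtain ⟨r, hr, hr1, hr2⟩ : ∃ r > 0, a < w₀.re - 2 * r ∧ w₀.re + 2 * r < b :=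
    ⟨min (w₀.re - a) (b - w₀.re) / 4, by have := lt_min (sub_pos.2 hw.1) (sub_pos.2 hw.2); linarith,
      by have := min_le_left (w₀.re - a) (b - w₀.re); linarith [hw.1],
      by have := min_le_right (w₀.re - a) (b - w₀.re); linarith [hw.2]⟩
  have hb1 := h (w₀.re - 2 * r) ⟨hr1, by linarith⟩
  have hb2 := h (w₀.re + 2 * r) ⟨by linarith, hr2⟩
  have hb0 := h w₀.re hw
  have hexp : Continuous fun p : ℂ × ℝ => Complex.exp (-p.1 * p.2) := by fun_prop
  have hmeas : ∀ w : ℂ, AEStronglyMeasurable (fun t : ℝ => Complex.exp (-w * t)) :=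
    fun w => (by fun_prop : Continuous fun t : ℝ => Complex.exp (-w * t)).aestronglyMeasurable
  have key := hasDerivAt_integral_of_dominated_loc_of_deriv_le (μ := volume)
    (F := fun (w : ℂ) (t : ℝ) => Complex.exp (-w * t) * f t)
    (F' := fun (w : ℂ) (t : ℝ) => -(t : ℂ) * Complex.exp (-w * t) * f t) (x₀ := w₀)
    (s := Metric.ball w₀ r)
    (bound := fun t => r⁻¹ * (Real.exp (-(w₀.re - 2 * r) * t) * ‖f t‖ +
      Real.exp (-(w₀.re + 2 * r) * t) * ‖f t‖)) (Metric.ball_mem_nhds _ hr)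
    (Filter.Eventually.of_forall fun w => (hmeas w).mul hf) ?_ ?_ ?_ ((hb1.add hb2).const_mul _) ?_
  · exact key.2.differentiableAt.differentiableWithinAt
  · refine hb0.mono' ((hmeas _).mul hf) (Filter.Eventually.of_forall fun t => ?_)
    rw [norm_mul, norm_exp_neg_mul_ofReal]
  · exact ((Complex.continuous_ofReal.neg.aestronglyMeasurable).mul (hmeas _)).mul hf
  · refine Filter.Eventually.of_forall fun t w hwb => ?_
    rw [norm_mul, norm_mul, norm_exp_neg_mul_ofReal, norm_neg, Complex.norm_real, Real.norm_eq_abs,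
      ← add_mul, ← mul_assoc]
    refine mul_le_mul_of_nonneg_right ?_ (norm_nonneg _)
    have hre : |w.re - w₀.re| < r := by
      have h1 := Complex.abs_re_le_norm (w - w₀)
      rw [Metric.mem_ball, dist_eq_norm] at hwb
      simpa using h1.trans_lt hwb
    have h1 : |t| ≤ r⁻¹ * Real.exp (r * |t|) := by
      rw [inv_mul_eq_div, le_div_iff₀ hr]
      have := Real.add_one_le_exp (r * |t|)
      linarith
    have h2 : Real.exp (-w.re * t) ≤ Real.exp (-w₀.re * t + r * |t|) := by
      apply Real.exp_le_exp.2
      have : (w₀.re - w.re) * t ≤ r * |t| := by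
        refine (le_abs_self _).trans ?_
        rw [abs_mul, abs_sub_comm]
        gcongr
      linarith
    have h3 : Real.exp (-w₀.re * t + 2 * r * |t|) ≤ Real.exp (-(w₀.re - 2 * r) * t) +
        Real.exp (-(w₀.re + 2 * r) * t) := by
      rcases abs_cases t with ⟨h, _⟩ | ⟨h, _⟩ <;> rw [h]
      · refine le_add_of_le_of_nonneg (Real.exp_le_exp.2 (by linarith)) (Real.exp_pos _).le
      · refine le_add_of_nonneg_of_le (Real.exp_pos _).le (Real.exp_le_exp.2 (by linarith))
    calc |t| * Real.exp (-w.re * t)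
        ≤ (r⁻¹ * Real.exp (r * |t|)) * Real.exp (-w₀.re * t + r * |t|) := by gcongr
      _ = r⁻¹ * Real.exp (-w₀.re * t + 2 * r * |t|) := by
          rw [mul_assoc, ← Real.exp_add]; ring_nf
      _ ≤ _ := by gcongr
  · refine Filter.Eventually.of_forall fun t w _ => ?_
    have h1 : HasDerivAt (fun w : ℂ => -w * (t : ℂ)) (-(t : ℂ)) w := by
      simpa using (hasDerivAt_neg w).mul_const (t : ℂ)
    have := h1.cexp.mul_const (f t)
    rw [mul_comm (-(t : ℂ))]
    exact this

theorem integrable_exp_neg_abs {c : ℝ} (hc : 0 < c) : Integrable fun t : ℝ => Real.exp (-c * |t|) := by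
  rw [← integrableOn_univ, ← Set.Iic_union_Ioi (a := (0 : ℝ))]
  refine IntegrableOn.union ?_ ?_
  · refine (integrableOn_exp_mul_Iic hc 0).congr_fun (fun t ht => ?_) measurableSet_Iic
    simp only [abs_of_nonpos (Set.mem_Iic.1 ht)]; ring_nf
  · refine (integrableOn_exp_mul_Ioi (neg_lt_zero.2 hc) 0).congr_fun (fun t ht => ?_)
      measurableSet_Ioi
    simp only [abs_of_pos (Set.mem_Ioi.1 ht)]

theorem integrable_exp_mul_norm {f : ℝ → ℂ} {a C σ : ℝ} (hf : AEStronglyMeasurable f)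
    (h : ∀ t, ‖f t‖ ≤ C * Real.exp (-a * |t|)) (hσ : |σ| < a) :
    Integrable fun t : ℝ => Real.exp (-σ * t) * ‖f t‖ := by
  refine ((integrable_exp_neg_abs (sub_pos.2 hσ)).const_mul C).mono'
    (((by fun_prop : Continuous fun t : ℝ => Real.exp (-σ * t)).aestronglyMeasurable).mul hf.norm)
    (Filter.Eventually.of_forall fun t => ?_)
  rw [norm_mul, norm_norm, Real.norm_eq_abs, Real.abs_exp]
  have h1 : -σ * t ≤ |σ| * |t| := by
    rw [← abs_mul, neg_mul]; exact neg_le_abs _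
  calc Real.exp (-σ * t) * ‖f t‖ ≤ Real.exp (|σ| * |t|) * (C * Real.exp (-a * |t|)) := by
        gcongr; exact h t
    _ = C * Real.exp (-(a - |σ|) * |t|) := by
        rw [mul_left_comm, ← Real.exp_add]; ring_nf

theorem integrable_exp_mul {f : ℝ → ℂ} (hf : AEStronglyMeasurable f) {w : ℂ}
    (h : Integrable fun t : ℝ => Real.exp (-w.re * t) * ‖f t‖) :
    Integrable fun t : ℝ => Complex.exp (-w * t) * f t := by
  refine h.mono' (((by fun_prop : Continuous fun t : ℝ =>
    Complex.exp (-w * t)).aestronglyMeasurable).mul hf) (Filter.Eventually.of_forall fun t => ?_)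
  rw [norm_mul, norm_exp_neg_mul_ofReal]

theorem bilap_comp_sub (f : ℝ → ℂ) (w : ℂ) (u : ℝ) :
    ∫ t : ℝ, Complex.exp (-w * t) * f (t - u) = Complex.exp (-w * u) * bilap f w := by
  rw [← integral_add_right_eq_self _ u, bilap, ← integral_const_mul]
  congr 1 with t
  rw [add_sub_cancel_right, ← mul_assoc, ← Complex.exp_add]
  push_cast; ring_nf

theorem bilap_comp_neg (f : ℝ → ℂ) (w : ℂ) : bilap (fun t => f (-t)) w = bilap f (-w) := by
  rw [bilap, bilap, ← integral_neg_eq_self]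
  congr 1 with t
  push_cast
  simp

section
variable {δ : ℝ} {η : ℝ → ℝ}

theorem MemS.even (hη : MemS δ η) (t : ℝ) : η (-t) = η t := hη.2.2.1 t

theorem MemS.continuous (hη : MemS δ η) : Continuous η := hη.2.1.continuous

theorem MemS.exists_bound (hη : MemS δ η) : ∃ C > 0, ∀ t : ℝ,
    |η t| ≤ C * Real.exp (-(1/2 + δ) * |t|) ∧ |deriv η t| ≤ C * Real.exp (-(1/2 + δ) * |t|) :=
  hη.2.2.2.1

theorem MemS.bilap_neg (hη : MemS δ η) (w : ℂ) :
    bilap (fun t => (η t : ℂ)) (-w) = bilap (fun t => (η t : ℂ)) w := by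
  rw [← bilap_comp_neg]; simp [hη.even]

theorem MemS.integrable_exp_mul_norm (hη : MemS δ η) {σ : ℝ} (hσ : |σ| < 1/2 + δ) :
    Integrable fun t : ℝ => Real.exp (-σ * t) * ‖(η t : ℂ)‖ := by
  obtain ⟨C, hC, h⟩ := hη.exists_bound
  exact _root_.integrable_exp_mul_norm
    (Complex.continuous_ofReal.comp hη.continuous).aestronglyMeasurable
    (fun t => by simpa using (h t).1) hσ

theorem MemS.integrable (hδ : 0 < δ) (hη : MemS δ η) : Integrable η := by
  have := hη.integrable_exp_mul_norm (σ := 0) (by simp; linarith)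
  simp only [neg_zero, zero_mul, Real.exp_zero, one_mul, Complex.norm_real] at this
  exact (integrable_norm_iff hη.continuous.aestronglyMeasurable).1 this

theorem MemS.bilap_differentiableOn (hη : MemS δ η) :
    DifferentiableOn ℂ (bilap fun t => (η t : ℂ)) {w | w.re ∈ Set.Ioo (-(1/2 + δ)) (1/2 + δ)} :=
  _root_.bilap_differentiableOn (Complex.continuous_ofReal.comp hη.continuous).aestronglyMeasurable
    fun _ hσ => hη.integrable_exp_mul_norm (abs_lt.2 hσ)

theorem MemS.bilap_I_mul (hδ : 0 < δ) (hη : MemS δ η) (y : ℝ) :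
    bilap (fun t => (η t : ℂ)) (Complex.I * y) = fourierR η (y / (2 * Real.pi)) := by
  have h1 : ∀ s : ℝ, (s = 1 ∨ s = -1) → bilap (fun t => (η t : ℂ)) (Complex.I * y) =
      ∫ t : ℝ, Complex.exp (s * y * t * Complex.I) * η t := by
    rintro s (rfl | rfl)
    · rw [← hη.bilap_neg, bilap]
      congr 1 with t; push_cast; ring_nf
    · rw [bilap]
      congr 1 with t; push_cast; ring_nf
  have hint : ∀ s : ℝ, Integrable fun t : ℝ => Complex.exp (s * y * t * Complex.I) * η t := by
    intro s
    have := integrable_exp_mul (Complex.continuous_ofReal.comp hη.continuous).aestronglyMeasurable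
      (w := -(s * y * Complex.I)) (hη.integrable_exp_mul_norm (by
        simp; linarith))
    refine this.congr (ae_of_all _ fun t => ?_)
    simp only [Function.comp, neg_neg]; ring_nf
  have h2 := (integral_add (hint 1) (hint (-1)))
  rw [← h1 1 (Or.inl rfl), ← h1 (-1) (Or.inr rfl)] at h2
  have h3 : (2 : ℂ) * bilap (fun t => (η t : ℂ)) (Complex.I * y) =
      2 * (fourierR η (y / (2 * Real.pi)) : ℂ) := by
    rw [two_mul, ← h2, fourierR, ← integral_complex_ofReal, ← integral_const_mul]
    congr 1 with t
    have e : 2 * Real.pi * (y / (2 * Real.pi)) * t = y * t := by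
      field_simp [Real.pi_ne_zero]
    rw [e]
    push_cast
    rw [Complex.cos]
    ring_nf
  exact mul_left_cancel₀ two_ne_zero h3

end

theorem summable_vonMangoldt_rpow {d : ℝ} (hd : 0 < d) :
    Summable fun n : ℕ => vonMangoldt n * (n : ℝ) ^ (-(1 + d)) := by
  have h := (ArithmeticFunction.LSeriesSummable_vonMangoldt (s := ((1 + d : ℝ) : ℂ))
    (by simpa using hd)).norm
  refine h.congr fun n => ?_
  rcases eq_or_ne n 0 with rfl | hn
  · simp
  rw [LSeries.norm_term_eq, if_neg hn]
  simp only [Complex.norm_real, Complex.ofReal_re, Real.norm_eq_abs,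
    abs_of_nonneg ArithmeticFunction.vonMangoldt_nonneg]
  rw [Real.rpow_neg (Nat.cast_nonneg n), div_eq_mul_inv]

section
variable {δ C : ℝ} {η : ℝ → ℝ}

theorem vonMangoldt_term_le (hC : 0 ≤ C) (hη : ∀ u, |η u| ≤ C * Real.exp (-(1/2 + δ) * |u|)) {d : ℝ} (hd : 0 < d)
    (hdδ : d ≤ δ) (n : ℕ) (t : ℝ) :
    vonMangoldt n / Real.sqrt n * |η (Real.log n - t)| ≤
      C * Real.exp ((1/2 + d) * t) * (vonMangoldt n * (n : ℝ) ^ (-(1 + d))) := by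
  rcases eq_or_ne n 0 with rfl | hn
  · simp
  have hn' : (0 : ℝ) < n := by positivity
  have h1 : |η (Real.log n - t)| ≤ C * Real.exp (-(1/2 + d) * (Real.log n - t)) := by
    refine (hη _).trans (mul_le_mul_of_nonneg_left (Real.exp_le_exp.2 ?_) hC)
    have h2 := le_abs_self (Real.log n - t)
    have h3 := abs_nonneg (Real.log n - t)
    nlinarith
  have h4 : (Real.sqrt n)⁻¹ = Real.exp (-(1/2) * Real.log n) := by
    rw [Real.sqrt_eq_rpow, ← Real.rpow_neg hn'.le, Real.rpow_def_of_pos hn']; ring_nf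
  have h5 : (n : ℝ) ^ (-(1 + d)) = Real.exp (-(1 + d) * Real.log n) := by
    rw [Real.rpow_def_of_pos hn']; ring_nf
  calc vonMangoldt n / Real.sqrt n * |η (Real.log n - t)|
      ≤ vonMangoldt n / Real.sqrt n * (C * Real.exp (-(1/2 + d) * (Real.log n - t))) := by
        gcongr
    _ = C * vonMangoldt n *
        (Real.exp (-(1/2) * Real.log n) * Real.exp (-(1/2 + d) * (Real.log n - t))) := by
        rw [div_eq_mul_inv, h4]; ring
    _ = C * vonMangoldt n * (Real.exp ((1/2 + d) * t) * Real.exp (-(1 + d) * Real.log n)) := by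
        rw [← Real.exp_add, ← Real.exp_add]; ring_nf
    _ = _ := by rw [h5]; ring

end

/-- The twisted sum `∑ Λ(n) χ(n) n^{-1/2} η(log n - t)`. -/
noncomputable def psiChar (η : ℝ → ℝ) {N : ℕ} (χ : DirichletCharacter ℂ N) (t : ℝ) : ℂ :=
  ∑' n : ℕ, χ n * ((vonMangoldt n / Real.sqrt n * η (Real.log n - t) : ℝ) : ℂ)

section
variable {δ C : ℝ} {η : ℝ → ℝ} {N : ℕ} (χ : DirichletCharacter ℂ N)

theorem norm_psiChar_term_le (hC : 0 ≤ C) (hη : ∀ u, |η u| ≤ C * Real.exp (-(1/2 + δ) * |u|))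
    {d : ℝ} (hd : 0 < d) (hdδ : d ≤ δ) (n : ℕ) (t : ℝ) :
    ‖χ n * ((vonMangoldt n / Real.sqrt n * η (Real.log n - t) : ℝ) : ℂ)‖ ≤
      C * Real.exp ((1/2 + d) * t) * (vonMangoldt n * (n : ℝ) ^ (-(1 + d))) := by
  refine le_trans ?_ (vonMangoldt_term_le hC hη hd hdδ n t)
  rw [norm_mul, Complex.norm_real, Real.norm_eq_abs, abs_mul,
    abs_of_nonneg (div_nonneg ArithmeticFunction.vonMangoldt_nonneg (Real.sqrt_nonneg _))]
  exact mul_le_of_le_one_left (mul_nonneg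
    (div_nonneg ArithmeticFunction.vonMangoldt_nonneg (Real.sqrt_nonneg _)) (abs_nonneg _))
    (χ.norm_le_one _)

theorem summable_psiChar (hδ : 0 < δ) (hC : 0 ≤ C)
    (hη : ∀ u, |η u| ≤ C * Real.exp (-(1/2 + δ) * |u|)) (t : ℝ) :
    Summable fun n : ℕ => χ n * ((vonMangoldt n / Real.sqrt n * η (Real.log n - t) : ℝ) : ℂ) :=
  Summable.of_norm_bounded ((summable_vonMangoldt_rpow hδ).mul_left _)
    fun n => norm_psiChar_term_le χ hC hη hδ le_rfl n t

theorem norm_psiChar_le (hC : 0 ≤ C) (hη : ∀ u, |η u| ≤ C * Real.exp (-(1/2 + δ) * |u|))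
    {d : ℝ} (hd : 0 < d) (hdδ : d ≤ δ) (t : ℝ) :
    ‖psiChar η χ t‖ ≤ C * (∑' n : ℕ, vonMangoldt n * (n : ℝ) ^ (-(1 + d))) *
      Real.exp ((1/2 + d) * t) := by
  refine (tsum_of_norm_bounded ((summable_vonMangoldt_rpow hd).mul_left _).hasSum
    fun n => norm_psiChar_term_le χ hC hη hd hdδ n t).trans (le_of_eq ?_)
  rw [tsum_mul_left]; ring

theorem continuous_psiChar (hδ : 0 < δ) (hη : MemS δ η) : Continuous (psiChar η χ) := by
  obtain ⟨C, hC, hb⟩ := hη.exists_bound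
  rw [continuous_iff_continuousAt]
  intro t₀
  have : ContinuousOn (psiChar η χ) (Set.Iic (t₀ + 1)) := by
    refine continuousOn_tsum (u := fun n : ℕ => C * Real.exp ((1/2 + δ) * (t₀ + 1)) *
      (vonMangoldt n * (n : ℝ) ^ (-(1 + δ)))) (fun n => ?_)
      ((summable_vonMangoldt_rpow hδ).mul_left _) (fun n t ht => ?_)
    · have := hη.continuous
      exact Continuous.continuousOn (by fun_prop)
    · refine (norm_psiChar_term_le χ hC.le (fun u => (hb u).1) hδ le_rfl n t).trans ?_
      have h0 : 0 ≤ vonMangoldt n * (n : ℝ) ^ (-(1 + δ)) :=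
        mul_nonneg ArithmeticFunction.vonMangoldt_nonneg (Real.rpow_nonneg (Nat.cast_nonneg _) _)
      have : t ≤ t₀ + 1 := ht
      gcongr
  exact this.continuousAt (Iic_mem_nhds (by linarith))

theorem conj_psiChar [NeZero N] (t : ℝ) : conj (psiChar η χ t) = psiChar η χ⁻¹ t := by
  rw [psiChar, Complex.conj_tsum, psiChar]
  congr 1 with n
  rw [map_mul, Complex.conj_ofReal]
  congr 1
  simpa using MulChar.star_apply' χ (n : ZMod N)

/-- The Laplace transform of `psiChar` in the region of absolute convergence. -/
theorem bilap_psiChar [NeZero N] (hδ : 0 < δ) (hη : MemS δ η) {w : ℂ} (hw : 1/2 < w.re)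
    (hw' : w.re < 1/2 + δ) :
    bilap (psiChar η χ) w = -(deriv χ.LFunction (1/2 + w) / χ.LFunction (1/2 + w)) *
      bilap (fun t => (η t : ℂ)) w := by
  obtain ⟨C, hC, hb⟩ := hη.exists_bound
  set H := bilap (fun t => (η t : ℂ)) w with hH
  have hcexp : Continuous fun t : ℝ => Complex.exp (-w * t) := by fun_prop
  have hηc : Continuous fun t : ℝ => (η t : ℂ) := Complex.continuous_ofReal.comp hη.continuous
  have hshift : ∀ u : ℝ, Integrable (fun t : ℝ => Complex.exp (-w * t) * ((η (u - t) : ℝ) : ℂ)) := by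
    intro u
    refine integrable_exp_mul
      (by have := hη.continuous; exact Continuous.aestronglyMeasurable (by fun_prop)) ?_
    refine integrable_exp_mul_norm (a := 1/2 + δ) (C := C * Real.exp ((1/2+δ) * |u|))
      (by have := hη.continuous; exact Continuous.aestronglyMeasurable (by fun_prop)) (fun t => ?_)
      (abs_lt.2 ⟨by linarith, hw'⟩)
    rw [Complex.norm_real, Real.norm_eq_abs]
    refine (hb _).1.trans ?_
    rw [mul_assoc, ← Real.exp_add]
    gcongr
    have h1 := abs_sub_abs_le_abs_sub t u
    rw [abs_sub_comm] at h1
    nlinarith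
  have hnorm : ∀ u : ℝ, ∫ t : ℝ, ‖Complex.exp (-w * t) * ((η (u - t) : ℝ) : ℂ)‖ =
      Real.exp (-w.re * u) * ∫ t : ℝ, Real.exp (-w.re * t) * |η t| := by
    intro u
    rw [← integral_add_right_eq_self _ u, ← integral_const_mul]
    congr 1 with t
    rw [norm_mul, norm_exp_neg_mul_ofReal, Complex.norm_real, Real.norm_eq_abs,
      show u - (t + u) = -t by ring, hη.even, ← mul_assoc, ← Real.exp_add]
    ring_nf
  have hval : ∀ u : ℝ, ∫ t : ℝ, Complex.exp (-w * t) * ((η (u - t) : ℝ) : ℂ) =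
      Complex.exp (-w * u) * H := by
    intro u
    rw [hH, ← bilap_comp_sub]
    congr 1 with t
    rw [← hη.even, neg_sub]
  set F : ℕ → ℝ → ℂ := fun n t => Complex.exp (-w * t) *
    (χ n * ((vonMangoldt n / Real.sqrt n * η (Real.log n - t) : ℝ) : ℂ)) with hF
  have hF' : ∀ n t, F n t = (χ n * ((vonMangoldt n / Real.sqrt n : ℝ) : ℂ)) *
      (Complex.exp (-w * t) * ((η (Real.log n - t) : ℝ) : ℂ)) := by
    intro n t; simp only [hF]; push_cast; ring
  have hFint : ∀ n, Integrable (F n) := fun n => by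
    have : F n = fun t : ℝ => (χ n * ((vonMangoldt n / Real.sqrt n : ℝ) : ℂ)) *
      (Complex.exp (-w * t) * ((η (Real.log n - t) : ℝ) : ℂ)) := funext (hF' n)
    rw [this]
    exact (hshift _).const_mul _
  have hpow : ∀ n : ℕ, n ≠ 0 → (Real.sqrt n)⁻¹ * Real.exp (-w.re * Real.log n) =
      (n : ℝ) ^ (-(1 + (w.re - 1/2))) := by
    intro n hn
    have hn' : (0 : ℝ) < n := by positivity
    rw [Real.sqrt_eq_rpow, ← Real.rpow_neg hn'.le, Real.rpow_def_of_pos hn',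
      Real.rpow_def_of_pos hn', ← Real.exp_add]
    ring_nf
  have hsum : Summable fun n => ∫ t, ‖F n t‖ := by
    refine Summable.of_nonneg_of_le (fun n => integral_nonneg fun t => norm_nonneg _) (fun n => ?_)
      ((summable_vonMangoldt_rpow (d := w.re - 1/2) (by linarith)).mul_right
        (∫ t : ℝ, Real.exp (-w.re * t) * |η t|))
    simp only [hF', norm_mul (χ _ * _)]
    rw [integral_const_mul, hnorm]
    have hI : 0 ≤ ∫ t : ℝ, Real.exp (-w.re * t) * |η t| := integral_nonneg fun t => by positivity
    rcases eq_or_ne n 0 with rfl | hn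
    · simp
    rw [← hpow n hn, ← mul_assoc, ← mul_assoc, ← div_eq_mul_inv]
    refine mul_le_mul_of_nonneg_right (mul_le_mul_of_nonneg_right ?_ (Real.exp_pos _).le) hI
    rw [norm_mul, Complex.norm_real, Real.norm_eq_abs,
      abs_of_nonneg (div_nonneg ArithmeticFunction.vonMangoldt_nonneg (Real.sqrt_nonneg _))]
    exact mul_le_of_le_one_left
      (div_nonneg ArithmeticFunction.vonMangoldt_nonneg (Real.sqrt_nonneg _)) (χ.norm_le_one _)
  have h1 := integral_tsum_of_summable_integral_norm hFint hsum
  have h2 : bilap (psiChar η χ) w = ∫ t, ∑' n, F n t := by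
    rw [bilap]
    congr 1 with t
    rw [psiChar, ← tsum_mul_left]
  have hre : 1 < (1/2 + w).re := by simp; linarith
  have h3 : ∀ n, ∫ t, F n t = LSeries.term ((fun n : ℕ => χ n) * fun n => (vonMangoldt n : ℂ)) (1/2 + w) n * H := by
    intro n
    simp only [hF']
    rw [integral_const_mul, hval, ← mul_assoc]
    congr 1
    rcases eq_or_ne n 0 with rfl | hn
    · simp
    rw [LSeries.term_of_ne_zero hn]
    simp only [Pi.mul_apply]
    have hn' : (n : ℂ) ≠ 0 := by exact_mod_cast hn
    have hn0 : (0 : ℝ) < n := by positivity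
    have e1 : ((Real.sqrt n : ℝ) : ℂ)⁻¹ = Complex.exp (-(1/2) * Complex.log n) := by
      rw [Real.sqrt_eq_rpow, Real.rpow_def_of_pos hn0, ← Complex.ofReal_inv, ← Real.exp_neg,
        Complex.ofReal_exp]
      push_cast
      congr 1; ring
    have e2 : ((n : ℂ) ^ (1/2 + w))⁻¹ = Complex.exp (-(1/2) * Complex.log n) *
        Complex.exp (-w * Real.log n) := by
      rw [Complex.cpow_def_of_ne_zero hn', ← Complex.exp_neg, ← Complex.exp_add, Complex.natCast_log]
      congr 1; ring
    rw [div_eq_mul_inv _ ((n : ℂ) ^ _), e2, Complex.ofReal_div, div_eq_mul_inv, e1]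
    ring
  rw [h2, ← h1]
  simp only [h3]
  rw [tsum_mul_right]
  congr 1
  have h4 := DirichletCharacter.LSeries_twist_vonMangoldt_eq χ hre
  rw [LSeries] at h4
  rw [h4, DirichletCharacter.LFunction_eq_LSeries χ hre, DirichletCharacter.deriv_LFunction_eq_deriv_LSeries χ hre,
    neg_div]

end

theorem norm_cexp_sub_cexp_le {z w : ℂ} {b u : ℝ} (hu : 0 ≤ u) (hz : b ≤ z.re) (hw : b ≤ w.re) :
    ‖Complex.exp (-z * u) - Complex.exp (-w * u)‖ ≤ ‖z - w‖ * u * Real.exp (-b * u) := by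
  have hconv : Convex ℝ {z : ℂ | b ≤ z.re} := convex_halfSpace_re_ge b
  have hd : ∀ x ∈ {z : ℂ | b ≤ z.re}, HasDerivWithinAt (fun z : ℂ => Complex.exp (-z * u))
      (Complex.exp (-x * u) * (-u)) {z : ℂ | b ≤ z.re} x := by
    intro x _
    have h1 : HasDerivAt (fun z : ℂ => -z * (u : ℂ)) (-(u : ℂ)) x := by
      simpa using (hasDerivAt_neg x).mul_const (u : ℂ)
    exact h1.cexp.hasDerivWithinAt
  have := hconv.norm_image_sub_le_of_norm_hasDerivWithin_le (C := u * Real.exp (-b * u)) hd ?_ hw hz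
  · exact this.trans_eq (by ring)
  · intro x hx
    rw [norm_mul, norm_exp_neg_mul_ofReal, norm_neg, Complex.norm_real, Real.norm_eq_abs,
      abs_of_nonneg hu, mul_comm]
    have hx' : b ≤ x.re := hx
    gcongr

theorem one_sub_exp_pos {u : ℝ} (hu : 0 < u) : 0 < 1 - Real.exp (-2 * u) := by
  have : Real.exp (-2 * u) < 1 := by rw [Real.exp_lt_one_iff]; linarith
  linarith

theorem div_one_sub_exp_le {u : ℝ} (hu : 0 < u) : u / (1 - Real.exp (-2 * u)) ≤ (1 + 2 * u) / 2 := by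
  rw [div_le_div_iff₀ (one_sub_exp_pos hu) two_pos]
  have h1 : 1 + 2 * u ≤ Real.exp (2 * u) := by linarith [Real.add_one_le_exp (2 * u)]
  have h2 : Real.exp (-2 * u) * Real.exp (2 * u) = 1 := by rw [← Real.exp_add]; simp
  have h3 := Real.exp_pos (-2 * u)
  nlinarith [mul_le_mul_of_nonneg_left h1 h3.le]

theorem integrableOn_one_add_mul_exp {b : ℝ} (hb : 0 < b) :
    IntegrableOn (fun u : ℝ => (1 + 2 * u) / 2 * Real.exp (-b * u)) (Set.Ioi 0) := by
  have h1 : IntegrableOn (fun u : ℝ => (1 + 4 / b) * Real.exp (-(b / 2) * u)) (Set.Ioi 0) :=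
    (integrableOn_exp_mul_Ioi (by linarith : -(b / 2) < 0) 0).const_mul _
  refine h1.mono' (by fun_prop) ((ae_restrict_iff' measurableSet_Ioi).2 (ae_of_all _ fun u hu => ?_))
  have hu : 0 < u := hu
  rw [Real.norm_of_nonneg (by positivity)]
  have h2 : u ≤ 2 / b * Real.exp (b / 2 * u) := by
    have := Real.add_one_le_exp (b / 2 * u)
    rw [div_mul_eq_mul_div, le_div_iff₀ hb]; linarith
  have h3 : (1 : ℝ) ≤ Real.exp (b / 2 * u) := Real.one_le_exp (by positivity)
  have h4 : (1 + 2 * u) / 2 ≤ (1 + 4 / b) * Real.exp (b / 2 * u) := by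
    have : 4 / b = 2 * (2 / b) := by ring
    rw [this]; nlinarith [div_pos two_pos hb]
  calc _ ≤ (1 + 4 / b) * Real.exp (b / 2 * u) * Real.exp (-b * u) := by gcongr
    _ = _ := by rw [mul_assoc, ← Real.exp_add]; ring_nf

theorem norm_digammaKernel_le {s : ℂ} {b u : ℝ} (hb : b ≤ s.re) (hb2 : b ≤ 2) (hu : 0 < u) :
    ‖(Complex.exp (-2 * u) - Complex.exp (-s * u)) / (1 - Complex.exp (-2 * u))‖ ≤
      ‖2 - s‖ * ((1 + 2 * u) / 2 * Real.exp (-b * u)) := by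
  have h1 := norm_cexp_sub_cexp_le (z := 2) (w := s) hu.le (by simpa using hb2) hb
  have e : (1 - Complex.exp (-2 * u)) = ((1 - Real.exp (-2 * u) : ℝ) : ℂ) := by push_cast; rfl
  rw [norm_div, e, Complex.norm_real, Real.norm_of_nonneg (one_sub_exp_pos hu).le]
  calc _ ≤ ‖2 - s‖ * u * Real.exp (-b * u) / (1 - Real.exp (-2 * u)) := by
        gcongr; exact (one_sub_exp_pos hu).le
    _ = ‖2 - s‖ * (u / (1 - Real.exp (-2 * u)) * Real.exp (-b * u)) := by ring
    _ ≤ _ := mul_le_mul_of_nonneg_left (mul_le_mul_of_nonneg_right (div_one_sub_exp_le hu)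
        (Real.exp_pos _).le) (norm_nonneg _)

theorem integrableOn_digammaKernel {s : ℂ} (hs : 0 < s.re) :
    IntegrableOn (fun u : ℝ => (Complex.exp (-2 * u) - Complex.exp (-s * u)) /
      (1 - Complex.exp (-2 * u))) (Set.Ioi 0) := by
  refine ((integrableOn_one_add_mul_exp (lt_min hs two_pos)).const_mul ‖2 - s‖).mono'
    (Measurable.aestronglyMeasurable (by fun_prop))
    ((ae_restrict_iff' measurableSet_Ioi).2 (ae_of_all _ fun u hu =>
      norm_digammaKernel_le (min_le_left _ _) (min_le_right _ _) hu))

theorem image_exp_neg_two_mul : (fun u : ℝ => Real.exp (-2 * u)) '' Set.Ioi 0 = Set.Ioo 0 1 := by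
  ext x
  constructor
  · rintro ⟨u, hu, rfl⟩
    exact ⟨Real.exp_pos _, by linarith [one_sub_exp_pos hu]⟩
  · rintro ⟨h0, h1⟩
    refine ⟨-(Real.log x / 2), ?_, ?_⟩
    · have := Real.log_neg h0 h1
      simp only [Set.mem_Ioi]; linarith
    · simp only []
      rw [show -2 * -(Real.log x / 2) = Real.log x by ring, Real.exp_log h0]

theorem integral_unit_eq_integral_exp (f : ℝ → ℂ) :
    ∫ x in (0 : ℝ)..1, f x = ∫ u in Set.Ioi (0 : ℝ), (2 * Real.exp (-2 * u) : ℝ) * f (Real.exp (-2 * u)) := by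
  rw [intervalIntegral.integral_of_le zero_le_one, integral_Ioc_eq_integral_Ioo,
    ← image_exp_neg_two_mul,
    integral_image_eq_integral_abs_deriv_smul measurableSet_Ioi
      (f' := fun u => Real.exp (-2 * u) * (-2))]
  · refine integral_congr_ae (ae_of_all _ fun u => ?_)
    simp only [abs_mul, Real.abs_exp, abs_neg, Nat.abs_ofNat, Complex.real_smul]
    push_cast; ring
  · intro u _
    have h1 : HasDerivAt (fun z : ℝ => -2 * z) (-2) u := by
      simpa using (hasDerivAt_id u).const_mul (-2 : ℝ)
    exact h1.exp.hasDerivWithinAt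
  · intro x _ y _ h
    simpa using Real.exp_injective h

theorem betaIntegral_sub_eq {s : ℂ} {v : ℝ} (hs : 0 < s.re) (hv : 0 < v) :
    Complex.betaIntegral (s / 2) v - Complex.betaIntegral 1 v =
      -2 * ∫ u in Set.Ioi (0 : ℝ), (Complex.exp (-2 * u) - Complex.exp (-s * u)) /
      (1 - Complex.exp (-2 * u)) * (((1 - Real.exp (-2 * u)) ^ v : ℝ) : ℂ) := by
  rw [Complex.betaIntegral, Complex.betaIntegral, ← intervalIntegral.integral_sub
    (Complex.betaIntegral_convergent (by simpa using hs) (by simpa using hv))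
    (Complex.betaIntegral_convergent (by simp) (by simpa using hv)), integral_unit_eq_integral_exp,
    ← integral_const_mul]
  refine setIntegral_congr_fun measurableSet_Ioi fun u hu => ?_
  have hp := one_sub_exp_pos hu
  have e : (1 - Complex.exp (-2 * u)) = ((1 - Real.exp (-2 * u) : ℝ) : ℂ) := by push_cast; rfl
  have hne : (1 - Complex.exp (-2 * u)) ≠ 0 := by
    rw [e]; exact_mod_cast hp.ne'
  have e1 : ((Real.exp (-2 * u) : ℝ) : ℂ) = Complex.exp (-2 * u) := by push_cast; rfl
  have e2 : ((Real.exp (-2 * u) : ℝ) : ℂ) ^ (s / 2 - 1) =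
      Complex.exp (-s * u) * Complex.exp (2 * u) := by
    rw [Complex.cpow_def_of_ne_zero (by rw [e1]; exact Complex.exp_ne_zero _), ← Complex.ofReal_log
      (Real.exp_pos _).le, Real.log_exp, ← Complex.exp_add]
    push_cast; ring_nf
  have e3 : (1 - ((Real.exp (-2 * u) : ℝ) : ℂ)) ^ ((v : ℂ) - 1) =
      (((1 - Real.exp (-2 * u)) ^ v : ℝ) : ℂ) / (1 - Complex.exp (-2 * u)) := by
    rw [e1, Complex.cpow_sub _ _ hne, Complex.cpow_one, e, Complex.ofReal_cpow hp.le]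
  have e4 : Complex.exp (-2 * u) * Complex.exp (2 * u) = 1 := by
    rw [← Complex.exp_add]; simp
  simp only [e2, e3, sub_self, Complex.cpow_zero, one_mul]
  push_cast
  linear_combination (2 * Complex.exp (-s * u) * ((((1 - Real.exp (-2 * u)) ^ v : ℝ) : ℂ) / (1 - Complex.exp (-2 * u)))) * e4

/-- Gauss' integral for the digamma function. -/
theorem logDeriv_Gamma_half {s : ℂ} (hs : 0 < s.re) :
    logDeriv Complex.Gamma (s / 2) = -(Real.eulerMascheroniConstant : ℂ) +
      2 * ∫ u in Set.Ioi (0 : ℝ), (Complex.exp (-2 * u) - Complex.exp (-s * u)) /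
      (1 - Complex.exp (-2 * u)) := by
  have hs2 : 0 < (s / 2).re := by simpa using hs
  have lim1 : Filter.Tendsto (fun v : ℝ => -2 * ∫ u in Set.Ioi (0 : ℝ),
      (Complex.exp (-2 * u) - Complex.exp (-s * u)) /
      (1 - Complex.exp (-2 * u)) * (((1 - Real.exp (-2 * u)) ^ v : ℝ) : ℂ)) (nhdsWithin 0 (Set.Ioi 0))
      (nhds (-2 * ∫ u in Set.Ioi (0 : ℝ), (Complex.exp (-2 * u) - Complex.exp (-s * u)) /
      (1 - Complex.exp (-2 * u)))) := by
    refine Filter.Tendsto.const_mul _ ?_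
    refine tendsto_integral_filter_of_dominated_convergence _ ?_ ?_
      (integrableOn_digammaKernel hs).norm ?_
    · refine Filter.Eventually.of_forall fun v => ?_
      exact (integrableOn_digammaKernel hs).aestronglyMeasurable.mul (Complex.measurable_ofReal.comp
        ((by fun_prop : Measurable fun u : ℝ => 1 - Real.exp (-2 * u)).pow_const v)).aestronglyMeasurable
    · filter_upwards [self_mem_nhdsWithin] with v hv
      refine (ae_restrict_iff' measurableSet_Ioi).2 (ae_of_all _ fun u hu => ?_)
      have hp := one_sub_exp_pos hu
      rw [norm_mul, Complex.norm_real, Real.norm_of_nonneg (Real.rpow_nonneg hp.le _)]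
      refine mul_le_of_le_one_right (norm_nonneg _) (Real.rpow_le_one hp.le ?_ (le_of_lt hv))
      linarith [Real.exp_pos (-2 * u)]
    · refine (ae_restrict_iff' measurableSet_Ioi).2 (ae_of_all _ fun u hu => ?_)
      have hp := one_sub_exp_pos hu
      have h1 : Filter.Tendsto (fun v : ℝ => (((1 - Real.exp (-2 * u)) ^ v : ℝ) : ℂ))
          (nhdsWithin 0 (Set.Ioi 0)) (nhds (((1 - Real.exp (-2 * u)) ^ (0 : ℝ) : ℝ) : ℂ)) :=
        (Complex.continuous_ofReal.tendsto _).comp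
          ((Real.continuousAt_const_rpow hp.ne').tendsto.mono_left nhdsWithin_le_nhds)
      simpa using h1.const_mul ((Complex.exp (-2 * u) - Complex.exp (-s * u)) /
      (1 - Complex.exp (-2 * u)))
  have hnz : ∀ z : ℂ, 0 < z.re → Complex.Gamma z ≠ 0 := fun z hz => Complex.Gamma_ne_zero_of_re_pos hz
  have hdiff : ∀ z : ℂ, 0 < z.re → DifferentiableAt ℂ Complex.Gamma z := fun z hz =>
    Complex.differentiableAt_Gamma _ fun n h => by
      rw [h] at hz; simp at hz; linarith [(n.cast_nonneg : (0 : ℝ) ≤ n)]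
  have hderiv : ∀ z : ℂ, 0 < z.re → HasDerivAt (fun v : ℝ => (Complex.Gamma (z + v))⁻¹)
      (-deriv Complex.Gamma z / Complex.Gamma z ^ 2) 0 := by
    intro z hz
    have h1 : HasDerivAt (fun z => (Complex.Gamma z)⁻¹) _ z := (hdiff z hz).hasDerivAt.inv (hnz z hz)
    have h2 : HasDerivAt (fun v : ℂ => z + v) 1 ((0 : ℝ) : ℂ) := by
      simpa using (hasDerivAt_id (((0 : ℝ) : ℂ))).const_add z
    have h3 := HasDerivAt.comp ((0 : ℝ) : ℂ) (h₂ := fun z => (Complex.Gamma z)⁻¹) (h := fun v : ℂ => z + v)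
      (h₂' := -deriv Complex.Gamma z / Complex.Gamma z ^ 2) (by simpa using h1) h2
    simpa using h3.comp_ofReal
  have h4 := ((hderiv (s / 2) hs2).const_mul (Complex.Gamma (s / 2))).sub (hderiv 1 (by simp))
  have h5 := h4.tendsto_slope
  have h6 := h5.mono_left (nhdsWithin_mono (0 : ℝ) (fun x (hx : 0 < x) => (ne_of_gt hx : x ≠ 0)))
  have h7 : Filter.Tendsto (fun v : ℝ => Complex.Gamma (v + 1)) (nhdsWithin 0 (Set.Ioi 0)) (nhds 1) := by
    have h8 : ContinuousAt (fun v : ℝ => Complex.Gamma (v + 1)) 0 := by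
      refine ContinuousAt.comp (g := Complex.Gamma) (f := fun v : ℝ => (v : ℂ) + 1) ?_ (by fun_prop)
      simpa using (hdiff 1 (by simp)).continuousAt
    simpa using h8.tendsto.mono_left nhdsWithin_le_nhds
  have h9 := h7.mul h6
  have hlim := tendsto_nhds_unique (lim1.congr' ?_) h9
  · have hG1 : deriv Complex.Gamma 1 = -(Real.eulerMascheroniConstant : ℂ) :=
      Complex.hasDerivAt_Gamma_one.deriv
    rw [Complex.Gamma_one, hG1] at hlim
    rw [logDeriv_apply]
    have hn := hnz _ hs2
    have e : Complex.Gamma (s / 2) * (-deriv Complex.Gamma (s / 2) / Complex.Gamma (s / 2) ^ 2) =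
        -(deriv Complex.Gamma (s / 2) / Complex.Gamma (s / 2)) := by field_simp
    rw [e] at hlim
    linear_combination hlim
  · filter_upwards [self_mem_nhdsWithin] with v hv
    have hv : 0 < v := hv
    rw [← betaIntegral_sub_eq hs hv]
    have hvc : (v : ℂ) ≠ 0 := by exact_mod_cast hv.ne'
    have b1 := Complex.Gamma_mul_Gamma_eq_betaIntegral hs2 (t := (v : ℂ)) (by simpa using hv)
    have b2 := Complex.Gamma_mul_Gamma_eq_betaIntegral (s := 1) (t := (v : ℂ)) (by simp) (by simpa using hv)
    have n1 : Complex.Gamma (s / 2 + v) ≠ 0 := hnz _ (by rw [Complex.add_re]; simp at hs2 ⊢; linarith)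
    have n2 : Complex.Gamma (1 + v) ≠ 0 := hnz _ (by simp; linarith)
    rw [slope_def_module]
    have b3 : Complex.betaIntegral (s / 2) v = Complex.Gamma (s / 2) * Complex.Gamma v * (Complex.Gamma (s / 2 + v))⁻¹ := by
      rw [b1, mul_comm (Complex.Gamma _), mul_assoc, mul_inv_cancel₀ n1, mul_one]
    have b4 : Complex.betaIntegral 1 v = Complex.Gamma v * (Complex.Gamma (1 + v))⁻¹ := by
      rw [Complex.Gamma_one, one_mul] at b2; rw [b2, mul_comm (Complex.Gamma _), mul_assoc,
        mul_inv_cancel₀ n2, mul_one]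
    rw [b3, b4, Complex.Gamma_add_one _ hvc]
    have n3 := hnz _ hs2
    simp only [Complex.ofReal_zero, add_zero, Complex.Gamma_one, sub_zero, Pi.sub_apply,
      Complex.real_smul, Complex.ofReal_inv]
    generalize Complex.Gamma (s / 2 + v) = G1
    generalize Complex.Gamma (1 + v) = G2
    generalize Complex.Gamma (s / 2) = G3 at n3 ⊢
    field_simp
    ring

noncomputable def archKernel (η : ℝ → ℝ) (κ t u : ℝ) : ℝ :=
  (Real.exp (-2 * u) * η t - Real.exp (-(1/2 + κ) * u) * η (t - u)) / (1 - Real.exp (-2 * u))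

/-- The contribution of the gamma factor to the explicit formula. -/
noncomputable def archTerm (η : ℝ → ℝ) (κ t : ℝ) : ℝ :=
  -(Real.log Real.pi + Real.eulerMascheroniConstant) / 2 * η t +
    ∫ u in Set.Ioi (0 : ℝ), archKernel η κ t u

section
variable {δ C κ : ℝ} {η : ℝ → ℝ}

theorem exp_neg_half_add_le (hδ : 0 < δ) (s : ℝ) :
    Real.exp (-(1/2 + δ) * |s|) ≤ Real.exp (-(1/4) * |s|) :=
  Real.exp_le_exp.2 (by nlinarith [abs_nonneg s])

theorem abs_sub_shift_le (hδ : 0 < δ) (hη : Differentiable ℝ η) (hC : 0 ≤ C)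
    (hb : ∀ t, |deriv η t| ≤ C * Real.exp (-(1/2 + δ) * |t|)) {t u : ℝ} (hu : 0 ≤ u) :
    |η t - η (t - u)| ≤ C * u * Real.exp (1/4 * u) * Real.exp (-(1/4) * |t|) := by
  have := (convex_Icc (t - u) t).norm_image_sub_le_of_norm_deriv_le (f := η)
    (C := C * Real.exp (1/4 * u) * Real.exp (-(1/4) * |t|)) (x := t - u) (y := t)
    (fun x _ => hη x) ?_ ⟨le_rfl, by linarith⟩ ⟨by linarith, le_rfl⟩
  · rw [Real.norm_eq_abs, Real.norm_eq_abs, sub_sub_cancel, abs_of_nonneg hu] at this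
    linarith
  · intro s hs
    refine (hb s).trans ?_
    rw [mul_assoc, ← Real.exp_add]
    refine mul_le_mul_of_nonneg_left ((exp_neg_half_add_le hδ s).trans (Real.exp_le_exp.2 ?_)) hC
    have h1 : |t| ≤ |s| + u := by
      have := abs_sub_abs_le_abs_sub t s
      have h2 : |t - s| ≤ u := abs_le.2 ⟨by linarith [hs.2], by linarith [hs.1]⟩
      linarith
    linarith

theorem abs_archKernel_le (hδ : 0 < δ) (hη : Differentiable ℝ η) (hC : 0 ≤ C)
    (h0 : ∀ t, |η t| ≤ C * Real.exp (-(1/2 + δ) * |t|))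
    (hb : ∀ t, |deriv η t| ≤ C * Real.exp (-(1/2 + δ) * |t|)) (hκ : κ ∈ Set.Icc (0 : ℝ) 1)
    (t : ℝ) {u : ℝ} (hu : 0 < u) :
    |archKernel η κ t u| ≤ 3 * C * Real.exp (-(1/4) * |t|) * ((1 + 2 * u) / 2 * Real.exp (-(1/4) * u)) := by
  have hp := one_sub_exp_pos hu
  have h1 : |Real.exp (-2 * u) - Real.exp (-(1/2 + κ) * u)| ≤ 2 * u * Real.exp (-(1/4) * u) := by
    have := norm_cexp_sub_cexp_le (z := (2 : ℝ)) (w := ((1/2 + κ : ℝ) : ℂ)) (b := 1/4) hu.le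
      (by rw [Complex.ofReal_re]; norm_num) (by rw [Complex.ofReal_re]; linarith [hκ.1])
    simp only [← Complex.ofReal_neg, ← Complex.ofReal_mul, ← Complex.ofReal_exp,
      ← Complex.ofReal_sub, Complex.norm_real, Real.norm_eq_abs] at this
    refine this.trans ?_
    gcongr
    exact abs_le.2 ⟨by linarith [hκ.2], by linarith [hκ.1]⟩
  have h2 := abs_sub_shift_le hδ hη hC hb hu.le (t := t)
  have h3 : |η t| ≤ C * Real.exp (-(1/4) * |t|) :=
    (h0 t).trans (mul_le_mul_of_nonneg_left (exp_neg_half_add_le hδ t) hC)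
  have h4 : Real.exp (-(1/2 + κ) * u) * Real.exp (1/4 * u) ≤ Real.exp (-(1/4) * u) := by
    rw [← Real.exp_add]; exact Real.exp_le_exp.2 (by nlinarith [hκ.1])
  have h5 : |Real.exp (-2 * u) * η t - Real.exp (-(1/2 + κ) * u) * η (t - u)| ≤
      3 * C * u * Real.exp (-(1/4) * u) * Real.exp (-(1/4) * |t|) := by
    have e : Real.exp (-2 * u) * η t - Real.exp (-(1/2 + κ) * u) * η (t - u) =
        (Real.exp (-2 * u) - Real.exp (-(1/2 + κ) * u)) * η t +
          Real.exp (-(1/2 + κ) * u) * (η t - η (t - u)) := by ring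
    rw [e]
    refine (abs_add_le _ _).trans ?_
    rw [abs_mul, abs_mul, Real.abs_exp]
    calc _ ≤ 2 * u * Real.exp (-(1/4) * u) * (C * Real.exp (-(1/4) * |t|)) +
          Real.exp (-(1/2 + κ) * u) * (C * u * Real.exp (1/4 * u) * Real.exp (-(1/4) * |t|)) := by
          gcongr
      _ = 2 * u * Real.exp (-(1/4) * u) * (C * Real.exp (-(1/4) * |t|)) +
          (Real.exp (-(1/2 + κ) * u) * Real.exp (1/4 * u)) * (C * u * Real.exp (-(1/4) * |t|)) := by
          ring
      _ ≤ 2 * u * Real.exp (-(1/4) * u) * (C * Real.exp (-(1/4) * |t|)) +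
          Real.exp (-(1/4) * u) * (C * u * Real.exp (-(1/4) * |t|)) := by gcongr
      _ = _ := by ring
  rw [archKernel, abs_div, abs_of_pos hp]
  calc _ ≤ 3 * C * u * Real.exp (-(1/4) * u) * Real.exp (-(1/4) * |t|) / (1 - Real.exp (-2 * u)) := by
        gcongr
    _ = 3 * C * Real.exp (-(1/4) * |t|) * (u / (1 - Real.exp (-2 * u)) * Real.exp (-(1/4) * u)) := by
        ring
    _ ≤ _ := mul_le_mul_of_nonneg_left (mul_le_mul_of_nonneg_right (div_one_sub_exp_le hu)
        (Real.exp_pos _).le) (by positivity)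

theorem measurable_archKernel (hη : Continuous η) (κ : ℝ) :
    Measurable fun p : ℝ × ℝ => archKernel η κ p.1 p.2 := by
  have := hη.measurable
  unfold archKernel
  fun_prop

theorem integrableOn_one_add_mul_exp_quarter :
    IntegrableOn (fun u : ℝ => (1 + 2 * u) / 2 * Real.exp (-(1/4) * u)) (Set.Ioi 0) :=
  integrableOn_one_add_mul_exp (by norm_num)

theorem MemS.integrableOn_archKernel (hδ : 0 < δ) (hη : MemS δ η) (hκ : κ ∈ Set.Icc (0 : ℝ) 1)
    (t : ℝ) : IntegrableOn (archKernel η κ t) (Set.Ioi 0) := by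
  obtain ⟨C, hC, h⟩ := hη.exists_bound
  exact (integrableOn_one_add_mul_exp_quarter.const_mul _).mono'
    ((measurable_archKernel hη.continuous κ).comp measurable_prodMk_left).aestronglyMeasurable
    ((ae_restrict_iff' measurableSet_Ioi).2 (ae_of_all _ fun u hu =>
      abs_archKernel_le hδ hη.2.1 hC.le (fun t => (h t).1) (fun t => (h t).2) hκ t hu))

theorem MemS.continuous_archTerm (hδ : 0 < δ) (hη : MemS δ η) (hκ : κ ∈ Set.Icc (0 : ℝ) 1) :
    Continuous (archTerm η κ) := by
  obtain ⟨C, hC, h⟩ := hη.exists_bound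
  refine (hη.continuous.const_mul _).add ?_
  refine continuous_of_dominated (bound := fun u => 3 * C * ((1 + 2 * u) / 2 * Real.exp (-(1/4) * u)))
    (fun t => (hη.integrableOn_archKernel hδ hκ t).aestronglyMeasurable) (fun t => ?_)
    (integrableOn_one_add_mul_exp_quarter.const_mul _) (ae_of_all _ fun u => ?_)
  · refine (ae_restrict_iff' measurableSet_Ioi).2 (ae_of_all _ fun u hu => ?_)
    refine (abs_archKernel_le hδ hη.2.1 hC.le (fun t => (h t).1) (fun t => (h t).2) hκ t hu).trans ?_
    have : 0 < u := hu
    have h1 : Real.exp (-(1/4) * |t|) ≤ 1 := Real.exp_le_one_iff.2 (by linarith [abs_nonneg t])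
    have : 3 * C * Real.exp (-(1/4) * |t|) ≤ 3 * C := mul_le_of_le_one_right (by positivity) h1
    gcongr
  · have := hη.continuous
    unfold archKernel
    fun_prop

theorem MemS.exists_archTerm_bound (hδ : 0 < δ) (hη : MemS δ η) :
    ∃ C > 0, ∀ κ ∈ Set.Icc (0 : ℝ) 1, ∀ t, |archTerm η κ t| ≤ C * Real.exp (-(1/4) * |t|) := by
  obtain ⟨C, hC, h⟩ := hη.exists_bound
  set J := ∫ u in Set.Ioi (0 : ℝ), (1 + 2 * u) / 2 * Real.exp (-(1/4) * u)
  have hJ : 0 ≤ J := setIntegral_nonneg measurableSet_Ioi fun u (hu : 0 < u) => by positivity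
  set c := |-(Real.log Real.pi + Real.eulerMascheroniConstant) / 2|
  refine ⟨c * C + 3 * C * J + 1, by positivity, fun κ hκ t => ?_⟩
  have h1 : |∫ u in Set.Ioi (0 : ℝ), archKernel η κ t u| ≤ 3 * C * Real.exp (-(1/4) * |t|) * J := by
    rw [← integral_const_mul, ← Real.norm_eq_abs]
    refine norm_integral_le_of_norm_le (integrableOn_one_add_mul_exp_quarter.const_mul _) ?_
    exact (ae_restrict_iff' measurableSet_Ioi).2 (ae_of_all _ fun u hu =>
      abs_archKernel_le hδ hη.2.1 hC.le (fun t => (h t).1) (fun t => (h t).2) hκ t hu)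
  have h2 : |η t| ≤ C * Real.exp (-(1/4) * |t|) :=
    (h t).1.trans (mul_le_mul_of_nonneg_left (exp_neg_half_add_le hδ t) hC.le)
  rw [archTerm]
  refine (abs_add_le _ _).trans ?_
  rw [abs_mul]
  have h3 : c * |η t| ≤ c * (C * Real.exp (-(1/4) * |t|)) := by gcongr
  have := Real.exp_pos (-(1/4) * |t|)
  nlinarith

theorem logDeriv_Gammaℝ {s : ℂ} (hs : 0 < s.re) :
    logDeriv Complex.Gammaℝ s = -(Real.log Real.pi + Real.eulerMascheroniConstant : ℝ) / 2 +
      ∫ u in Set.Ioi (0 : ℝ), (Complex.exp (-2 * u) - Complex.exp (-s * u)) /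
      (1 - Complex.exp (-2 * u)) := by
  have hs2 : 0 < (s / 2).re := by simpa using hs
  have hπ : (Real.pi : ℂ) ≠ 0 := by exact_mod_cast Real.pi_ne_zero
  have h1 : HasDerivAt (fun s : ℂ => (Real.pi : ℂ) ^ (-s / 2))
      ((Real.pi : ℂ) ^ (-s / 2) * Complex.log Real.pi * (-1 / 2)) s := by
    have := ((hasDerivAt_neg s).div_const 2).const_cpow (c := (Real.pi : ℂ)) (Or.inl hπ)
    simpa using this
  have hd : DifferentiableAt ℂ Complex.Gamma (s / 2) :=
    Complex.differentiableAt_Gamma _ fun n h => by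
      rw [h] at hs2; simp at hs2; linarith [(n.cast_nonneg : (0 : ℝ) ≤ n)]
  have h2 : HasDerivAt (fun s : ℂ => Complex.Gamma (s / 2)) (deriv Complex.Gamma (s / 2) * (1 / 2)) s :=
    HasDerivAt.comp s (h₂ := Complex.Gamma) (h := fun s : ℂ => s / 2) hd.hasDerivAt
      ((hasDerivAt_id s).div_const 2)
  have h3 : HasDerivAt Complex.Gammaℝ _ s := h1.mul h2
  have hne := Complex.Gamma_ne_zero_of_re_pos hs2
  have hne' : (Real.pi : ℂ) ^ (-s / 2) ≠ 0 := by simp [Complex.cpow_eq_zero_iff, hπ]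
  have h4 := logDeriv_Gamma_half hs
  rw [logDeriv_apply] at h4
  rw [logDeriv_apply, h3.deriv, Complex.Gammaℝ_def]
  have h5 : deriv Complex.Gamma (s / 2) = (deriv Complex.Gamma (s / 2) / Complex.Gamma (s / 2)) *
    Complex.Gamma (s / 2) := by field_simp
  rw [h5, h4, ← Complex.ofReal_log Real.pi_pos.le]
  generalize (∫ u in Set.Ioi (0 : ℝ), (Complex.exp (-2 * u) - Complex.exp (-s * u)) /
      (1 - Complex.exp (-2 * u))) = J
  generalize Complex.Gamma (s / 2) = G at hne ⊢
  generalize (Real.pi : ℂ) ^ (-s / 2) = P at hne' ⊢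
  push_cast
  field_simp
  ring

theorem MemS.bilap_archTerm (hδ : 0 < δ) (hη : MemS δ η) (hκ : κ ∈ Set.Icc (0 : ℝ) 1) {w : ℂ}
    (hw : |w.re| < 1/4) :
    bilap (fun t => (archTerm η κ t : ℂ)) w =
      logDeriv Complex.Gammaℝ (1/2 + κ + w) * bilap (fun t => (η t : ℂ)) w := by
  obtain ⟨C, hC, h⟩ := hη.exists_bound
  have hH : Integrable fun t : ℝ => Complex.exp (-w * t) * (η t : ℂ) :=
    integrable_exp_mul (Complex.continuous_ofReal.comp hη.continuous).aestronglyMeasurable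
      (hη.integrable_exp_mul_norm (by linarith))
  have hsh : ∀ u : ℝ, Integrable fun t : ℝ => Complex.exp (-w * t) * (η (t - u) : ℂ) := by
    intro u
    refine ((hH.comp_sub_right u).const_mul (Complex.exp (-w * u))).congr (ae_of_all _ fun t => ?_)
    simp only [← mul_assoc, ← Complex.exp_add]
    push_cast; ring_nf
  have hF : Integrable (fun p : ℝ × ℝ => Complex.exp (-w * p.1) * (archKernel η κ p.1 p.2 : ℂ))
      (volume.prod (volume.restrict (Set.Ioi 0))) := by
    have h1 : Integrable fun t : ℝ => 3 * C * (Real.exp (-w.re * t) * ‖(Real.exp (-(1/4) * |t|) : ℂ)‖) :=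
      (_root_.integrable_exp_mul_norm (f := fun t => (Real.exp (-(1/4) * |t|) : ℂ)) (C := 1) (a := 1/4)
        (Continuous.aestronglyMeasurable (by fun_prop))
        (fun t => by rw [one_mul, Complex.norm_real, Real.norm_eq_abs, Real.abs_exp])
        hw).const_mul _
    have h2 := h1.mul_prod integrableOn_one_add_mul_exp_quarter
    refine h2.mono' ?_ ?_
    · exact ((by fun_prop : Continuous fun p : ℝ × ℝ => Complex.exp (-w * p.1)).measurable.mul
        (Complex.measurable_ofReal.comp (measurable_archKernel hη.continuous κ))).aestronglyMeasurable
    · have : ∀ᵐ p : ℝ × ℝ ∂(volume.prod (volume.restrict (Set.Ioi 0))), p.2 ∈ Set.Ioi (0:ℝ) :=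
        Measure.quasiMeasurePreserving_snd.ae (ae_restrict_mem measurableSet_Ioi)
      filter_upwards [this] with p hp
      have h3 := abs_archKernel_le hδ hη.2.1 hC.le (fun t => (h t).1) (fun t => (h t).2) hκ p.1 hp
      rw [norm_mul, norm_exp_neg_mul_ofReal, Complex.norm_real, Real.norm_eq_abs,
        Complex.norm_real, Real.norm_of_nonneg (Real.exp_pos _).le]
      exact (mul_le_mul_of_nonneg_left h3 (Real.exp_pos _).le).trans_eq (by ring)
  have hsw := integral_integral_swap
    (f := fun t u : ℝ => Complex.exp (-w * t) * (archKernel η κ t u : ℂ)) hF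
  have hK : ∀ t : ℝ, ((∫ u in Set.Ioi (0 : ℝ), archKernel η κ t u : ℝ) : ℂ) =
      ∫ u in Set.Ioi (0 : ℝ), (archKernel η κ t u : ℂ) := fun t => integral_complex_ofReal.symm
  have hint2 : Integrable fun t : ℝ =>
      ∫ u in Set.Ioi (0 : ℝ), Complex.exp (-w * t) * (archKernel η κ t u : ℂ) := hF.integral_prod_left
  have e1 : bilap (fun t => (archTerm η κ t : ℂ)) w =
      (-(Real.log Real.pi + Real.eulerMascheroniConstant : ℝ) / 2) * bilap (fun t => (η t : ℂ)) w +
      ∫ t : ℝ, ∫ u in Set.Ioi (0 : ℝ), Complex.exp (-w * t) * (archKernel η κ t u : ℂ) := by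
    rw [bilap, bilap, ← integral_const_mul, ← integral_add (hH.const_mul _) hint2]
    congr 1 with t
    rw [archTerm, integral_const_mul, Complex.ofReal_add, hK]
    push_cast; ring
  rw [e1, hsw, logDeriv_Gammaℝ (by
    have := (abs_lt.1 hw).1
    simp only [Complex.add_re, Complex.ofReal_re]; norm_num; linarith [hκ.1]), add_mul]
  congr 1
  rw [← integral_mul_const]
  refine setIntegral_congr_fun measurableSet_Ioi fun u hu => ?_
  have e2 : ∀ t : ℝ, Complex.exp (-w * t) * (archKernel η κ t u : ℂ) =
      (Complex.exp (-2 * u) * (Complex.exp (-w * t) * (η t : ℂ)) -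
        Complex.exp (-(1/2 + κ) * u) * (Complex.exp (-w * t) * (η (t - u) : ℂ))) /
        (1 - Complex.exp (-2 * u)) := by
    intro t
    rw [archKernel]; push_cast; ring
  simp only [e2]
  rw [integral_div, integral_sub (hH.const_mul _) ((hsh u).const_mul _), integral_const_mul,
    integral_const_mul, bilap_comp_sub (fun t => (η t : ℂ)), ← bilap, ← mul_assoc (Complex.exp (-(1/2 + κ) * u)),
    ← Complex.exp_add]
  ring_nf

end

section
variable {f : ℂ → ℂ}

theorem analyticOrderAt_ne_top_of_entire (hf : Differentiable ℂ f) (hne : ∃ z, f z ≠ 0) (ρ : ℂ) :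
    analyticOrderAt f ρ ≠ ⊤ := by
  obtain ⟨z, hz⟩ := hne
  intro h
  have hA : AnalyticOnNhd ℂ f Set.univ := fun z _ => hf.analyticAt z
  have := hA.eqOn_zero_of_preconnected_of_eventuallyEq_zero isPreconnected_univ (Set.mem_univ ρ)
    (analyticOrderAt_eq_top.1 h)
  exact hz (this (Set.mem_univ z))

theorem exists_entire_factor (hf : Differentiable ℂ f) (hne : ∃ z, f z ≠ 0) (ρ : ℂ) :
    ∃ g : ℂ → ℂ, Differentiable ℂ g ∧ g ρ ≠ 0 ∧
      ∀ z, f z = (z - ρ) ^ analyticOrderNatAt f ρ * g z := by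
  have htop := analyticOrderAt_ne_top_of_entire hf hne ρ
  obtain ⟨p, hp⟩ := hf.analyticAt ρ
  have hp0 : p ≠ 0 := fun h => htop (analyticOrderAt_eq_top.2
    ((HasFPowerSeriesAt.locally_zero_iff hp).2 h))
  have hd : ∀ n, Differentiable ℂ ((Function.swap dslope ρ)^[n] f) := by
    intro n
    induction n with
    | zero => exact hf
    | succ n ih =>
      rw [Function.iterate_succ', Function.comp_apply, Function.swap, ← differentiableOn_univ,
        Complex.differentiableOn_dslope Filter.univ_mem, differentiableOn_univ]
      exact ih
  have hg0 := hp.iterate_dslope_fslope_ne_zero hp0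
  have heq := hp.eq_pow_order_mul_iterate_dslope
  have hn : analyticOrderNatAt f ρ = p.order :=
    ((hf.analyticAt ρ).analyticOrderNatAt_eq_iff htop).2
      ⟨_, (hd p.order).analyticAt ρ, hg0, Filter.Eventually.of_forall heq⟩
  exact ⟨_, hd p.order, hg0, fun z => by rw [hn, ← smul_eq_mul]; exact heq z⟩

theorem exists_entire_factor_finset (hf : Differentiable ℂ f) (hne : ∃ z, f z ≠ 0) (S : Finset ℂ) :
    ∃ g : ℂ → ℂ, Differentiable ℂ g ∧ (∀ ρ ∈ S, g ρ ≠ 0) ∧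
      ∀ z, f z = (∏ ρ ∈ S, (z - ρ) ^ analyticOrderNatAt f ρ) * g z := by
  classical
  induction S using Finset.induction_on with
  | empty => exact ⟨f, hf, by simp, by simp⟩
  | insert ρ S hρ ih =>
    obtain ⟨g, hg, hgS, hfg⟩ := ih
    obtain ⟨z, hz⟩ := hne
    obtain ⟨g', hg', hg'ρ, hgg'⟩ := exists_entire_factor hg
      ⟨z, fun h => hz (by rw [hfg, h, mul_zero])⟩ ρ
    have hP : (∏ σ ∈ S, (ρ - σ) ^ analyticOrderNatAt f σ) ≠ 0 :=
      Finset.prod_ne_zero_iff.2 fun σ hσ => pow_ne_zero _ (sub_ne_zero.2 fun h => hρ (h ▸ hσ))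
    have hPd : Differentiable ℂ fun z => ∏ σ ∈ S, (z - σ) ^ analyticOrderNatAt f σ := by fun_prop
    have hn : analyticOrderNatAt f ρ = analyticOrderNatAt g ρ :=
      ((hf.analyticAt ρ).analyticOrderNatAt_eq_iff
        (analyticOrderAt_ne_top_of_entire hf ⟨z, hz⟩ ρ)).2
        ⟨fun z => (∏ σ ∈ S, (z - σ) ^ analyticOrderNatAt f σ) * g' z,
          (hPd.mul hg').analyticAt ρ, mul_ne_zero hP hg'ρ, Filter.Eventually.of_forall fun z => by
            rw [hfg z, hgg' z, smul_eq_mul]; ring⟩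
    refine ⟨g', hg', fun σ hσ => ?_, fun z => ?_⟩
    · rcases Finset.mem_insert.1 hσ with rfl | hσ
      · exact hg'ρ
      · intro h
        exact hgS σ hσ (by rw [hgg' σ, h, mul_zero])
    · rw [Finset.prod_insert hρ, hn, hfg z, hgg' z]; ring

theorem logDeriv_eq_sum_add {g : ℂ → ℂ} (hg : Differentiable ℂ g) {S : Finset ℂ} {m : ℂ → ℕ}
    (hfg : ∀ z, f z = (∏ ρ ∈ S, (z - ρ) ^ m ρ) * g z) {z : ℂ} (hz : z ∉ S) (hgz : g z ≠ 0) :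
    logDeriv f z = ∑ ρ ∈ S, (m ρ : ℂ) / (z - ρ) + logDeriv g z := by
  have h1 : ∀ ρ ∈ S, (z - ρ) ^ m ρ ≠ 0 := fun ρ hρ =>
    pow_ne_zero _ (sub_ne_zero.2 fun h => hz (h ▸ hρ))
  rw [funext hfg, logDeriv_mul z (Finset.prod_ne_zero_iff.2 h1) hgz (by fun_prop) hg.differentiableAt,
    logDeriv_prod h1 (fun ρ _ => by fun_prop)]
  congr 1
  refine Finset.sum_congr rfl fun ρ _ => ?_
  rw [logDeriv_fun_pow (f := fun z => z - ρ) (by fun_prop), logDeriv_apply]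
  simp [div_eq_mul_inv]

/-- The zeros of a nonzero entire function on a segment of the imaginary axis. -/
theorem finite_zeros_imag_segment (hf : Differentiable ℂ f) (hne : ∃ z, f z ≠ 0) (Y : ℝ) :
    {γ : ℝ | f (Complex.I * γ) = 0 ∧ |γ| ≤ Y}.Finite := by
  obtain ⟨z, hz⟩ := hne
  by_contra hinf
  have hsub : {γ : ℝ | f (Complex.I * γ) = 0 ∧ |γ| ≤ Y} ⊆ Set.Icc (-Y) Y := fun γ hγ => abs_le.1 hγ.2
  obtain ⟨γ₀, _, hacc⟩ := Set.Infinite.exists_accPt_of_subset_isCompact hinf isCompact_Icc hsub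
  have hA : AnalyticOnNhd ℂ f Set.univ := fun z _ => hf.analyticAt z
  refine hz (hA.eqOn_zero_of_preconnected_of_frequently_eq_zero isPreconnected_univ
    (Set.mem_univ (Complex.I * γ₀)) ?_ (Set.mem_univ z))
  rw [accPt_iff_frequently_nhdsNE] at hacc
  have hc : Filter.Tendsto (fun γ : ℝ => Complex.I * (γ : ℂ)) (nhdsWithin γ₀ {γ₀}ᶜ)
      (nhdsWithin (Complex.I * γ₀) {Complex.I * (γ₀ : ℂ)}ᶜ) := by
    refine tendsto_nhdsWithin_of_tendsto_nhds_of_eventually_within _ ?_ ?_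
    · exact ((by fun_prop : Continuous fun γ : ℝ => Complex.I * (γ : ℂ)).tendsto γ₀).mono_left
        nhdsWithin_le_nhds
    · filter_upwards [self_mem_nhdsWithin] with γ hγ
      intro h
      exact hγ (by simpa using h)
  exact hc.frequently (hacc.mono fun γ hγ => hγ.1)

end

/-- The Poisson kernel is an approximate identity. -/
theorem tendsto_poisson {G : ℝ → ℂ} (hG : Continuous G) {C : ℝ} (hC : ∀ y, ‖G y‖ ≤ C) (γ : ℝ) :
    Filter.Tendsto (fun κ : ℝ => ∫ y : ℝ, G y * (1 / (κ + Complex.I * y - Complex.I * γ) -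
      1 / (-κ + Complex.I * y - Complex.I * γ))) (nhdsWithin 0 (Set.Ioi 0))
      (nhds (2 * Real.pi * G γ)) := by
  have hlim : Filter.Tendsto (fun κ : ℝ => ∫ s : ℝ, G (γ + κ * s) * ((2 * (1 + s ^ 2)⁻¹ : ℝ) : ℂ))
      (nhdsWithin 0 (Set.Ioi 0)) (nhds (∫ s : ℝ, G (γ + (0 : ℝ) * s) * ((2 * (1 + s ^ 2)⁻¹ : ℝ) : ℂ))) := by
    refine tendsto_integral_filter_of_dominated_convergence (fun s => C * (2 * (1 + s ^ 2)⁻¹)) ?_ ?_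
      ((integrable_inv_one_add_sq.const_mul _).const_mul _) ?_
    · refine Filter.Eventually.of_forall fun κ => Continuous.aestronglyMeasurable ?_
      have : ∀ s : ℝ, 1 + s ^ 2 ≠ 0 := fun s => by positivity
      fun_prop (disch := assumption)
    · refine Filter.Eventually.of_forall fun κ => ae_of_all _ fun s => ?_
      rw [norm_mul, Complex.norm_real, Real.norm_of_nonneg (by positivity)]
      exact mul_le_mul_of_nonneg_right (hC _) (by positivity)
    · refine ae_of_all _ fun s => Filter.Tendsto.mul_const _ ?_
      exact ((by fun_prop : Continuous fun κ : ℝ => G (γ + κ * s)).tendsto 0).mono_left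
        nhdsWithin_le_nhds
  have h0 : (∫ s : ℝ, G (γ + (0 : ℝ) * s) * ((2 * (1 + s ^ 2)⁻¹ : ℝ) : ℂ)) = 2 * Real.pi * G γ := by
    simp only [zero_mul, add_zero]
    rw [integral_const_mul, integral_complex_ofReal, integral_const_mul, integral_univ_inv_one_add_sq]
    push_cast; ring
  rw [h0] at hlim
  refine hlim.congr' ?_
  filter_upwards [self_mem_nhdsWithin] with κ hκ
  have hκ : 0 < κ := hκ
  rw [← integral_add_left_eq_self (fun y : ℝ => G y * (1 / (κ + Complex.I * y - Complex.I * γ) -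
      1 / (-κ + Complex.I * y - Complex.I * γ))) γ]
  have h1 := Measure.integral_comp_mul_left (fun x : ℝ => G (γ + x) * (1 / (κ + Complex.I * ((γ + x : ℝ) : ℂ) - Complex.I * γ) -
      1 / (-κ + Complex.I * ((γ + x : ℝ) : ℂ) - Complex.I * γ))) κ
  rw [abs_of_pos (inv_pos.2 hκ)] at h1
  have h2 : (∫ x : ℝ, G (γ + x) * (1 / (κ + Complex.I * ((γ + x : ℝ) : ℂ) - Complex.I * γ) -
      1 / (-κ + Complex.I * ((γ + x : ℝ) : ℂ) - Complex.I * γ))) = κ • (κ⁻¹ • ∫ x : ℝ, G (γ + x) * (1 / (κ + Complex.I * ((γ + x : ℝ) : ℂ) - Complex.I * γ) -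
      1 / (-κ + Complex.I * ((γ + x : ℝ) : ℂ) - Complex.I * γ))) := by
    rw [smul_smul, mul_inv_cancel₀ hκ.ne', one_smul]
  rw [h2, ← h1, ← integral_smul]
  congr 1 with s
  have hc : (κ : ℂ) ≠ 0 := by exact_mod_cast hκ.ne'
  have hs : (1 : ℂ) + s ^ 2 ≠ 0 := by
    have : (1 : ℝ) + s ^ 2 ≠ 0 := by positivity
    exact_mod_cast this
  have hs' : (1 + Complex.I * s) * (1 - Complex.I * s) = 1 + s ^ 2 := by
    linear_combination (-(s : ℂ) ^ 2) * Complex.I_sq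
  have n1 : (1 + Complex.I * s) ≠ 0 := left_ne_zero_of_mul (hs' ▸ hs)
  have n2 : (1 - Complex.I * s) ≠ 0 := right_ne_zero_of_mul (hs' ▸ hs)
  have e1 : (κ : ℂ) + Complex.I * ((γ + κ * s : ℝ) : ℂ) - Complex.I * γ = κ * (1 + Complex.I * s) := by
    push_cast; ring
  have e2 : -(κ : ℂ) + Complex.I * ((γ + κ * s : ℝ) : ℂ) - Complex.I * γ = -(κ * (1 - Complex.I * s)) := by
    push_cast; ring
  rw [e1, e2, Complex.real_smul]
  push_cast
  rw [← hs']
  field_simp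
  ring

section
variable {Q P G g : ℝ → ℂ} {f H : ℂ → ℂ} {A : ℕ} {C Y : ℝ}

theorem integral_exp_mul_mul_eq (hQ : Continuous Q) {κ : ℝ}
    (hQi : Integrable fun t : ℝ => Real.exp (-κ * t) * ‖Q t‖) (hG : Continuous G)
    (hGi : Integrable G) (hg : ∀ t : ℝ, g t = ∫ y : ℝ, G y * Complex.exp (-(Complex.I * y) * t)) :
    ∫ t : ℝ, (Real.exp (-κ * t) : ℂ) * Q t * g t = ∫ y : ℝ, G y * bilap Q (κ + Complex.I * y) := by
  have hQ' : Integrable fun t : ℝ => (Real.exp (-κ * t) : ℂ) * Q t :=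
    hQi.mono' (Continuous.aestronglyMeasurable (by fun_prop)) (ae_of_all _ fun t => by
      rw [norm_mul, Complex.norm_real, Real.norm_of_nonneg (Real.exp_pos _).le])
  have hF : Integrable (Function.uncurry fun (t y : ℝ) => (Real.exp (-κ * t) : ℂ) * Q t *
      (G y * Complex.exp (-(Complex.I * y) * t))) (volume.prod volume) := by
    refine (hQ'.mul_prod hGi).norm.mono' (Continuous.aestronglyMeasurable (by fun_prop))
      (ae_of_all _ fun p => ?_)
    have : ‖Complex.exp (-(Complex.I * p.2) * p.1)‖ = 1 := by
      rw [Complex.norm_exp]; simp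
    simp only [Function.uncurry, norm_mul, this, mul_one, le_refl]
  simp only [hg, ← integral_const_mul]
  rw [integral_integral_swap hF]
  congr 1 with y
  rw [bilap, ← integral_const_mul]
  congr 1 with t
  rw [show -((κ : ℂ) + Complex.I * y) * t = ((-κ * t : ℝ) : ℂ) + -(Complex.I * y) * t by push_cast; ring,
    Complex.exp_add, ← Complex.ofReal_exp]
  ring

theorem tendsto_integral_exp_mul_mul (hQ : Continuous Q) (hg : Continuous g)
    (hQb : ∀ σ : ℝ, 0 ≤ σ → σ < 1/4 → ∀ t, Real.exp (-σ * t) * ‖Q t‖ ≤ C * (1 + |t|) ^ A)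
    (hgi : Integrable fun t : ℝ => (1 + |t|) ^ A * ‖g t‖) :
    Filter.Tendsto (fun κ : ℝ => ∫ t : ℝ, (Real.exp (-κ * t) : ℂ) * Q t * g t)
      (nhdsWithin 0 (Set.Ioi 0)) (nhds (∫ t : ℝ, Q t * g t)) := by
  have h0 : (∫ t : ℝ, Q t * g t) = ∫ t : ℝ, (Real.exp (-(0 : ℝ) * t) : ℂ) * Q t * g t := by simp
  rw [h0]
  refine tendsto_integral_filter_of_dominated_convergence (fun t => C * ((1 + |t|) ^ A * ‖g t‖)) ?_ ?_
    (hgi.const_mul _) ?_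
  · exact Filter.Eventually.of_forall fun κ => Continuous.aestronglyMeasurable (by fun_prop)
  · filter_upwards [Ioo_mem_nhdsGT (show (0 : ℝ) < 1/4 by norm_num)] with κ hκ
    refine ae_of_all _ fun t => ?_
    rw [norm_mul, norm_mul, Complex.norm_real, Real.norm_of_nonneg (Real.exp_pos _).le, ← mul_assoc]
    exact mul_le_mul_of_nonneg_right (hQb κ hκ.1.le hκ.2 t) (norm_nonneg _)
  · refine ae_of_all _ fun t => ?_
    exact ((by fun_prop : Continuous fun κ : ℝ => (Real.exp (-κ * t) : ℂ) * Q t * g t).tendsto 0).mono_left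
      nhdsWithin_le_nhds

/-- Near a segment of the imaginary axis, `f'/f · H` is a sum of simple poles plus a continuous
function. -/
theorem exists_polar_part (hf : Differentiable ℂ f) (hne : ∃ z, f z ≠ 0)
    (hH : DifferentiableOn ℂ H {w | w.re ∈ Set.Ioo (-(1/4)) (1/4)}) (Y : ℝ) :
    ∃ (S : Finset ℝ) (E : ℂ → ℂ) (r : ℝ), 0 < r ∧ r < 1/4 ∧
      (∀ γ, γ ∈ S ↔ f (Complex.I * γ) = 0 ∧ |γ| ≤ Y) ∧
      ContinuousOn E {w | |w.re| ≤ r ∧ |w.im| ≤ Y} ∧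
      ∀ w : ℂ, w.re ≠ 0 → |w.re| ≤ r → |w.im| ≤ Y → f w ≠ 0 ∧ logDeriv f w * H w =
        ∑ γ ∈ S, (analyticOrderNatAt f (Complex.I * γ) : ℂ) * H (Complex.I * γ) *
          (1 / (w - Complex.I * γ)) + E w := by
  classical
  set S := (finite_zeros_imag_segment hf hne Y).toFinset
  have hS : ∀ γ, γ ∈ S ↔ f (Complex.I * γ) = 0 ∧ |γ| ≤ Y := fun γ => by
    simp [S]
  have hinj : Function.Injective fun γ : ℝ => Complex.I * (γ : ℂ) := fun a b h => by simpa using h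
  set S' : Finset ℂ := S.map ⟨_, hinj⟩
  obtain ⟨g, hg, hgS, hfg⟩ := exists_entire_factor_finset hf hne S'
  have hopen : IsOpen {w : ℂ | w.re ∈ Set.Ioo (-(1/4)) (1/4)} :=
    isOpen_Ioo.preimage Complex.continuous_re
  set V : Set ℂ := {w | w.re ∈ Set.Ioo (-(1/4)) (1/4) ∧ g w ≠ 0}
  have hV : IsOpen V := hopen.inter (isOpen_ne_fun hg.continuous continuous_const)
  set K : Set ℂ := (fun y : ℝ => Complex.I * (y : ℂ)) '' Set.Icc (-Y) Y
  have hK : IsCompact K := isCompact_Icc.image (by fun_prop)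
  have hKV : K ⊆ V := by
    rintro _ ⟨y, hy, rfl⟩
    refine ⟨by simp, fun h => ?_⟩
    have h0 : f (Complex.I * y) = 0 := by rw [hfg, h, mul_zero]
    exact hgS (Complex.I * y) (Finset.mem_map.2 ⟨y, (hS y).2 ⟨h0, abs_le.2 hy⟩, rfl⟩) h
  obtain ⟨r₀, hr₀, hr₀V⟩ := hK.exists_cthickening_subset_open hV hKV
  set r := min r₀ (1/8)
  have hbox : ∀ w : ℂ, |w.re| ≤ r → |w.im| ≤ Y → w ∈ V := by
    intro w h1 h2
    refine hr₀V (Metric.mem_cthickening_of_dist_le w (Complex.I * w.im) _ _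
      ⟨w.im, abs_le.1 h2, rfl⟩ ?_)
    have e : w - Complex.I * w.im = (w.re : ℂ) := by
      linear_combination -(Complex.re_add_im w)
    rw [dist_eq_norm, e, Complex.norm_real, Real.norm_eq_abs]
    exact h1.trans (min_le_left _ _)
  have h0mem : ∀ γ : ℝ, {w : ℂ | w.re ∈ Set.Ioo (-(1/4)) (1/4)} ∈ nhds (Complex.I * (γ : ℂ)) :=
    fun γ => hopen.mem_nhds (by simp)
  refine ⟨S, fun w => ∑ γ ∈ S, (analyticOrderNatAt f (Complex.I * γ) : ℂ) *
    dslope H (Complex.I * γ) w + deriv g w / g w * H w, r, by positivity,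
    (min_le_right _ _).trans_lt (by norm_num), hS, ?_, ?_⟩
  · have hc : ContinuousOn (fun w => ∑ γ ∈ S, (analyticOrderNatAt f (Complex.I * γ) : ℂ) *
        dslope H (Complex.I * γ) w + deriv g w / g w * H w) V := by
      have hHV : ContinuousOn H V := hH.continuousOn.mono fun w hw => hw.1
      refine ContinuousOn.add (continuousOn_finsetSum _ fun γ _ => continuousOn_const.mul
        (((Complex.differentiableOn_dslope (h0mem γ)).2 hH).continuousOn.mono fun w hw => hw.1)) ?_
      have hdg : Continuous (deriv g) := (hg.contDiff (n := 1)).continuous_deriv le_rfl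
      exact (hdg.continuousOn.div hg.continuous.continuousOn fun w hw => hw.2).mul hHV
    exact hc.mono fun w hw => hbox w hw.1 hw.2
  · intro w hw0 h1 h2
    have hwS : w ∉ S' := by
      intro h
      obtain ⟨γ, _, rfl⟩ := Finset.mem_map.1 h
      simp at hw0
    have hwV := hbox w h1 h2
    have hwγ : ∀ γ : ℝ, w ≠ Complex.I * γ := fun γ h => by rw [h] at hw0; simp at hw0
    refine ⟨?_, ?_⟩
    · rw [hfg]
      exact mul_ne_zero (Finset.prod_ne_zero_iff.2 fun ρ hρ => pow_ne_zero _
        (sub_ne_zero.2 fun h => hwS (h ▸ hρ))) hwV.2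
    · rw [logDeriv_eq_sum_add hg hfg hwS hwV.2, add_mul, Finset.sum_mul, Finset.sum_map,
        logDeriv_apply, ← add_assoc, ← Finset.sum_add_distrib]
      congr 1
      refine Finset.sum_congr rfl fun γ _ => ?_
      have hn : w - Complex.I * γ ≠ 0 := sub_ne_zero.2 (hwγ γ)
      rw [dslope_of_ne _ (hwγ γ), slope_def_field]
      simp only [Function.Embedding.coeFn_mk]
      field_simp
      ring

theorem tendsto_integral_sub_reflect {E : ℂ → ℂ} {r : ℝ} (hr : 0 < r)
    (hE : ContinuousOn E {w | |w.re| ≤ r ∧ |w.im| ≤ Y}) (hG : Continuous G) :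
    Filter.Tendsto (fun κ : ℝ => ∫ y in Set.Icc (-Y) Y, G y *
      (E (κ + Complex.I * y) - E (-κ + Complex.I * y))) (nhdsWithin 0 (Set.Ioi 0)) (nhds 0) := by
  have hmem : ∀ κ : ℝ, |κ| ≤ r → ∀ y ∈ Set.Icc (-Y) Y,
      (κ + Complex.I * y : ℂ) ∈ {w : ℂ | |w.re| ≤ r ∧ |w.im| ≤ Y} := by
    intro κ hκ y hy
    exact ⟨by simpa using hκ, by simpa using abs_le.2 hy⟩
  have hcomp : IsCompact {w : ℂ | |w.re| ≤ r ∧ |w.im| ≤ Y} := by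
    have : {w : ℂ | |w.re| ≤ r ∧ |w.im| ≤ Y} = Set.Icc (-r) r ×ℂ Set.Icc (-Y) Y := by
      ext w; simp [Complex.mem_reProdIm, abs_le]
    rw [this]
    exact isCompact_Icc.reProdIm isCompact_Icc
  obtain ⟨M, hM⟩ := hcomp.exists_bound_of_continuousOn hE
  have hcont : ∀ κ : ℝ, |κ| ≤ r → ContinuousOn (fun y : ℝ => E (κ + Complex.I * y)) (Set.Icc (-Y) Y) :=
    fun κ hκ => hE.comp (by fun_prop) fun y hy => hmem κ hκ y hy
  have h0 : (0 : ℂ) = ∫ y in Set.Icc (-Y) Y, (0 : ℂ) := by simp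
  rw [h0]
  refine tendsto_integral_filter_of_dominated_convergence (fun y => ‖G y‖ * (M + M)) ?_ ?_
    ((hG.norm.mul continuous_const).integrableOn_Icc) ?_
  · filter_upwards [Ioo_mem_nhdsGT hr] with κ hκ
    refine ContinuousOn.aestronglyMeasurable (hG.continuousOn.mul ((hcont κ ?_).sub ?_)) measurableSet_Icc
    · rw [abs_of_pos hκ.1]; exact hκ.2.le
    · have := hcont (-κ) (by rw [abs_neg, abs_of_pos hκ.1]; exact hκ.2.le)
      simpa using this
  · filter_upwards [Ioo_mem_nhdsGT hr] with κ hκ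
    refine (ae_restrict_iff' measurableSet_Icc).2 (ae_of_all _ fun y hy => ?_)
    rw [norm_mul]
    have h1 := hM _ (hmem κ (by rw [abs_of_pos hκ.1]; exact hκ.2.le) y hy)
    have h2 := hM _ (hmem (-κ) (by rw [abs_neg, abs_of_pos hκ.1]; exact hκ.2.le) y hy)
    rw [Complex.ofReal_neg] at h2
    exact mul_le_mul_of_nonneg_left ((norm_sub_le _ _).trans (add_le_add h1 h2)) (norm_nonneg _)
  · refine (ae_restrict_iff' measurableSet_Icc).2 (ae_of_all _ fun y hy => ?_)
    have hE0 := hE _ (hmem 0 (by simpa using hr.le) y hy)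
    have hlim : ∀ s : ℝ, |s| = 1 → Filter.Tendsto (fun κ : ℝ => E ((s * κ : ℝ) + Complex.I * y))
        (nhdsWithin 0 (Set.Ioi 0)) (nhds (E ((0 : ℝ) + Complex.I * y))) := by
      intro s hs
      refine hE0.tendsto.comp (tendsto_nhdsWithin_of_tendsto_nhds_of_eventually_within _ ?_ ?_)
      · have := (by fun_prop : Continuous fun κ : ℝ => ((s * κ : ℝ) : ℂ) + Complex.I * y).tendsto 0
        simpa using this.mono_left nhdsWithin_le_nhds
      · filter_upwards [Ioo_mem_nhdsGT hr] with κ hκ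
        exact hmem (s * κ) (by rw [abs_mul, hs, one_mul, abs_of_pos hκ.1]; exact hκ.2.le) y hy
    have := ((hlim 1 (by simp)).sub (hlim (-1) (by simp))).const_mul (G y)
    simpa using this

theorem integral_mul_fourier_eq_sum_zeros (hf : Differentiable ℂ f) (hne : ∃ z, f z ≠ 0)
    (hH : DifferentiableOn ℂ H {w | w.re ∈ Set.Ioo (-(1/4)) (1/4)})
    (hQ : Continuous Q) (hP : Continuous P)
    (hQb : ∀ σ : ℝ, 0 ≤ σ → σ < 1/4 → ∀ t, Real.exp (-σ * t) * ‖Q t‖ ≤ C * (1 + |t|) ^ A)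
    (hPb : ∀ σ : ℝ, 0 ≤ σ → σ < 1/4 → ∀ t, Real.exp (-σ * t) * ‖P t‖ ≤ C * (1 + |t|) ^ A)
    (hQi : ∀ σ : ℝ, 0 < σ → σ < 1/4 → Integrable fun t : ℝ => Real.exp (-σ * t) * ‖Q t‖)
    (hPi : ∀ σ : ℝ, 0 < σ → σ < 1/4 → Integrable fun t : ℝ => Real.exp (-σ * t) * ‖P t‖)
    (hQf : ∀ w : ℂ, 0 < w.re → w.re < 1/4 → bilap Q w * f w = deriv f w * H w)
    (hPf : ∀ w : ℂ, 0 < w.re → w.re < 1/4 → bilap P w * f (-w) = -(deriv f (-w) * H (-w)))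
    (hG : Continuous G) (hGY : ∀ y, Y < |y| → G y = 0) (hg : Continuous g)
    (hgG : ∀ t : ℝ, g t = ∫ y : ℝ, G y * Complex.exp (-(Complex.I * y) * t))
    (hgi : Integrable fun t : ℝ => (1 + |t|) ^ A * ‖g t‖) :
    ∃ S : Finset ℝ, (∀ γ, γ ∈ S ↔ f (Complex.I * γ) = 0 ∧ |γ| ≤ Y) ∧
      ∫ t : ℝ, (Q t + P (-t)) * g t = 2 * Real.pi * ∑ γ ∈ S,
        (analyticOrderNatAt f (Complex.I * γ) : ℂ) * H (Complex.I * γ) * G γ := by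
  obtain ⟨S, E, r, hr, hr4, hS, hE, hpol⟩ := exists_polar_part hf hne hH Y
  refine ⟨S, hS, ?_⟩
  have hGsupp : ∀ F : ℝ → ℂ, ∫ y : ℝ, G y * F y = ∫ y in Set.Icc (-Y) Y, G y * F y := by
    intro F
    refine (setIntegral_eq_integral_of_forall_compl_eq_zero fun y hy => ?_).symm
    rw [hGY y (by rw [← not_le, abs_le]; exact hy), zero_mul]
  have hGc : HasCompactSupport G := by
    refine HasCompactSupport.intro (isCompact_Icc (a := -Y) (b := Y)) fun y hy => ?_
    exact hGY y (by rw [← not_le, abs_le]; exact hy)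
  have hGi : Integrable G := hG.integrable_of_hasCompactSupport hGc
  obtain ⟨CG, hCG⟩ := hG.bounded_above_of_compact_support hGc
  have hsub0 : ∀ R : ℝ → ℂ, Continuous R →
      (∀ σ : ℝ, 0 ≤ σ → σ < 1/4 → ∀ t, Real.exp (-σ * t) * ‖R t‖ ≤ C * (1 + |t|) ^ A) →
      ∀ g' : ℝ → ℂ, Continuous g' → Integrable (fun t : ℝ => (1 + |t|) ^ A * ‖g' t‖) →
      Integrable fun t => R t * g' t := by
    intro R hR hRb g' hg' hg'i
    refine (hg'i.const_mul C).mono' (hR.mul hg').aestronglyMeasurable (ae_of_all _ fun t => ?_)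
    have := hRb 0 le_rfl (by norm_num) t
    simp only [neg_zero, zero_mul, Real.exp_zero, one_mul] at this
    rw [norm_mul, ← mul_assoc]
    exact mul_le_mul_of_nonneg_right this (norm_nonneg _)
  have hgn : Continuous fun t => g (-t) := hg.comp continuous_neg
  have hgni : Integrable fun t : ℝ => (1 + |t|) ^ A * ‖g (-t)‖ := by
    have := hgi.comp_neg
    simpa using this
  have hgnG : ∀ t : ℝ, g (-t) = ∫ y : ℝ, G (-y) * Complex.exp (-(Complex.I * y) * t) := by
    intro t
    rw [hgG, ← integral_neg_eq_self]
    congr 1 with y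
    push_cast; ring_nf
  have hPg : Integrable fun t => P (-t) * g t := by
    have := (hsub0 P hP hPb _ hgn hgni).comp_neg
    simpa using this
  have hsplit : ∫ t : ℝ, (Q t + P (-t)) * g t = (∫ t : ℝ, Q t * g t) + ∫ t : ℝ, P t * g (-t) := by
    simp only [add_mul]
    rw [integral_add (hsub0 Q hQ hQb g hg hgi) hPg, ← integral_neg_eq_self (fun t => P t * g (-t))]
    simp
  have hlim := (tendsto_integral_exp_mul_mul hQ hg hQb hgi).add
    (tendsto_integral_exp_mul_mul hP hgn hPb hgni)
  rw [← hsplit] at hlim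
  set ker : ℝ → ℝ → ℝ → ℂ := fun κ γ y => 1 / (κ + Complex.I * y - Complex.I * γ) -
      1 / (-κ + Complex.I * y - Complex.I * γ)
  have hlim2 : Filter.Tendsto (fun κ : ℝ => ∑ γ ∈ S, (analyticOrderNatAt f (Complex.I * γ) : ℂ) *
      H (Complex.I * γ) * (∫ y : ℝ, G y * ker κ γ y) + ∫ y in Set.Icc (-Y) Y, G y *
      (E (κ + Complex.I * y) - E (-κ + Complex.I * y))) (nhdsWithin 0 (Set.Ioi 0))
      (nhds (∑ γ ∈ S, (analyticOrderNatAt f (Complex.I * γ) : ℂ) *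
      H (Complex.I * γ) * (2 * Real.pi * G γ) + 0)) :=
    (tendsto_finsetSum _ fun γ _ => (tendsto_poisson hG hCG γ).const_mul _).add
      (tendsto_integral_sub_reflect hr hE hG)
  have heq := tendsto_nhds_unique (hlim.congr' ?_) hlim2
  · rw [heq, add_zero, Finset.mul_sum]
    exact Finset.sum_congr rfl fun γ _ => by ring
  · filter_upwards [Ioo_mem_nhdsGT hr] with κ hκ
    have hκ4 : κ < 1/4 := hκ.2.trans hr4
    have hκc : (κ : ℂ) ≠ 0 := by exact_mod_cast hκ.1.ne'
    rw [integral_exp_mul_mul_eq hQ (hQi κ hκ.1 hκ4) hG hGi hgG,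
      integral_exp_mul_mul_eq (G := fun y => G (-y)) hP (hPi κ hκ.1 hκ4) (hG.comp continuous_neg)
        hGi.comp_neg hgnG,
      ← integral_neg_eq_self (fun y : ℝ => G (-y) * bilap P (κ + Complex.I * y))]
    simp only [neg_neg]
    rw [hGsupp, hGsupp]
    have hbc : ∀ R : ℝ → ℂ, Continuous R → (∀ σ : ℝ, 0 < σ → σ < 1/4 →
        Integrable fun t : ℝ => Real.exp (-σ * t) * ‖R t‖) → ∀ s : ℝ,
        Continuous fun y : ℝ => bilap R (κ + Complex.I * ((s * y : ℝ) : ℂ)) := by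
      intro R hR hRi s
      have h1 := bilap_differentiableOn (a := 0) (b := 1/4) hR.aestronglyMeasurable
        fun σ hσ => hRi σ hσ.1 hσ.2
      exact h1.continuousOn.comp_continuous (by fun_prop) fun y => by
        simpa using ⟨hκ.1, by simpa using hκ4⟩
    have i1 : IntegrableOn (fun y : ℝ => G y * bilap Q (κ + Complex.I * y)) (Set.Icc (-Y) Y) := by
      have := hbc Q hQ hQi 1
      simp only [one_mul] at this
      exact (hG.mul this).integrableOn_Icc
    have i2 : IntegrableOn (fun y : ℝ => G y * bilap P (κ + Complex.I * ((-y : ℝ) : ℂ))) (Set.Icc (-Y) Y) := by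
      have := hbc P hP hPi (-1)
      simp only [neg_one_mul] at this
      exact (hG.mul this).integrableOn_Icc
    have hker : ∀ γ : ℝ, Continuous (ker κ γ) := by
      intro γ
      have n1 : ∀ y : ℝ, (κ + Complex.I * y - Complex.I * γ : ℂ) ≠ 0 := fun y h => by
        have := congrArg Complex.re h
        simp at this; exact hκ.1.ne' this
      have n2 : ∀ y : ℝ, (-κ + Complex.I * y - Complex.I * γ : ℂ) ≠ 0 := fun y h => by
        have := congrArg Complex.re h
        simp at this; exact hκ.1.ne' this
      simp only [ker]
      exact (continuous_const.div (by fun_prop) n1).sub (continuous_const.div (by fun_prop) n2)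
    have i3 : ∀ γ : ℝ, IntegrableOn (fun y : ℝ => (analyticOrderNatAt f (Complex.I * γ) : ℂ) *
        H (Complex.I * γ) * (G y * ker κ γ y)) (Set.Icc (-Y) Y) :=
      fun γ => (continuous_const.mul (hG.mul (hker γ))).integrableOn_Icc
    have hptw : ∀ y ∈ Set.Icc (-Y) Y, bilap Q (κ + Complex.I * y) +
        bilap P (κ + Complex.I * ((-y : ℝ) : ℂ)) =
        ∑ γ ∈ S, (analyticOrderNatAt f (Complex.I * γ) : ℂ) * H (Complex.I * γ) * ker κ γ y +
        (E (κ + Complex.I * y) - E (-κ + Complex.I * y)) := by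
      intro y hy
      obtain ⟨f1, h1⟩ := hpol (κ + Complex.I * y) (by simpa using hκ.1.ne')
        (by simpa [abs_of_pos hκ.1] using hκ.2.le) (by simpa using abs_le.2 hy)
      obtain ⟨f2, h2⟩ := hpol (-κ + Complex.I * y) (by simpa using hκ.1.ne')
        (by simpa [abs_of_pos hκ.1] using hκ.2.le) (by simpa using abs_le.2 hy)
      have q1 := hQf (κ + Complex.I * y) (by simpa using hκ.1) (by simpa using hκ4)
      have q2 := hPf (κ + Complex.I * ((-y : ℝ) : ℂ)) (by simpa using hκ.1) (by simpa using hκ4)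
      have e : -((κ : ℂ) + Complex.I * ((-y : ℝ) : ℂ)) = -κ + Complex.I * y := by push_cast; ring
      rw [e] at q2
      have b1 : bilap Q (κ + Complex.I * y) = logDeriv f (κ + Complex.I * y) * H (κ + Complex.I * y) := by
        rw [logDeriv_apply, div_mul_eq_mul_div, eq_div_iff f1, q1]
      have b2 : bilap P (κ + Complex.I * ((-y : ℝ) : ℂ)) =
          -(logDeriv f (-κ + Complex.I * y) * H (-κ + Complex.I * y)) := by
        rw [logDeriv_apply, div_mul_eq_mul_div, ← neg_div, eq_div_iff f2, q2]
      rw [b1, b2, h1, h2]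
      simp only [ker, mul_sub, Finset.sum_sub_distrib]
      ring
    rw [← integral_add i1 i2]
    have e3 : ∀ y ∈ Set.Icc (-Y) Y, G y * bilap Q (κ + Complex.I * y) +
        G y * bilap P (κ + Complex.I * ((-y : ℝ) : ℂ)) =
        ∑ γ ∈ S, (analyticOrderNatAt f (Complex.I * γ) : ℂ) * H (Complex.I * γ) * (G y * ker κ γ y) +
        G y * (E (κ + Complex.I * y) - E (-κ + Complex.I * y)) := by
      intro y hy
      rw [← mul_add, hptw y hy, mul_add, Finset.mul_sum]
      congr 1
      exact Finset.sum_congr rfl fun γ _ => by ring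
    rw [setIntegral_congr_fun measurableSet_Icc e3, integral_add (integrable_finsetSum _ fun γ _ => i3 γ),
      integral_finsetSum _ fun γ _ => i3 γ]
    · congr 1
      refine Finset.sum_congr rfl fun γ _ => ?_
      rw [integral_const_mul, hGsupp]
    · have i4 := (i1.add i2).sub (integrable_finsetSum S fun γ _ => i3 γ)
      refine i4.congr ((ae_restrict_iff' measurableSet_Icc).2 (ae_of_all _ fun y hy => ?_))
      simp only [Pi.sub_apply, Pi.add_apply]
      rw [e3 y hy]; simp

end

section

/-- `f` grows at most polynomially at `+∞` and decays exponentially at `-∞`. -/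
def PolyExpBound (f : ℝ → ℂ) (A : ℕ) (a C : ℝ) : Prop :=
  (∀ t, 0 ≤ t → ‖f t‖ ≤ C * (1 + t) ^ A) ∧ ∀ t, t ≤ 0 → ‖f t‖ ≤ C * Real.exp (a * t)

namespace PolyExpBound

variable {f g : ℝ → ℂ} {A : ℕ} {a C D : ℝ}

theorem nonneg (h : PolyExpBound f A a C) : 0 ≤ C := by
  have := (norm_nonneg _).trans (h.1 0 le_rfl)
  simpa using this

theorem add (hf : PolyExpBound f A a C) (hg : PolyExpBound g A a D) :
    PolyExpBound (fun t => f t + g t) A a (C + D) :=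
  ⟨fun t ht => (norm_add_le _ _).trans (by rw [add_mul]; exact add_le_add (hf.1 t ht) (hg.1 t ht)),
   fun t ht => (norm_add_le _ _).trans (by rw [add_mul]; exact add_le_add (hf.2 t ht) (hg.2 t ht))⟩

theorem neg (hf : PolyExpBound f A a C) : PolyExpBound (fun t => -f t) A a C :=
  ⟨fun t ht => by rw [norm_neg]; exact hf.1 t ht, fun t ht => by rw [norm_neg]; exact hf.2 t ht⟩

theorem of_exp_neg_abs (hC : 0 ≤ C) (ha : 0 ≤ a) (A : ℕ) (h : ∀ t, ‖f t‖ ≤ C * Real.exp (-a * |t|)) :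
    PolyExpBound f A a C := by
  refine ⟨fun t ht => (h t).trans (mul_le_mul_of_nonneg_left ?_ hC), fun t ht => (h t).trans_eq ?_⟩
  · exact (Real.exp_le_one_iff.2 (by nlinarith [abs_nonneg t])).trans (one_le_pow₀ (by linarith))
  · rw [abs_of_nonpos ht]; ring_nf

theorem mono (h : PolyExpBound f A a C) {b : ℝ} (hb : b ≤ a) : PolyExpBound f A b C :=
  ⟨h.1, fun t ht => (h.2 t ht).trans (mul_le_mul_of_nonneg_left
    (Real.exp_le_exp.2 (by nlinarith)) h.nonneg)⟩

theorem exp_mul_norm_le (h : PolyExpBound f A a C) {σ : ℝ} (h0 : 0 ≤ σ) (ha : σ ≤ a) (t : ℝ) :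
    Real.exp (-σ * t) * ‖f t‖ ≤ C * (1 + |t|) ^ A := by
  rcases le_total 0 t with ht | ht
  · rw [abs_of_nonneg ht]
    calc Real.exp (-σ * t) * ‖f t‖ ≤ 1 * ‖f t‖ := mul_le_mul_of_nonneg_right
          (Real.exp_le_one_iff.2 (by nlinarith)) (norm_nonneg _)
      _ ≤ _ := by rw [one_mul]; exact h.1 t ht
  · calc Real.exp (-σ * t) * ‖f t‖ ≤ Real.exp (-σ * t) * (C * Real.exp (a * t)) :=
          mul_le_mul_of_nonneg_left (h.2 t ht) (Real.exp_pos _).le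
      _ = C * Real.exp ((a - σ) * t) := by
          rw [mul_left_comm, ← Real.exp_add]; ring_nf
      _ ≤ C * (1 + |t|) ^ A := mul_le_mul_of_nonneg_left
          ((Real.exp_le_one_iff.2 (by nlinarith)).trans
            (one_le_pow₀ (by linarith [abs_nonneg t]))) h.nonneg

theorem integrable (h : PolyExpBound f A a C) (hf : Continuous f) {σ : ℝ} (h0 : 0 < σ)
    (ha : σ < a) : Integrable fun t : ℝ => Real.exp (-σ * t) * ‖f t‖ := by
  set K : ℝ := A.factorial * (2 / σ) ^ A * Real.exp (σ / 2) with hK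
  have hK0 : 0 ≤ K := by positivity
  have hpow : ∀ t : ℝ, 0 ≤ t → (1 + t) ^ A ≤ K * Real.exp (σ / 2 * t) := by
    intro t ht
    have := Real.pow_div_factorial_le_exp (σ / 2 * (1 + t)) (by positivity) A
    rw [div_le_iff₀ (by positivity), mul_pow] at this
    calc (1 + t) ^ A = (2 / σ) ^ A * ((σ / 2) ^ A * (1 + t) ^ A) := by
          rw [← mul_assoc, ← mul_pow, div_mul_div_cancel₀ h0.ne']; simp
      _ ≤ (2 / σ) ^ A * (Real.exp (σ / 2 * (1 + t)) * A.factorial) :=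
          mul_le_mul_of_nonneg_left this (by positivity)
      _ = _ := by rw [hK, mul_add, Real.exp_add]; ring_nf
  set s := min (σ / 2) (a - σ)
  have hs : 0 < s := lt_min (by linarith) (by linarith)
  refine ((integrable_exp_neg_abs hs).const_mul (C * (K + 1))).mono'
    (by fun_prop) (ae_of_all _ fun t => ?_)
  have hC := h.nonneg
  rw [Real.norm_of_nonneg (by positivity)]
  rcases le_total 0 t with ht | ht
  · rw [abs_of_nonneg ht]
    calc Real.exp (-σ * t) * ‖f t‖ ≤ Real.exp (-σ * t) * (C * (K * Real.exp (σ / 2 * t))) :=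
          mul_le_mul_of_nonneg_left ((h.1 t ht).trans
            (mul_le_mul_of_nonneg_left (hpow t ht) hC)) (Real.exp_pos _).le
      _ = C * K * Real.exp (-(σ / 2) * t) := by
          rw [show -(σ / 2) * t = -σ * t + σ / 2 * t by ring, Real.exp_add]; ring
      _ ≤ C * (K + 1) * Real.exp (-s * t) := by
          refine mul_le_mul (by nlinarith) (Real.exp_le_exp.2 ?_) (Real.exp_pos _).le (by positivity)
          nlinarith [min_le_left (σ / 2) (a - σ)]
  · rw [abs_of_nonpos ht]
    calc Real.exp (-σ * t) * ‖f t‖ ≤ Real.exp (-σ * t) * (C * Real.exp (a * t)) :=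
          mul_le_mul_of_nonneg_left (h.2 t ht) (Real.exp_pos _).le
      _ = C * 1 * Real.exp ((a - σ) * t) := by
          rw [mul_left_comm, ← Real.exp_add]; ring_nf
      _ ≤ C * (K + 1) * Real.exp (-s * -t) := by
          refine mul_le_mul (by nlinarith) (Real.exp_le_exp.2 ?_) (Real.exp_pos _).le (by positivity)
          nlinarith [min_le_right (σ / 2) (a - σ)]

end PolyExpBound

variable {δ : ℝ} {η : ℝ → ℝ} {N : ℕ} [NeZero N] {χ : DirichletCharacter ℂ N} {A : ℕ} {C : ℝ}

omit [NeZero N] in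
theorem exists_polyExpBound_psiChar (hδ : 0 < δ) (hη : MemS δ η)
    (h : ∀ t, 1 ≤ t → ‖psiChar η χ t‖ ≤ C * t ^ A) :
    ∃ C, PolyExpBound (psiChar η χ) A (1/2 + δ) C := by
  obtain ⟨C', hC', hb⟩ := hη.exists_bound
  have hψ := norm_psiChar_le χ hC'.le (fun t => (hb t).1) hδ le_rfl
  set D := C' * ∑' n : ℕ, ArithmeticFunction.vonMangoldt n * (n : ℝ) ^ (-(1 + δ))
  have hD : 0 ≤ D := mul_nonneg hC'.le (tsum_nonneg fun n =>
    mul_nonneg ArithmeticFunction.vonMangoldt_nonneg (by positivity))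
  refine ⟨|C| + D * Real.exp (1/2 + δ), fun t ht => ?_, fun t ht => ?_⟩
  · have hp : (1 : ℝ) ≤ (1 + t) ^ A := one_le_pow₀ (by linarith)
    have hE : 0 ≤ D * Real.exp (1/2 + δ) := by positivity
    rcases le_total 1 t with h1 | h1
    · calc ‖psiChar η χ t‖ ≤ |C| * (1 + t) ^ A := (h t h1).trans
            (mul_le_mul (le_abs_self C) (pow_le_pow_left₀ ht (by linarith) A) (by positivity)
              (abs_nonneg _))
        _ ≤ _ := by rw [add_mul]; nlinarith [mul_nonneg hE (zero_le_one.trans hp)]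
    · calc ‖psiChar η χ t‖ ≤ D * Real.exp (1/2 + δ) := (hψ t).trans
            (mul_le_mul_of_nonneg_left (Real.exp_le_exp.2 (by nlinarith)) hD)
        _ ≤ _ := by rw [add_mul]; nlinarith [abs_nonneg C]
  · refine (hψ t).trans (mul_le_mul_of_nonneg_right ?_ (Real.exp_pos _).le)
    nlinarith [abs_nonneg C, Real.one_le_exp (x := 1/2 + δ) (by linarith)]

theorem bilap_psiChar_mul_LFunction (hδ : 0 < δ) (hη : MemS δ η) (hχ : χ ≠ 1)
    (hb : PolyExpBound (psiChar η χ) A (1/2 + δ) C) {w : ℂ} (h0 : 0 < w.re)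
    (h1 : w.re < 1/2 + δ) :
    bilap (psiChar η χ) w * χ.LFunction (1/2 + w) =
      -(deriv χ.LFunction (1/2 + w) * bilap (fun t => (η t : ℂ)) w) := by
  set U : Set ℂ := {w | w.re ∈ Set.Ioo 0 (1/2 + δ)}
  have hU : IsOpen U := isOpen_Ioo.preimage Complex.continuous_re
  have hUc : Convex ℝ U := (convex_Ioo 0 (1/2 + δ)).linear_preimage Complex.reLm
  have hL : Differentiable ℂ χ.LFunction := DirichletCharacter.differentiable_LFunction hχ
  have hL' : Differentiable ℂ (deriv χ.LFunction) := hL.deriv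
  have a1 : AnalyticOnNhd ℂ (fun w => bilap (psiChar η χ) w * χ.LFunction (1/2 + w)) U := by
    refine DifferentiableOn.analyticOnNhd (.mul (bilap_differentiableOn
      (continuous_psiChar χ hδ hη).aestronglyMeasurable fun σ hσ =>
      hb.integrable (continuous_psiChar χ hδ hη) hσ.1 hσ.2) ?_) hU
    exact (hL.comp (differentiable_id.const_add _)).differentiableOn
  have a2 : AnalyticOnNhd ℂ (fun w => -(deriv χ.LFunction (1/2 + w) *
      bilap (fun t => (η t : ℂ)) w)) U := by
    refine DifferentiableOn.analyticOnNhd (.neg (.mul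
      (hL'.comp (differentiable_id.const_add _)).differentiableOn
      (hη.bilap_differentiableOn.mono fun w hw => ?_))) hU
    exact ⟨by have := hw.1; linarith, hw.2⟩
  have hz : ((1/2 + δ/2 : ℝ) : ℂ) ∈ U := by
    show (((1/2 + δ/2 : ℝ) : ℂ)).re ∈ Set.Ioo _ _
    rw [Complex.ofReal_re]; constructor <;> linarith
  refine a1.eqOn_of_preconnected_of_eventuallyEq a2 hUc.isPreconnected hz ?_
    (show w ∈ U from ⟨h0, h1⟩)
  have hV : IsOpen {w : ℂ | w.re ∈ Set.Ioo (1/2 : ℝ) (1/2 + δ)} :=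
    isOpen_Ioo.preimage Complex.continuous_re
  filter_upwards [hV.mem_nhds (show ((1/2 + δ/2 : ℝ) : ℂ).re ∈ Set.Ioo (1/2 : ℝ) (1/2 + δ) by
    rw [Complex.ofReal_re]; constructor <;> linarith)] with w hw
  have hne : χ.LFunction (1/2 + w) ≠ 0 :=
    χ.LFunction_ne_zero_of_one_le_re (.inl hχ) (by have := hw.1; simp; linarith)
  rw [bilap_psiChar χ hδ hη hw.1 hw.2]
  generalize χ.LFunction (1/2 + w) = L at hne ⊢
  field_simp

end

section
variable {δ : ℝ} {η : ℝ → ℝ} {N : ℕ} [NeZero N] {χ : DirichletCharacter ℂ N} {A : ℕ} {C : ℝ}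

open Classical in
/-- The shift in the gamma factor of `χ`: `0` for even and `1` for odd characters. -/
noncomputable def parityShift (χ : DirichletCharacter ℂ N) : ℝ := if χ.Even then 0 else 1

omit [NeZero N] in
theorem parityShift_mem (χ : DirichletCharacter ℂ N) : parityShift χ ∈ Set.Icc (0 : ℝ) 1 := by
  unfold parityShift; split_ifs <;> norm_num

omit [NeZero N] in
theorem parityShift_inv (χ : DirichletCharacter ℂ N) : parityShift χ⁻¹ = parityShift χ := by
  have : χ⁻¹.Even ↔ χ.Even := by
    simp only [DirichletCharacter.Even, MulChar.inv_apply_eq_inv', inv_eq_one]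
  unfold parityShift
  split_ifs <;> simp_all

omit [NeZero N] in
theorem gammaFactor_eq (χ : DirichletCharacter ℂ N) (s : ℂ) :
    χ.gammaFactor s = Complex.Gammaℝ (s + parityShift χ) := by
  unfold parityShift
  split_ifs with h
  · simp [h.gammaFactor_def]
  · rw [(χ.even_or_odd.resolve_left h).gammaFactor_def]; simp

/-- The arithmetic and archimedean part of the explicit formula for `χ`. -/
noncomputable def explicitTerm (η : ℝ → ℝ) (χ : DirichletCharacter ℂ N) (t : ℝ) : ℂ :=
  -psiChar η χ t + (archTerm η (parityShift χ) t : ℂ)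

omit [NeZero N] in
theorem continuous_explicitTerm (hδ : 0 < δ) (hη : MemS δ η) (χ : DirichletCharacter ℂ N) :
    Continuous (explicitTerm η χ) :=
  (continuous_psiChar χ hδ hη).neg.add
    (Complex.continuous_ofReal.comp (hη.continuous_archTerm hδ (parityShift_mem χ)))

theorem conj_explicitTerm (χ : DirichletCharacter ℂ N) (t : ℝ) :
    conj (explicitTerm η χ t) = explicitTerm η χ⁻¹ t := by
  simp [explicitTerm, conj_psiChar, parityShift_inv]

omit [NeZero N] in
theorem exists_polyExpBound_explicitTerm (hδ : 0 < δ) (hη : MemS δ η)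
    (hb : PolyExpBound (psiChar η χ) A (1/2 + δ) C) :
    ∃ C, PolyExpBound (explicitTerm η χ) A (1/4) C := by
  obtain ⟨D, hD, h⟩ := hη.exists_archTerm_bound hδ
  refine ⟨_, (hb.mono (by linarith)).neg.add (.of_exp_neg_abs hD.le (by norm_num) A fun t => ?_)⟩
  rw [Complex.norm_real]; exact h _ (parityShift_mem χ) t

theorem bilap_add {f g : ℝ → ℂ} (hf : AEStronglyMeasurable f) (hg : AEStronglyMeasurable g) {w : ℂ}
    (hf' : Integrable fun t : ℝ => Real.exp (-w.re * t) * ‖f t‖)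
    (hg' : Integrable fun t : ℝ => Real.exp (-w.re * t) * ‖g t‖) :
    bilap (fun t => f t + g t) w = bilap f w + bilap g w := by
  simp only [bilap, mul_add]
  exact integral_add (integrable_exp_mul hf hf') (integrable_exp_mul hg hg')

theorem bilap_neg_fun (f : ℝ → ℂ) (w : ℂ) : bilap (fun t => -f t) w = -bilap f w := by
  simp only [bilap, mul_neg]; exact integral_neg _

theorem bilap_explicitTerm_mul (hδ : 0 < δ) (hη : MemS δ η) (hχ : χ ≠ 1)
    (hb : PolyExpBound (psiChar η χ) A (1/2 + δ) C) {w : ℂ} (h0 : 0 < w.re) (h1 : w.re < 1/4) :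
    bilap (explicitTerm η χ) w * χ.completedLFunction (1/2 + w) =
      deriv χ.completedLFunction (1/2 + w) * bilap (fun t => (η t : ℂ)) w := by
  have hN : N ≠ 1 := fun h => by subst h; exact hχ (Subsingleton.elim _ _)
  have cψ := continuous_psiChar χ hδ hη
  have cA : Continuous fun t : ℝ => ((archTerm η (parityShift χ) t : ℝ) : ℂ) :=
    Complex.continuous_ofReal.comp (hη.continuous_archTerm hδ (parityShift_mem χ))
  obtain ⟨D, hD, h⟩ := hη.exists_archTerm_bound hδ
  have hw : |w.re| < 1/4 := by rwa [abs_of_pos h0]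
  have hbil : bilap (explicitTerm η χ) w = -bilap (psiChar η χ) w +
      logDeriv Complex.Gammaℝ (1/2 + parityShift χ + w) * bilap (fun t => (η t : ℂ)) w := by
    rw [← hη.bilap_archTerm hδ (parityShift_mem χ) hw, ← bilap_neg_fun]
    refine bilap_add cψ.neg.aestronglyMeasurable cA.aestronglyMeasurable ?_ ?_
    · simpa using hb.integrable cψ h0 (by linarith)
    · refine integrable_exp_mul_norm cA.aestronglyMeasurable (C := D) (fun t => ?_) hw
      rw [Complex.norm_real]; exact h _ (parityShift_mem χ) t
  set s : ℂ := 1/2 + w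
  have hs : 0 < s.re := by simp [s]; linarith
  have hsκ : ∀ z : ℂ, 0 < z.re → 0 < (z + parityShift χ).re := fun z hz => by
    have := (parityShift_mem χ).1
    simp; linarith
  have hΓ : ∀ z : ℂ, 0 < z.re → Complex.Gammaℝ (z + parityShift χ) ≠ 0 := fun z hz =>
    Complex.Gammaℝ_ne_zero_of_re_pos (hsκ z hz)
  have hL := DirichletCharacter.differentiable_LFunction hχ
  have hprod : ∀ z : ℂ, 0 < z.re → χ.completedLFunction z =
      χ.LFunction z * Complex.Gammaℝ (z + parityShift χ) := fun z hz => by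
    rw [χ.LFunction_eq_completed_div_gammaFactor z (.inr hN), gammaFactor_eq,
      div_mul_cancel₀ _ (hΓ z hz)]
  have hΓd : DifferentiableAt ℂ Complex.Gammaℝ (s + parityShift χ) := by
    exact ((Complex.differentiable_Gammaℝ_inv (s + parityShift χ)).inv
      (inv_ne_zero (hΓ s hs))).congr_of_eventuallyEq (.of_forall fun z => by simp)
  have hd : deriv χ.completedLFunction s = deriv χ.LFunction s * Complex.Gammaℝ (s + parityShift χ) +
      χ.LFunction s * deriv Complex.Gammaℝ (s + parityShift χ) := by
    have hev : χ.completedLFunction =ᶠ[nhds s]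
        fun z => χ.LFunction z * Complex.Gammaℝ (z + parityShift χ) := by
      filter_upwards [(isOpen_Ioi.preimage Complex.continuous_re).mem_nhds hs] with z hz
      exact hprod z hz
    rw [hev.deriv_eq]
    exact ((hL s).hasDerivAt.mul (hΓd.hasDerivAt.comp_add_const s _)).deriv
  have key := bilap_psiChar_mul_LFunction hδ hη hχ hb h0 (by linarith)
  rw [hbil, hprod s hs, hd, show 1/2 + (parityShift χ : ℂ) + w = s + parityShift χ by simp only [s]; ring,
    logDeriv_apply]
  have hne := hΓ s hs
  change bilap (psiChar η χ) w * χ.LFunction s = -(deriv χ.LFunction s * _) at key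
  generalize Complex.Gammaℝ (s + parityShift χ) = g at hne ⊢
  field_simp
  linear_combination (-g) * key

theorem bilap_explicitTerm_inv_mul (hδ : 0 < δ) (hη : MemS δ η) (hχ : χ ≠ 1) (hprim : χ.IsPrimitive)
    (hb : PolyExpBound (psiChar η χ⁻¹) A (1/2 + δ) C) {w : ℂ} (h0 : 0 < w.re) (h1 : w.re < 1/4) :
    bilap (fun t => explicitTerm η χ⁻¹ t + ((Real.log N * η t : ℝ) : ℂ)) w *
      χ.completedLFunction (1/2 + -w) =
      -(deriv χ.completedLFunction (1/2 + -w) * bilap (fun t => (η t : ℂ)) (-w)) := by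
  have hχ' : χ⁻¹ ≠ 1 := inv_ne_one.2 hχ
  have hNC : (N : ℂ) ≠ 0 := Nat.cast_ne_zero.2 (NeZero.ne N)
  obtain ⟨D, hD⟩ := exists_polyExpBound_explicitTerm hδ hη hb
  have cη : Continuous fun t => (η t : ℂ) := Complex.continuous_ofReal.comp hη.continuous
  have hbil : bilap (fun t => explicitTerm η χ⁻¹ t + ((Real.log N * η t : ℝ) : ℂ)) w =
      bilap (explicitTerm η χ⁻¹) w + Real.log N * bilap (fun t => (η t : ℂ)) w := by
    rw [bilap_add (continuous_explicitTerm hδ hη _).aestronglyMeasurable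
      (Continuous.aestronglyMeasurable (by push_cast; exact continuous_const.mul cη))
      (hD.integrable (continuous_explicitTerm hδ hη _) h0 h1)]
    · congr 1
      simp only [bilap]
      rw [← integral_const_mul]
      congr 1 with t
      push_cast; ring
    · have := (hη.integrable_exp_mul_norm (σ := w.re) (by rw [abs_of_pos h0]; linarith)).const_mul
        |Real.log N|
      refine this.congr (ae_of_all _ fun t => ?_)
      simp only [Complex.ofReal_mul, norm_mul, Complex.norm_real, Real.norm_eq_abs]
      ring
  have hFE : ∀ z : ℂ, χ.completedLFunction (1/2 + -z) =
      (N : ℂ) ^ z * χ.rootNumber * χ⁻¹.completedLFunction (1/2 + z) := fun z => by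
    have := hprim.completedLFunction_one_sub (1/2 + z)
    rw [show (1 : ℂ) - (1/2 + z) = 1/2 + -z by ring, show (1/2 : ℂ) + z - 1/2 = z by ring] at this
    exact this
  have hd : -deriv χ.completedLFunction (1/2 + -w) = (N : ℂ) ^ w * χ.rootNumber *
      (Real.log N * χ⁻¹.completedLFunction (1/2 + w) + deriv χ⁻¹.completedLFunction (1/2 + w)) := by
    have hl : HasDerivAt (fun z : ℂ => χ.completedLFunction (1/2 + -z))
        (deriv χ.completedLFunction (1/2 + -w) * -1) w :=
      ((DirichletCharacter.differentiable_completedLFunction hχ _).hasDerivAt).comp w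
        ((hasDerivAt_neg w).const_add _)
    have hp : HasDerivAt (fun z : ℂ => (N : ℂ) ^ z) ((N : ℂ) ^ w * Complex.log N * 1) w :=
      (hasDerivAt_id w).const_cpow (.inl hNC)
    have hr := (hp.mul_const χ.rootNumber).mul
      (((DirichletCharacter.differentiable_completedLFunction hχ' (1/2 + w)).hasDerivAt).comp_const_add
        (1/2) w)
    have := hl.unique (hr.congr_of_eventuallyEq (.of_forall hFE))
    rw [mul_neg_one] at this
    rw [this, ← Complex.natCast_log]; ring
  have key := bilap_explicitTerm_mul hδ hη hχ' hb h0 h1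
  rw [hbil, hFE, hη.bilap_neg, ← neg_mul, hd]
  linear_combination ((N : ℂ) ^ w * χ.rootNumber) * key

end

section

open scoped FourierTransform in
/-- A bump function equal to `1` on `[-1, 1]` together with its rapidly decreasing transform. -/
theorem exists_bump_transform : ∃ (β : ℝ → ℝ) (b : ℝ → ℂ), Continuous β ∧ Continuous b ∧
    (∀ y, |y| ≤ 1 → β y = 1) ∧ (∀ y, 2 < |y| → β y = 0) ∧ (∀ y, 0 ≤ β y) ∧ (∀ y, β y ≤ 1) ∧
    (∀ s : ℝ, b s = ∫ y : ℝ, (β y : ℂ) * Complex.exp (-(Complex.I * y) * s)) ∧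
    (∀ A : ℕ, Integrable fun s : ℝ => (1 + |s|) ^ A * ‖b s‖) ∧ ∫ s, b s = 2 * Real.pi := by
  let φ : ContDiffBump (0 : ℝ) := ⟨1, 2, one_pos, one_lt_two⟩
  have hc : HasCompactSupport fun y => (φ y : ℂ) :=
    φ.hasCompactSupport.comp_left (g := fun r : ℝ => (r : ℂ)) Complex.ofReal_zero
  have hs : ContDiff ℝ (⊤ : ℕ∞) fun y => (φ y : ℂ) :=
    Complex.ofRealCLM.contDiff.comp φ.contDiff
  let F : SchwartzMap ℝ ℂ := hc.toSchwartzMap hs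
  have hF : ∀ y, F y = φ y := fun y => rfl
  have hπ : (0 : ℝ) < 2 * Real.pi := by positivity
  have hnorm : Integrable fun s : ℝ => 𝓕 F (s / (2 * Real.pi)) :=
    ((𝓕 F).integrable).comp_div hπ.ne'
  refine ⟨φ, fun s => 𝓕 F (s / (2 * Real.pi)), φ.continuous,
    (𝓕 F).continuous.comp (by fun_prop), fun y hy => ?_, fun y hy => ?_, fun y => φ.nonneg,
    fun y => φ.le_one, fun s => ?_, fun A => ?_, ?_⟩
  · exact φ.one_of_mem_closedBall (by simpa using hy)
  · exact φ.zero_of_le_dist (by simpa using hy.le)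
  · show 𝓕 (F : ℝ → ℂ) (s / (2 * Real.pi)) = _
    rw [Real.fourier_real_eq_integral_exp_smul]
    congr 1 with y
    rw [hF, smul_eq_mul, mul_comm]
    congr 2
    push_cast
    field_simp
  · have h1 := (((𝓕 F).integrable_pow_mul volume A).comp_div hπ.ne').const_mul ((2 * Real.pi) ^ A)
    have h2 := (h1.add hnorm.norm).const_mul (2 ^ (A - 1))
    refine h2.mono' (Continuous.aestronglyMeasurable ?_) (ae_of_all _ fun s => ?_)
    · have := (𝓕 F).continuous
      fun_prop
    · rw [Real.norm_of_nonneg (by positivity)]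
      have := add_pow_le (abs_nonneg s) zero_le_one A
      rw [one_pow, add_comm |s|] at this
      simp only [Pi.add_apply, Real.norm_eq_abs, abs_div, abs_of_pos hπ, div_pow]
      calc (1 + |s|) ^ A * ‖𝓕 F (s / (2 * Real.pi))‖
          ≤ 2 ^ (A - 1) * (|s| ^ A + 1) * ‖𝓕 F (s / (2 * Real.pi))‖ :=
            mul_le_mul_of_nonneg_right this (norm_nonneg _)
        _ = _ := by field_simp
  · rw [Measure.integral_comp_div (fun s => 𝓕 F s), abs_of_pos hπ]
    have h0 : 𝓕⁻ (𝓕 F) 0 = ∫ s, 𝓕 F s := by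
      rw [SchwartzMap.fourierInv_coe, Real.fourierInv_eq']
      simp
    rw [← h0, FourierTransform.fourierInv_fourier_eq, hF,
      φ.one_of_mem_closedBall (by simp [φ])]
    simp

/-- A polynomially bounded function whose spectral side is a nonnegative discrete measure is an
absolutely convergent trigonometric sum. -/
theorem hasSum_of_integral_eq_sum {R : ℝ → ℂ} {A : ℕ} {C : ℝ} (hR : Continuous R)
    (hRb : ∀ t, ‖R t‖ ≤ C * (1 + |t|) ^ A) {Z : Set ℝ} {a : ℝ → ℝ} (ha : ∀ γ, 0 ≤ a γ)
    (h : ∀ (G g : ℝ → ℂ) (Y : ℝ), Continuous G → (∀ y, Y < |y| → G y = 0) → Continuous g →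
      (∀ t : ℝ, g t = ∫ y : ℝ, G y * Complex.exp (-(Complex.I * y) * t)) →
      (Integrable fun t => (1 + |t|) ^ A * ‖g t‖) →
      ∃ S : Finset ℝ, (∀ γ, γ ∈ S ↔ γ ∈ Z ∧ |γ| ≤ Y) ∧
        ∫ t, R t * g t = 2 * Real.pi * ∑ γ ∈ S, (a γ : ℂ) * G γ) :
    (Summable fun γ : Z => a γ) ∧
      ∀ t : ℝ, HasSum (fun γ : Z => (a γ : ℂ) * Complex.exp (Complex.I * γ * t)) (R t) := by
  obtain ⟨β, b, hβ, hb, hβ1, hβ0, hβn, hβl, hbβ, hbi, hbint⟩ := exists_bump_transform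
  have hC : 0 ≤ C := by
    have := (norm_nonneg _).trans (hRb 0)
    simpa using this
  have hπ : (2 * Real.pi : ℂ) ≠ 0 := by exact_mod_cast Real.two_pi_pos.ne'
  -- the smoothed sums
  have key : ∀ t₀ Y : ℝ, 0 < Y → ∃ S : Finset ℝ, (∀ γ, γ ∈ S ↔ γ ∈ Z ∧ |γ| ≤ 2 * Y) ∧
      ∑ γ ∈ S, (a γ : ℂ) * (β (γ / Y) * Complex.exp (Complex.I * γ * t₀)) =
        (2 * Real.pi : ℂ)⁻¹ * ∫ s, R (t₀ + s / Y) * b s := by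
    intro t₀ Y hY
    have main := h (fun y => β (y / Y) * Complex.exp (Complex.I * y * t₀))
      (fun t => Y * b (Y * (t - t₀))) (2 * Y) (by fun_prop) ?_ (by fun_prop) ?_ ?_
    · obtain ⟨S, hS, hE⟩ := main
      refine ⟨S, hS, ?_⟩
      rw [eq_inv_mul_iff_mul_eq₀ hπ, ← hE]
      rw [← integral_sub_right_eq_self _ (-t₀)]
      have := Measure.integral_comp_div (fun s => R (s - -t₀) * (Y * b (Y * (s - -t₀ - t₀)))) Y
      rw [abs_of_pos hY] at this
      rw [← inv_smul_smul₀ hY.ne' (∫ x, R (x - -t₀) * (Y * b (Y * (x - -t₀ - t₀)))), ← this,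
        ← integral_smul]
      congr 1 with s
      rw [sub_neg_eq_add, add_sub_cancel_right, mul_div_cancel₀ _ hY.ne', Complex.real_smul,
        Complex.ofReal_inv, add_comm t₀]
      have : (Y : ℂ) ≠ 0 := by exact_mod_cast hY.ne'
      field_simp
    · intro y hy
      rw [hβ0 _ (by rwa [abs_div, abs_of_pos hY, lt_div_iff₀ hY])]; simp
    · intro t
      rw [hbβ]
      have := Measure.integral_comp_div (fun y : ℝ => (β y : ℂ) *
        Complex.exp (-(Complex.I * y) * (Y * (t - t₀) : ℝ))) Y
      rw [abs_of_pos hY, Complex.real_smul] at this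
      rw [← this]
      congr 1 with y
      rw [mul_assoc, ← Complex.exp_add]
      congr 2
      have : (Y : ℂ) ≠ 0 := by exact_mod_cast hY.ne'
      push_cast
      field_simp
      ring
    · have h1 := (((hbi A).comp_mul_left' hY.ne').comp_sub_right t₀).const_mul
        (((1 + |t₀|) * (1 + 1 / Y)) ^ A * Y)
      refine h1.mono' (Continuous.aestronglyMeasurable (by fun_prop)) (ae_of_all _ fun t => ?_)
      rw [Real.norm_of_nonneg (by positivity), norm_mul, Complex.norm_real, Real.norm_of_nonneg hY.le]
      have h2 : (1 + |t|) ≤ (1 + |t₀|) * (1 + 1 / Y) * (1 + |Y * (t - t₀)|) := by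
        rw [abs_mul, abs_of_pos hY]
        have h3 : |t| ≤ |t - t₀| + |t₀| := by
          simpa using abs_add_le (t - t₀) t₀
        have h4 : 1 + |t - t₀| ≤ (1 + 1 / Y) * (1 + Y * |t - t₀|) := by
          have : (1 + 1 / Y) * (1 + Y * |t - t₀|) = 1 + |t - t₀| + (1 / Y + Y * |t - t₀|) := by
            field_simp; ring
          rw [this]
          have : 0 ≤ 1 / Y + Y * |t - t₀| := by positivity
          linarith
        calc 1 + |t| ≤ (1 + |t₀|) * (1 + |t - t₀|) := by
              nlinarith [mul_nonneg (abs_nonneg t₀) (abs_nonneg (t - t₀))]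
          _ ≤ _ := by rw [mul_assoc]; exact mul_le_mul_of_nonneg_left h4 (by positivity)
      calc (1 + |t|) ^ A * (Y * ‖b (Y * (t - t₀))‖)
          ≤ ((1 + |t₀|) * (1 + 1 / Y) * (1 + |Y * (t - t₀)|)) ^ A * (Y * ‖b (Y * (t - t₀))‖) :=
            mul_le_mul_of_nonneg_right (pow_le_pow_left₀ (by positivity) h2 A) (by positivity)
        _ = _ := by rw [mul_pow]; ring
  have lim : ∀ t₀ : ℝ, Filter.Tendsto (fun Y : ℝ => (2 * Real.pi : ℂ)⁻¹ *
      ∫ s, R (t₀ + s / Y) * b s) Filter.atTop (nhds (R t₀)) := by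
    intro t₀
    have : Filter.Tendsto (fun Y : ℝ => ∫ s, R (t₀ + s / Y) * b s) Filter.atTop
        (nhds (∫ s, R t₀ * b s)) := by
      refine tendsto_integral_filter_of_dominated_convergence
        (fun s => C * (1 + |t₀|) ^ A * ((1 + |s|) ^ A * ‖b s‖)) ?_ ?_ ((hbi A).const_mul _) ?_
      · exact .of_forall fun Y => Continuous.aestronglyMeasurable (by fun_prop)
      · filter_upwards [Filter.eventually_ge_atTop 1] with Y hY
        refine ae_of_all _ fun s => ?_
        rw [norm_mul, ← mul_assoc]
        refine mul_le_mul_of_nonneg_right ((hRb _).trans ?_) (norm_nonneg _)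
        rw [mul_assoc, ← mul_pow]
        refine mul_le_mul_of_nonneg_left (pow_le_pow_left₀ (by positivity) ?_ A) hC
        have h1 : |s / Y| ≤ |s| := by
          rw [abs_div, abs_of_pos (by linarith : 0 < Y)]
          exact div_le_self (abs_nonneg s) hY
        nlinarith [abs_add_le t₀ (s / Y), mul_nonneg (abs_nonneg t₀) (abs_nonneg s)]
      · refine ae_of_all _ fun s => ?_
        have h1 : Filter.Tendsto (fun Y : ℝ => t₀ + s / Y) Filter.atTop (nhds (t₀ + 0)) :=
          (Filter.Tendsto.div_atTop tendsto_const_nhds Filter.tendsto_id).const_add t₀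
        rw [add_zero] at h1
        exact ((hR.tendsto t₀).comp h1).mul_const _
    rw [integral_const_mul, hbint] at this
    have := this.const_mul (2 * Real.pi : ℂ)⁻¹
    rwa [mul_comm (R t₀), inv_mul_cancel_left₀ hπ] at this
  choose! S hS hSE using key
  have hsum : Summable fun γ : Z => a γ := by
    refine summable_of_sum_le (c := ‖R 0‖ + 1) (fun γ => ha γ) fun F => ?_
    have h1 := (lim 0).norm.eventually (eventually_le_nhds (b := ‖R 0‖ + 1) (by linarith))
    obtain ⟨Y, hY, hY0, hYF⟩ := (h1.and ((Filter.eventually_gt_atTop (0 : ℝ)).and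
      ((Filter.eventually_all_finset F).2 fun γ _ =>
        Filter.eventually_ge_atTop |(γ : ℝ)|))).exists
    rw [← hSE 0 Y hY0] at hY
    have h2 : ∑ γ ∈ S 0 Y, (a γ : ℂ) * (β (γ / Y) * Complex.exp (Complex.I * γ * (0 : ℝ))) =
        ((∑ γ ∈ S 0 Y, a γ * β (γ / Y) : ℝ) : ℂ) := by
      push_cast; simp
    rw [h2, Complex.norm_real] at hY
    refine le_trans ?_ ((le_abs_self _).trans hY)
    rw [show ∑ γ ∈ F, a γ = ∑ γ ∈ F.map (Function.Embedding.subtype _), a γ from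
      (Finset.sum_map F (Function.Embedding.subtype _) a).symm]
    calc ∑ γ ∈ F.map (Function.Embedding.subtype _), a γ
        = ∑ γ ∈ F.map (Function.Embedding.subtype _), a γ * β (γ / Y) := by
          refine Finset.sum_congr rfl fun γ hγ => ?_
          obtain ⟨z, hz, rfl⟩ := Finset.mem_map.1 hγ
          have hz2 : |(z : ℝ)| ≤ Y := hYF z hz
          show a z = a z * β (z / Y)
          rw [hβ1 _ (by rw [abs_div, abs_of_pos hY0]; exact div_le_one_of_le₀ hz2 hY0.le), mul_one]
      _ ≤ _ := Finset.sum_le_sum_of_subset_of_nonneg (fun γ hγ => ?_)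
          fun γ _ _ => mul_nonneg (ha γ) (hβn _)
    obtain ⟨z, hz, rfl⟩ := Finset.mem_map.1 hγ
    have hz2 : |(z : ℝ)| ≤ Y := hYF z hz
    exact (hS 0 Y hY0 _).2 ⟨z.2, hz2.trans (by linarith)⟩
  have hnexp : ∀ γ t : ℝ, ‖Complex.exp (Complex.I * γ * t)‖ = 1 := fun γ t => by
    rw [mul_assoc, ← Complex.ofReal_mul, mul_comm]; exact Complex.norm_exp_ofReal_mul_I _
  refine ⟨hsum, fun t => ?_⟩
  have hs2 : Summable fun γ : Z => (a γ : ℂ) * Complex.exp (Complex.I * γ * t) := by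
    refine .of_norm (hsum.congr fun γ => ?_)
    rw [norm_mul, hnexp, mul_one, Complex.norm_real, Real.norm_of_nonneg (ha γ)]
  have hdom : Filter.Tendsto (fun Y : ℝ => ∑' γ : Z, (a γ : ℂ) * (β (γ / Y) *
      Complex.exp (Complex.I * γ * t))) Filter.atTop
      (nhds (∑' γ : Z, (a γ : ℂ) * Complex.exp (Complex.I * γ * t))) := by
    refine tendsto_tsum_of_dominated_convergence hsum (fun γ => ?_) (.of_forall fun Y γ => ?_)
    · refine tendsto_const_nhds.congr' ?_
      filter_upwards [Filter.eventually_ge_atTop |(γ : ℝ)|, Filter.eventually_gt_atTop 0] with Y h1 h2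
      rw [hβ1 _ (by rw [abs_div, abs_of_pos h2]; exact div_le_one_of_le₀ h1 h2.le)]
      simp
    · rw [norm_mul, norm_mul, hnexp, mul_one, Complex.norm_real, Complex.norm_real,
        Real.norm_of_nonneg (ha γ), Real.norm_of_nonneg (hβn _)]
      exact mul_le_of_le_one_right (ha γ) (hβl _)
  have heq : R t = ∑' γ : Z, (a γ : ℂ) * Complex.exp (Complex.I * γ * t) := by
    refine tendsto_nhds_unique (lim t) (hdom.congr' ?_)
    filter_upwards [Filter.eventually_gt_atTop 0] with Y hY
    rw [← hSE t Y hY, tsum_subtype Z fun γ : ℝ => (a γ : ℂ) * (β (γ / Y) *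
      Complex.exp (Complex.I * γ * t))]
    rw [tsum_eq_sum (s := S t Y)]
    · refine Finset.sum_congr rfl fun γ hγ => ?_
      rw [Set.indicator_of_mem ((hS t Y hY γ).1 hγ).1]
    · intro γ hγ
      by_cases hz : γ ∈ Z
      · rw [Set.indicator_of_mem hz]
        have : 2 * Y < |γ| := by
          by_contra! hle
          exact hγ ((hS t Y hY γ).2 ⟨hz, hle⟩)
        rw [hβ0 _ (by rwa [abs_div, abs_of_pos hY, lt_div_iff₀ hY])]; simp
      · rw [Set.indicator_of_notMem hz]
  rw [heq]
  exact hs2.hasSum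

end

section
variable {δ : ℝ} {η : ℝ → ℝ}

theorem MemS.continuous_fourierR (hδ : 0 < δ) (hη : MemS δ η) : Continuous (fourierR η) := by
  have h : Continuous fun y : ℝ => (bilap (fun t => (η t : ℂ))
      (Complex.I * ((2 * Real.pi * y : ℝ) : ℂ))).re := by
    refine Complex.continuous_re.comp (hη.bilap_differentiableOn.continuousOn.comp_continuous
      (by fun_prop) fun y => ?_)
    show (Complex.I * ((2 * Real.pi * y : ℝ) : ℂ)).re ∈ Set.Ioo _ _
    rw [show (Complex.I * ((2 * Real.pi * y : ℝ) : ℂ)).re = 0 by rw [Complex.mul_re]; simp]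
    constructor <;> linarith
  refine h.congr fun y => ?_
  rw [hη.bilap_I_mul hδ, Complex.ofReal_re, mul_div_cancel_left₀ _ Real.two_pi_pos.ne']

theorem integrable_inv_mul_log_rpow (hδ : 0 < δ) :
    Integrable fun ξ : ℝ => (|ξ| + 1)⁻¹ * Real.log (|ξ| + 2) ^ (-(2 + δ)) := by
  have hcont : Continuous fun ξ : ℝ => (|ξ| + 1)⁻¹ * Real.log (|ξ| + 2) ^ (-(2 + δ)) := by
    have h1 : ∀ ξ : ℝ, |ξ| + 1 ≠ 0 := fun ξ => by positivity
    have h2 : ∀ ξ : ℝ, |ξ| + 2 ≠ 0 := fun ξ => by positivity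
    have h3 : ∀ ξ : ℝ, Real.log (|ξ| + 2) ≠ 0 := fun ξ =>
      (Real.log_pos (by linarith [abs_nonneg ξ])).ne'
    exact ((by fun_prop : Continuous fun ξ : ℝ => |ξ| + 1).inv₀ h1).mul
      (((by fun_prop : Continuous fun ξ : ℝ => |ξ| + 2).log h2).rpow_const fun ξ => .inl (h3 ξ))
  have hder : ∀ x ∈ Set.Ici (1 : ℝ), HasDerivAt (fun x : ℝ => -Real.log (x + 1) ^ (-(1 + δ)))
      ((1 + δ) * ((x + 1)⁻¹ * Real.log (x + 1) ^ (-(2 + δ)))) x := by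
    intro x (hx : 1 ≤ x)
    have hl : 0 < Real.log (x + 1) := Real.log_pos (by linarith)
    have h := ((((hasDerivAt_id x).add_const 1).log (by simp; linarith)).rpow_const
      (p := -(1 + δ)) (.inl hl.ne')).neg
    refine h.congr_deriv ?_
    simp only [id]
    rw [show -(1 + δ) - 1 = -(2 + δ) by ring]
    ring
  have hlim : Filter.Tendsto (fun x : ℝ => -Real.log (x + 1) ^ (-(1 + δ))) Filter.atTop (nhds (-0)) :=
    ((tendsto_rpow_neg_atTop (by linarith)).comp (Real.tendsto_log_atTop.comp
      (Filter.tendsto_atTop_add_const_right _ 1 Filter.tendsto_id))).neg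
  have hI := integrableOn_Ioi_deriv_of_nonneg' hder (fun x (hx : 1 < x) =>
    mul_nonneg (by linarith) (mul_nonneg (by positivity)
      (Real.rpow_nonneg (Real.log_nonneg (by linarith)) _))) hlim
  have hI1 : IntegrableOn (fun ξ : ℝ => (|ξ| + 1)⁻¹ * Real.log (|ξ| + 2) ^ (-(2 + δ))) (Set.Ioi 1) := by
    refine (hI.const_mul (1 + δ)⁻¹).mono' hcont.aestronglyMeasurable
      ((ae_restrict_iff' measurableSet_Ioi).2 (ae_of_all _ fun x (hx : 1 < x) => ?_))
    have hl : 0 < Real.log (x + 1) := Real.log_pos (by linarith)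
    rw [abs_of_pos (by linarith), inv_mul_cancel_left₀ (by linarith), Real.norm_of_nonneg
      (mul_nonneg (by positivity) (Real.rpow_nonneg (Real.log_nonneg (by linarith)) _))]
    refine mul_le_mul_of_nonneg_left (Real.rpow_le_rpow_of_nonpos hl
      (Real.log_le_log (by linarith) (by linarith)) (by linarith)) (by positivity)
  have hI2 : IntegrableOn (fun ξ : ℝ => (|ξ| + 1)⁻¹ * Real.log (|ξ| + 2) ^ (-(2 + δ))) (Set.Ici 0) := by
    rw [← Set.Icc_union_Ioi_eq_Ici (zero_le_one' ℝ)]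
    exact hcont.integrableOn_Icc.union hI1
  rw [← integrableOn_univ, ← Set.Iic_union_Ici (a := (0 : ℝ))]
  refine IntegrableOn.union ?_ hI2
  have := hI2.integrable_indicator measurableSet_Ici |>.comp_neg
  rw [← integrable_indicator_iff measurableSet_Iic]
  refine this.congr (ae_of_all _ fun x => ?_)
  simp [Set.indicator]

theorem MemS.integrable_fourierR (hδ : 0 < δ) (hη : MemS δ η) : Integrable (fourierR η) := by
  obtain ⟨C, hC, h⟩ := hη.2.2.2.2.2
  refine ((integrable_inv_mul_log_rpow hδ).const_mul C).mono'
    (hη.continuous_fourierR hδ).aestronglyMeasurable (ae_of_all _ fun ξ => ?_)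
  rw [Real.norm_of_nonneg (hη.2.2.2.2.1 ξ)]
  exact h ξ

open scoped FourierTransform in
theorem MemS.alphaSq_eq_integral_sq (hδ : 0 < δ) (hη : MemS δ η) :
    alphaSq η = ∫ t, η t ^ 2 := by
  set f : ℝ → ℂ := fun t => (η t : ℂ)
  have hf : Integrable f := (hη.integrable hδ).ofReal
  have hfc : Continuous f := Complex.continuous_ofReal.comp hη.continuous
  have hFf : 𝓕 f = fun ξ => (fourierR η ξ : ℂ) := by
    ext ξ
    have := hη.bilap_I_mul hδ (2 * Real.pi * ξ)
    rw [mul_div_cancel_left₀ _ Real.two_pi_pos.ne'] at this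
    rw [← this, Real.fourier_real_eq_integral_exp_smul, bilap]
    congr 1 with t
    rw [smul_eq_mul]
    congr 2
    push_cast; ring
  have hFi : Integrable (𝓕 f) := by rw [hFf]; exact (hη.integrable_fourierR hδ).ofReal
  have hinv : 𝓕 (𝓕 f) = f := by
    have h1 := hfc.fourierInv_fourier_eq hf hFi
    ext t
    have h2 := congrFun h1 (-t)
    rw [Real.fourierInv_eq_fourier_neg, neg_neg] at h2
    rw [h2]; simp [f, hη.even]
  have hdual : ∫ ξ, 𝓕 f ξ * 𝓕 f ξ = ∫ t, f t * 𝓕 (𝓕 f) t := by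
    simpa using! (VectorFourier.integral_fourierIntegral_smul_eq_flip (L := innerₗ ℝ)
      Real.continuous_fourierChar continuous_inner hf hFi)
  rw [hinv, hFf] at hdual
  have : ((alphaSq η : ℝ) : ℂ) = ((∫ t, η t ^ 2 : ℝ) : ℂ) := by
    rw [alphaSq, ← integral_complex_ofReal, ← integral_complex_ofReal]
    simpa [f, sq] using hdual
  exact_mod_cast this

theorem MemS.integrable_sq (hδ : 0 < δ) (hη : MemS δ η) : Integrable fun t => η t ^ 2 := by
  obtain ⟨C, hC, h⟩ := hη.exists_bound
  refine ((hη.integrable hδ).norm.const_mul C).mono' (hη.continuous.pow 2).aestronglyMeasurable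
    (ae_of_all _ fun t => ?_)
  rw [norm_pow, sq]
  refine mul_le_mul_of_nonneg_right ((h t).1.trans (mul_le_of_le_one_right hC.le
    (Real.exp_le_one_iff.2 ?_))) (norm_nonneg _)
  nlinarith [abs_nonneg t]

theorem MemS.alphaSq_pos (hδ : 0 < δ) (hη : MemS δ η) : 0 < alphaSq η := by
  rw [hη.alphaSq_eq_integral_sq hδ]
  obtain ⟨t, ht⟩ := Function.ne_iff.1 hη.1
  rw [integral_pos_iff_support_of_nonneg (fun t => sq_nonneg (η t)) (hη.integrable_sq hδ)]
  exact (hη.continuous.pow 2).isOpen_support.measure_pos _ ⟨t, by simpa using ht⟩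

end

section
variable {δ : ℝ} {η : ℝ → ℝ} {N : ℕ} [NeZero N] {χ : DirichletCharacter ℂ N} {A : ℕ} {C C' : ℝ}

/-- The almost periodic function attached to `χ` by the explicit formula. -/
noncomputable def spectralTerm (η : ℝ → ℝ) (χ : DirichletCharacter ℂ N) (t : ℝ) : ℂ :=
  explicitTerm η χ t + (explicitTerm η χ⁻¹ (-t) + ((Real.log N * η (-t) : ℝ) : ℂ))

theorem conj_spectralTerm (χ : DirichletCharacter ℂ N) (t : ℝ) :
    conj (spectralTerm η χ t) = spectralTerm η χ⁻¹ t := by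
  simp only [spectralTerm, map_add, conj_explicitTerm, Complex.conj_ofReal]

omit [NeZero N] in
theorem continuous_spectralTerm (hδ : 0 < δ) (hη : MemS δ η) (χ : DirichletCharacter ℂ N) :
    Continuous (spectralTerm η χ) := by
  have h1 := continuous_explicitTerm hδ hη χ
  have h2 := continuous_explicitTerm hδ hη χ⁻¹
  have h3 := hη.continuous
  unfold spectralTerm
  fun_prop

/-- The coefficient of the frequency `γ` in the spectral expansion of `χ`. -/
noncomputable def spectralWeight (η : ℝ → ℝ) (χ : DirichletCharacter ℂ N) (γ : ℝ) : ℝ :=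
  analyticOrderNatAt (fun w => χ.completedLFunction (1/2 + w)) (Complex.I * γ) *
    fourierR η (γ / (2 * Real.pi))

theorem differentiable_completedLFunction_half (hχ : χ ≠ 1) :
    Differentiable ℂ fun w => χ.completedLFunction (1/2 + w) :=
  (DirichletCharacter.differentiable_completedLFunction hχ).comp (differentiable_id.const_add _)

theorem exists_completedLFunction_ne_zero (hχ : χ ≠ 1) : ∃ w, χ.completedLFunction (1/2 + w) ≠ 0 := by
  refine ⟨3/2, fun h => ?_⟩
  have h2 : χ.LFunction 2 ≠ 0 := χ.LFunction_ne_zero_of_one_le_re (.inl hχ) (by simp)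
  rw [χ.LFunction_eq_completed_div_gammaFactor 2 (.inl two_ne_zero)] at h2
  rw [show (1/2 + 3/2 : ℂ) = 2 by norm_num] at h
  simp [h] at h2

theorem hasSum_spectralTerm (hδ : 0 < δ) (hη : MemS δ η) (hχ : χ ≠ 1) (hprim : χ.IsPrimitive)
    (hb : PolyExpBound (psiChar η χ) A (1/2 + δ) C)
    (hb' : PolyExpBound (psiChar η χ⁻¹) A (1/2 + δ) C') :
    (Summable fun γ : {γ : ℝ | χ.completedLFunction (1/2 + Complex.I * γ) = 0} =>
      spectralWeight η χ γ) ∧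
    ∀ t : ℝ, HasSum (fun γ : {γ : ℝ | χ.completedLFunction (1/2 + Complex.I * γ) = 0} =>
      (spectralWeight η χ γ : ℂ) * Complex.exp (Complex.I * γ * t)) (spectralTerm η χ t) := by
  obtain ⟨D, hD⟩ := exists_polyExpBound_explicitTerm hδ hη hb
  obtain ⟨D', hD'⟩ := exists_polyExpBound_explicitTerm hδ hη hb'
  have hηb : ∃ E, PolyExpBound (fun t => ((Real.log N * η t : ℝ) : ℂ)) A (1/4) E := by
    obtain ⟨K, hK, h⟩ := hη.exists_bound
    refine ⟨|Real.log N| * K, .of_exp_neg_abs (by positivity) (by norm_num) A fun t => ?_⟩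
    rw [Complex.norm_real, norm_mul, Real.norm_eq_abs, mul_assoc]
    exact mul_le_mul_of_nonneg_left ((h t).1.trans (mul_le_mul_of_nonneg_left
      (exp_neg_half_add_le hδ t) hK.le)) (abs_nonneg _)
  obtain ⟨E, hE⟩ := hηb
  have hP := hD'.add hE
  have cQ := continuous_explicitTerm hδ hη χ
  have cQ' := continuous_explicitTerm hδ hη χ⁻¹
  have cη := hη.continuous
  have cP : Continuous fun t => explicitTerm η χ⁻¹ t + ((Real.log N * η t : ℝ) : ℂ) := by fun_prop
  set M := max D (D' + E)
  have w1 : ∀ (t : ℝ) {x : ℝ}, x ≤ D ∨ x ≤ D' + E → x * (1 + |t|) ^ A ≤ M * (1 + |t|) ^ A :=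
    fun t x hx => mul_le_mul_of_nonneg_right (hx.elim (le_max_of_le_left ·) (le_max_of_le_right ·))
      (by positivity)
  refine hasSum_of_integral_eq_sum (A := A) (C := D + (D' + E)) (continuous_spectralTerm hδ hη χ)
    (fun t => ?_) (fun γ => mul_nonneg (Nat.cast_nonneg _) (hη.2.2.2.2.1 _)) ?_
  · have q1 := hD.exp_mul_norm_le le_rfl (by norm_num) t
    have q2 := hP.exp_mul_norm_le le_rfl (by norm_num) (-t)
    simp only [neg_zero, zero_mul, Real.exp_zero, one_mul, abs_neg] at q1 q2
    rw [add_mul]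
    exact (norm_add_le _ _).trans (add_le_add q1 q2)
  · intro G g Y hG hGY hg hgG hgi
    obtain ⟨S, hS, hSE⟩ := integral_mul_fourier_eq_sum_zeros (C := M)
      (H := bilap fun t => (η t : ℂ)) (differentiable_completedLFunction_half hχ)
      (exists_completedLFunction_ne_zero hχ)
      (hη.bilap_differentiableOn.mono fun w hw => ⟨by have := hw.1; linarith, by have := hw.2; linarith⟩)
      cQ cP (fun σ h0 h1 t => (hD.exp_mul_norm_le h0 h1.le t).trans (w1 t (.inl le_rfl)))
      (fun σ h0 h1 t => (hP.exp_mul_norm_le h0 h1.le t).trans (w1 t (.inr le_rfl)))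
      (fun σ h0 h1 => hD.integrable cQ h0 h1) (fun σ h0 h1 => hP.integrable cP h0 h1)
      (fun w h0 h1 => by
        rw [bilap_explicitTerm_mul hδ hη hχ hb h0 h1]
        congr 1
        exact (deriv_comp_const_add _ _ _).symm)
      (fun w h0 h1 => by
        rw [bilap_explicitTerm_inv_mul hδ hη hχ hprim hb' h0 h1]
        congr 2
        exact (deriv_comp_const_add _ _ _).symm) hG hGY hg hgG hgi
    refine ⟨S, hS, ?_⟩
    simp only [hη.bilap_I_mul hδ] at hSE
    simp only [spectralWeight, Complex.ofReal_mul, Complex.ofReal_natCast]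
    exact hSE

theorem countable_zeros (hχ : χ ≠ 1) :
    {γ : ℝ | χ.completedLFunction (1/2 + Complex.I * γ) = 0}.Countable := by
  have := Set.countable_iUnion fun n : ℕ => (finite_zeros_imag_segment
    (differentiable_completedLFunction_half hχ) (exists_completedLFunction_ne_zero hχ) n).countable
  refine this.mono fun γ hγ => ?_
  obtain ⟨n, hn⟩ := exists_nat_ge |γ|
  exact Set.mem_iUnion.2 ⟨n, hγ, hn⟩

theorem fourierR_le_spectralWeight (hη : MemS δ η) (hχ : χ ≠ 1) {γ : ℝ}
    (hγ : χ.completedLFunction (1/2 + Complex.I * γ) = 0) :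
    fourierR η (γ / (2 * Real.pi)) ≤ spectralWeight η χ γ := by
  refine le_mul_of_one_le_left (hη.2.2.2.2.1 _) ?_
  have hd := differentiable_completedLFunction_half hχ
  have h1 := analyticOrderAt_ne_top_of_entire hd (exists_completedLFunction_ne_zero hχ)
    (Complex.I * γ)
  have h2 : analyticOrderAt (fun w => χ.completedLFunction (1/2 + w)) (Complex.I * γ) ≠ 0 :=
    (hd.analyticAt _).analyticOrderAt_ne_zero.2 hγ
  rw [Nat.one_le_cast, Nat.one_le_iff_ne_zero]
  intro h0
  apply h2
  rw [← Nat.cast_analyticOrderNatAt h1, h0]; rfl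

/-- A bound for the explicit terms uniform in the character. -/
theorem MemS.exists_explicitTerm_bound (hδ : 0 < δ) (hη : MemS δ η) :
    ∃ K > 0, ∀ (N : ℕ) [NeZero N] (χ : DirichletCharacter ℂ N) (t : ℝ),
      ‖explicitTerm η χ t‖ ≤ K * Real.exp ((1/2 + δ/2) * |t|) := by
  obtain ⟨C, hC, h⟩ := hη.exists_bound
  obtain ⟨D, hD, h'⟩ := hη.exists_archTerm_bound hδ
  set T := ∑' n : ℕ, ArithmeticFunction.vonMangoldt n * (n : ℝ) ^ (-(1 + δ/2))
  have hT : 0 ≤ T := tsum_nonneg fun n =>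
    mul_nonneg ArithmeticFunction.vonMangoldt_nonneg (by positivity)
  refine ⟨C * T + D, by positivity, fun N _ χ t => ?_⟩
  have h1 := norm_psiChar_le χ hC.le (fun t => (h t).1) (half_pos hδ) (by linarith) t
  have h2 : Real.exp ((1/2 + δ/2) * t) ≤ Real.exp ((1/2 + δ/2) * |t|) :=
    Real.exp_le_exp.2 (mul_le_mul_of_nonneg_left (le_abs_self t) (by linarith))
  have h3 : Real.exp (-(1/4) * |t|) ≤ Real.exp ((1/2 + δ/2) * |t|) :=
    Real.exp_le_exp.2 (mul_le_mul_of_nonneg_right (by linarith) (abs_nonneg t))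
  rw [add_mul]
  refine (norm_add_le _ _).trans (add_le_add ?_ ?_)
  · rw [norm_neg]
    exact h1.trans (mul_le_mul_of_nonneg_left h2 (by positivity))
  · rw [Complex.norm_real]
    exact (h' _ (parityShift_mem χ) t).trans (mul_le_mul_of_nonneg_left h3 hD.le)

theorem MemS.exists_isPosAlmostPeriodic (hδ : 0 < δ) (hη : MemS δ η) :
    ∃ K > 0, ∀ (N : ℕ) [NeZero N] (χ : DirichletCharacter ℂ N) (A : ℕ) (C C' : ℝ), χ ≠ 1 →
      χ.IsPrimitive → PolyExpBound (psiChar η χ) A (1/2 + δ) C →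
      PolyExpBound (psiChar η χ⁻¹) A (1/2 + δ) C' →
      IsPosAlmostPeriodic (spectralTerm η χ) (Real.log N * alphaSq η - K) := by
  obtain ⟨B, hB, hBb⟩ := hη.exists_explicitTerm_bound hδ
  obtain ⟨C₀, hC₀, h⟩ := hη.exists_bound
  have hdom : Integrable fun t : ℝ => |η t| * (B * Real.exp ((1/2 + δ/2) * |t|)) := by
    refine ((integrable_exp_neg_abs (half_pos hδ)).const_mul (C₀ * B)).mono'
      (Continuous.aestronglyMeasurable (by have := hη.continuous; fun_prop)) (ae_of_all _ fun t => ?_)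
    rw [Real.norm_of_nonneg (by positivity)]
    calc _ ≤ C₀ * Real.exp (-(1/2 + δ) * |t|) * (B * Real.exp ((1/2 + δ/2) * |t|)) :=
          mul_le_mul_of_nonneg_right (h t).1 (by positivity)
      _ = _ := by
          rw [show -(δ/2) * |t| = -(1/2 + δ) * |t| + (1/2 + δ/2) * |t| by ring, Real.exp_add]; ring
  set J := ∫ t : ℝ, |η t| * (B * Real.exp ((1/2 + δ/2) * |t|))
  have hJ : 0 ≤ J := integral_nonneg fun t => by positivity
  refine ⟨2 * J + 1, by positivity, fun N _ χ A C C' hχ hprim hb hb' => ?_⟩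
  obtain ⟨hs, hsum⟩ := hasSum_spectralTerm hδ hη hχ hprim hb hb'
  set Z : Set ℝ := {γ : ℝ | χ.completedLFunction (1/2 + Complex.I * γ) = 0}
  have hc : ∀ γ, 0 ≤ spectralWeight η χ γ := fun γ => mul_nonneg (Nat.cast_nonneg _) (hη.2.2.2.2.1 _)
  refine ⟨Z, fun γ => spectralWeight η χ γ, fun γ => γ, fun γ => hc γ, hs, hsum, ?_⟩
  have : Countable Z := (countable_zeros hχ).to_subtype
  have hηi := hη.integrable hδ
  have hηc := hη.continuous
  have hFn : ∀ (γ : Z) (t : ℝ), ‖(η t : ℂ) * ((spectralWeight η χ γ : ℂ) *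
      Complex.exp (Complex.I * γ * t))‖ = spectralWeight η χ γ * |η t| := fun γ t => by
    rw [norm_mul, norm_mul, Complex.norm_real, Complex.norm_real, Real.norm_of_nonneg (hc γ),
      show Complex.I * (γ : ℝ) * (t : ℂ) = ((γ * t : ℝ) : ℂ) * Complex.I by push_cast; ring,
      Complex.norm_exp_ofReal_mul_I, Real.norm_eq_abs]
    ring
  have hFi : ∀ γ : Z, Integrable fun t : ℝ => (η t : ℂ) * ((spectralWeight η χ γ : ℂ) *
      Complex.exp (Complex.I * γ * t)) := fun γ =>
    (hηi.abs.const_mul (spectralWeight η χ γ)).mono'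
      (Continuous.aestronglyMeasurable (by fun_prop)) (ae_of_all _ fun t => (hFn γ t).le)
  have hnorm : ∀ t : ℝ, ‖(η t : ℂ) * (explicitTerm η χ t + explicitTerm η χ⁻¹ (-t))‖ ≤
      2 * (|η t| * (B * Real.exp ((1/2 + δ/2) * |t|))) := fun t => by
    have h1 := hBb N χ t
    have h2 := hBb N χ⁻¹ (-t)
    rw [abs_neg] at h2
    rw [norm_mul, Complex.norm_real, Real.norm_eq_abs]
    calc _ ≤ |η t| * (B * Real.exp ((1/2 + δ/2) * |t|) + B * Real.exp ((1/2 + δ/2) * |t|)) :=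
          mul_le_mul_of_nonneg_left ((norm_add_le _ _).trans (add_le_add h1 h2)) (abs_nonneg _)
      _ = _ := by ring
  -- pairing the expansion with `η`
  have hpair : HasSum (fun γ : Z => ((spectralWeight η χ γ * fourierR η (γ / (2 * Real.pi)) : ℝ) : ℂ))
      (∫ t : ℝ, (η t : ℂ) * spectralTerm η χ t) := by
    have hF := hasSum_integral_of_summable_integral_norm (μ := volume)
      (F := fun (γ : Z) (t : ℝ) => (η t : ℂ) * ((spectralWeight η χ γ : ℂ) *
        Complex.exp (Complex.I * γ * t))) (fun γ => (hFi γ)) ?_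
    · simp only [fun t : ℝ => ((hsum t).mul_left (η t : ℂ)).tsum_eq] at hF
      have hE : (fun γ : Z => ((spectralWeight η χ γ * fourierR η (γ / (2 * Real.pi)) : ℝ) : ℂ)) =
          fun γ : Z => ∫ t : ℝ, (η t : ℂ) * ((spectralWeight η χ γ : ℂ) *
            Complex.exp (Complex.I * γ * t)) := funext fun γ => ?_
      · rw [hE]; exact hF
      have h2 := hη.bilap_neg (Complex.I * (γ : ℝ))
      rw [hη.bilap_I_mul hδ, bilap] at h2
      rw [Complex.ofReal_mul, ← h2, ← integral_const_mul]
      refine integral_congr_ae (ae_of_all _ fun t => ?_)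
      simp only [neg_neg]
      ring
    · refine (hs.mul_right (∫ t : ℝ, |η t|)).congr fun γ => ?_
      rw [← integral_const_mul]
      exact integral_congr_ae (ae_of_all _ fun t => (hFn γ t).symm)
  have hi1 : Integrable fun t : ℝ => (η t : ℂ) * (explicitTerm η χ t + explicitTerm η χ⁻¹ (-t)) := by
    have c1 := continuous_explicitTerm hδ hη χ
    have c2 := continuous_explicitTerm hδ hη χ⁻¹
    exact (hdom.const_mul 2).mono' (Continuous.aestronglyMeasurable (by fun_prop))
      (ae_of_all _ hnorm)
  have hi2 : Integrable fun t : ℝ => ((η t ^ 2 : ℝ) : ℂ) := (hη.integrable_sq hδ).ofReal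
  have hint : ∫ t : ℝ, (η t : ℂ) * spectralTerm η χ t =
      (∫ t : ℝ, (η t : ℂ) * (explicitTerm η χ t + explicitTerm η χ⁻¹ (-t))) +
        ((Real.log N * alphaSq η : ℝ) : ℂ) := by
    rw [hη.alphaSq_eq_integral_sq hδ, Complex.ofReal_mul, ← integral_complex_ofReal,
      ← integral_const_mul, ← integral_add hi1 (hi2.const_mul _)]
    refine integral_congr_ae (ae_of_all _ fun t => ?_)
    simp only [spectralTerm, hη.even]
    push_cast
    ring
  have hbound : ‖∫ t : ℝ, (η t : ℂ) * (explicitTerm η χ t + explicitTerm η χ⁻¹ (-t))‖ ≤ 2 * J := by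
    rw [← integral_const_mul]
    exact norm_integral_le_of_norm_le (hdom.const_mul 2) (ae_of_all _ hnorm)
  have hle : Real.log N * alphaSq η - 2 * J ≤
      ∑' γ : Z, spectralWeight η χ γ * fourierR η (γ / (2 * Real.pi)) := by
    have h1 := (Complex.hasSum_re hpair).tsum_eq
    simp only [Complex.ofReal_re] at h1
    rw [h1, hint, Complex.add_re, Complex.ofReal_re]
    have := (abs_le.1 ((Complex.abs_re_le_norm _).trans hbound)).1
    linarith
  have hs2 : Summable fun γ : Z => spectralWeight η χ γ ^ 2 := by
    refine .of_nonneg_of_le (fun γ => sq_nonneg _) (fun γ => ?_)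
      (hs.mul_left (∑' γ : Z, spectralWeight η χ γ))
    rw [sq]
    exact mul_le_mul_of_nonneg_right (hs.le_tsum γ fun _ _ => hc _) (hc γ)
  have hle2 : ∀ γ : Z, spectralWeight η χ γ * fourierR η (γ / (2 * Real.pi)) ≤
      spectralWeight η χ γ ^ 2 := fun γ => by
    rw [sq]
    exact mul_le_mul_of_nonneg_left (fourierR_le_spectralWeight hη hχ γ.2) (hc γ)
  have := (Complex.hasSum_re hpair).summable
  simp only [Complex.ofReal_re] at this
  linarith [this.tsum_le_tsum hle2 hs2]

end

theorem dirichletCharacter_isPrimitive_of_prime {p : ℕ} (hp : p.Prime) {χ : DirichletCharacter ℂ p}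
    (hχ : χ ≠ 1) : χ.IsPrimitive := by
  have : NeZero p := ⟨hp.ne_zero⟩
  rcases (Nat.dvd_prime hp).1 χ.conductor_dvd_level with h | h
  · exact absurd ((DirichletCharacter.eq_one_iff_conductor_eq_one).2 h) hχ
  · exact h

section
variable {δ : ℝ} {η : ℝ → ℝ} {q : ℕ} [NeZero q]

/-- The deviation of the sum over the progression `a⁻¹` from its mean. -/
noncomputable def progressionError (η : ℝ → ℝ) (q : ℕ) (t : ℝ) (a : (ZMod q)ˣ) : ℝ :=
  psiAP η (Real.exp t) q ((a⁻¹ : (ZMod q)ˣ) : ZMod q).val -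
    psiCop η (Real.exp t) q / (q.totient : ℝ)

theorem Mmom_exp_eq (n : ℕ) (t : ℝ) : Mmom n (Real.exp t) q η =
    1 / (q.totient : ℝ) * ∑ a : (ZMod q)ˣ, progressionError η q t a ^ n := by
  rw [Mmom]
  congr 1
  symm
  refine Finset.sum_bij (fun a _ => ((a⁻¹ : (ZMod q)ˣ) : ZMod q).val) (fun a _ => ?_)
    (fun a _ b _ h => ?_) (fun b hb => ?_) (fun a _ => rfl)
  · exact Finset.mem_filter.2 ⟨Finset.mem_range.2 (ZMod.val_lt _), ZMod.val_coe_unit_coprime _⟩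
  · exact inv_injective (Units.ext (ZMod.val_injective q h))
  · obtain ⟨h1, h2⟩ := Finset.mem_filter.1 hb
    refine ⟨(ZMod.unitOfCoprime b h2)⁻¹, Finset.mem_univ _, ?_⟩
    simp [ZMod.val_cast_of_lt (Finset.mem_range.1 h1)]

omit [NeZero q] in
theorem vonMangoldt_mul_log_div_exp (n : ℕ) (t : ℝ) :
    ArithmeticFunction.vonMangoldt n / Real.sqrt n * η (Real.log (n / Real.exp t)) =
      ArithmeticFunction.vonMangoldt n / Real.sqrt n * η (Real.log n - t) := by
  rcases eq_or_ne n 0 with rfl | hn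
  · simp
  · rw [Real.log_div (by positivity) (Real.exp_ne_zero t), Real.log_exp]

omit [NeZero q] in
theorem psiChar_one_eq (t : ℝ) :
    psiChar η (1 : DirichletCharacter ℂ q) t = (psiCop η (Real.exp t) q : ℂ) := by
  rw [psiCop, Complex.ofReal_tsum, psiChar]
  congr 1 with n
  rw [vonMangoldt_mul_log_div_exp]
  by_cases h : n.Coprime q
  · have := (ZMod.isUnit_iff_coprime n q).2 h
    rw [if_pos h, MulChar.one_apply this, one_mul]
  · have := (ZMod.isUnit_iff_coprime n q).not.2 h
    rw [if_neg h, MulChar.map_nonunit _ this]; simp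

theorem sum_characters_mul_psiChar (hδ : 0 < δ) (hη : MemS δ η) (t : ℝ) (a : (ZMod q)ˣ) :
    ∑ χ : DirichletCharacter ℂ q, χ a * psiChar η χ t =
      ((q.totient * psiAP η (Real.exp t) q ((a⁻¹ : (ZMod q)ˣ) : ZMod q).val : ℝ) : ℂ) := by
  obtain ⟨C, hC, hb⟩ := hη.exists_bound
  have hs := fun χ : DirichletCharacter ℂ q => summable_psiChar χ hδ hC.le (fun u => (hb u).1) t
  simp only [psiChar, ← tsum_mul_left]
  rw [← Summable.tsum_finsetSum fun χ _ => (hs χ).mul_left _, Complex.ofReal_mul, psiAP,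
    Complex.ofReal_tsum, ← tsum_mul_left]
  congr 1 with n
  have h1 := DirichletCharacter.sum_char_inv_mul_char_eq ℂ (a⁻¹ : (ZMod q)ˣ).isUnit (n : ZMod q)
  rw [vonMangoldt_mul_log_div_exp]
  simp only [← mul_assoc, ← Finset.sum_mul]
  rw [ZMod.inv_coe_unit, inv_inv] at h1
  rw [h1, ZMod.natCast_zmod_val]
  by_cases h : ((a⁻¹ : (ZMod q)ˣ) : ZMod q) = n
  · rw [if_pos h, if_pos h.symm]; simp
  · rw [if_neg h, if_neg (Ne.symm h)]; simp

theorem sum_erase_mul_psiChar (hδ : 0 < δ) (hη : MemS δ η) (t : ℝ) (a : (ZMod q)ˣ) :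
    ∑ χ ∈ (Finset.univ : Finset (DirichletCharacter ℂ q)).erase 1, χ a * psiChar η χ t =
      ((q.totient * progressionError η q t a : ℝ) : ℂ) := by
  have h := sum_characters_mul_psiChar hδ hη t a
  rw [← Finset.add_sum_erase _ _ (Finset.mem_univ 1), psiChar_one_eq,
    MulChar.one_apply a.isUnit, one_mul] at h
  have hq : (q.totient : ℝ) ≠ 0 := by
    exact_mod_cast (Nat.totient_pos.2 (NeZero.pos q)).ne'
  rw [progressionError, mul_sub, mul_div_cancel₀ _ hq, Complex.ofReal_sub, ← h]
  ring

theorem psiChar_eq_sum_progressionError (hδ : 0 < δ) (hη : MemS δ η) (t : ℝ)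
    {χ : DirichletCharacter ℂ q} (hχ : χ ≠ 1) :
    psiChar η χ t = ∑ a : (ZMod q)ˣ, χ⁻¹ a * (progressionError η q t a : ℂ) := by
  classical
  have hq : (q.totient : ℂ) ≠ 0 := by
    exact_mod_cast (Nat.totient_pos.2 (NeZero.pos q)).ne'
  refine mul_left_cancel₀ hq ?_
  rw [Finset.mul_sum]
  have h1 : ∀ a : (ZMod q)ˣ, (q.totient : ℂ) * (χ⁻¹ a * (progressionError η q t a : ℂ)) =
      ∑ χ' ∈ (Finset.univ : Finset (DirichletCharacter ℂ q)).erase 1,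
        psiChar η χ' t * (χ' * χ⁻¹) a := fun a => by
    have := sum_erase_mul_psiChar hδ hη t a
    rw [Complex.ofReal_mul, Complex.ofReal_natCast] at this
    rw [mul_left_comm, ← this, Finset.mul_sum]
    refine Finset.sum_congr rfl fun χ' _ => ?_
    rw [MulChar.mul_apply]; ring
  simp only [h1]
  rw [Finset.sum_comm]
  simp only [← Finset.mul_sum, sum_units_eq_ite, mul_inv_eq_one]
  rw [Finset.sum_eq_single χ (fun b _ hb => by rw [if_neg hb, mul_zero])
    (fun h => absurd (Finset.mem_erase.2 ⟨hχ, Finset.mem_univ _⟩) h), if_pos rfl, mul_comm]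

theorem pow_norm_psiChar_le_Mmom (hδ : 0 < δ) (hη : MemS δ η) (t : ℝ)
    {χ : DirichletCharacter ℂ q} (hχ : χ ≠ 1) (m : ℕ) :
    (‖psiChar η χ t‖ / q.totient) ^ (2 * m) ≤ Mmom (2 * m) (Real.exp t) q η := by
  have hq : (0 : ℝ) < q.totient := by exact_mod_cast Nat.totient_pos.2 (NeZero.pos q)
  have hcard : ∑ a : (ZMod q)ˣ, (1 / q.totient : ℝ) = 1 := by
    rw [Finset.sum_const, Finset.card_univ, ZMod.card_units_eq_totient, nsmul_eq_mul,
      mul_one_div_cancel hq.ne']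
  have h1 : ‖psiChar η χ t‖ ≤ ∑ a : (ZMod q)ˣ, |progressionError η q t a| := by
    rw [psiChar_eq_sum_progressionError hδ hη t hχ]
    refine (norm_sum_le _ _).trans (Finset.sum_le_sum fun a _ => ?_)
    rw [norm_mul, Complex.norm_real, Real.norm_eq_abs]
    exact mul_le_of_le_one_left (abs_nonneg _) (DirichletCharacter.norm_le_one _ _)
  calc (‖psiChar η χ t‖ / q.totient) ^ (2 * m)
      ≤ (∑ a : (ZMod q)ˣ, (1 / q.totient : ℝ) * |progressionError η q t a|) ^ (2 * m) := by
        rw [← Finset.mul_sum, div_eq_mul_one_div, mul_comm]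
        gcongr
    _ ≤ ∑ a : (ZMod q)ˣ, (1 / q.totient : ℝ) * |progressionError η q t a| ^ (2 * m) :=
        Real.pow_arith_mean_le_arith_mean_pow _ _ _ (fun _ _ => by positivity) hcard
          (fun _ _ => abs_nonneg _) _
    _ = _ := by
        rw [Mmom_exp_eq, Finset.mul_sum]
        simp only [pow_mul, sq_abs]

end

theorem one_le_log_natCast {N : ℕ} (hN : 3 ≤ N) : 1 ≤ Real.log N := by
  rw [Real.le_log_iff_exp_le (by positivity)]
  have : (3 : ℝ) ≤ N := by exact_mod_cast hN
  linarith [Real.exp_one_lt_d9]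

section
variable {δ : ℝ} {η : ℝ → ℝ}

theorem MemS.exists_spectralTerm_bound (hδ : 0 < δ) (hη : MemS δ η) :
    ∃ K > 0, ∀ (N : ℕ) [NeZero N] (χ : DirichletCharacter ℂ N), 3 ≤ N →
      ‖spectralTerm η χ 0‖ ≤ K * Real.log N ∧
      ∀ t : ℝ, 0 ≤ t → ‖spectralTerm η χ t + psiChar η χ t‖ ≤
        K * Real.log N * Real.exp (-(1/4) * t) := by
  obtain ⟨C, hC, h⟩ := hη.exists_bound
  obtain ⟨D, hD, h'⟩ := hη.exists_archTerm_bound hδ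
  set T := ∑' n : ℕ, ArithmeticFunction.vonMangoldt n * (n : ℝ) ^ (-(1 + δ/2))
  have hT : 0 ≤ T := tsum_nonneg fun n =>
    mul_nonneg ArithmeticFunction.vonMangoldt_nonneg (by positivity)
  have hψ : ∀ (N : ℕ) [NeZero N] (χ : DirichletCharacter ℂ N) (t : ℝ), 0 ≤ t →
      ‖psiChar η χ (-t)‖ ≤ C * T * Real.exp (-(1/4) * t) := fun N _ χ t ht => by
    refine (norm_psiChar_le χ hC.le (fun t => (h t).1) (half_pos hδ) (by linarith) _).trans
      (mul_le_mul_of_nonneg_left (Real.exp_le_exp.2 ?_) (by positivity))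
    nlinarith
  have harch : ∀ (N : ℕ) (χ : DirichletCharacter ℂ N) (t : ℝ),
      ‖(archTerm η (parityShift χ) t : ℂ)‖ ≤ D * Real.exp (-(1/4) * |t|) := fun N χ t => by
    rw [Complex.norm_real]; exact h' _ (parityShift_mem χ) t
  have hlog : ∀ (N : ℕ), 3 ≤ N → ∀ t : ℝ, 0 ≤ t → ‖((Real.log N * η (-t) : ℝ) : ℂ)‖ ≤
      Real.log N * (C * Real.exp (-(1/4) * t)) := fun N hN t ht => by
    have h0 := one_le_log_natCast hN
    rw [Complex.norm_real, norm_mul, Real.norm_of_nonneg (by linarith), hη.even]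
    refine mul_le_mul_of_nonneg_left ((h t).1.trans (mul_le_mul_of_nonneg_left
      (Real.exp_le_exp.2 ?_) hC.le)) (by linarith)
    rw [abs_of_nonneg ht]
    nlinarith
  have key : ∀ (N : ℕ) [NeZero N] (χ : DirichletCharacter ℂ N), 3 ≤ N → ∀ t : ℝ, 0 ≤ t →
      ‖spectralTerm η χ t + psiChar η χ t‖ ≤
        (D + C * T + D + C) * Real.log N * Real.exp (-(1/4) * t) := fun N _ χ hN t ht => by
    have h0 := one_le_log_natCast hN
    have e1 := harch N χ t
    have e2 := harch N χ⁻¹ (-t)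
    have e3 := hψ N χ⁻¹ t ht
    have e4 := hlog N hN t ht
    rw [abs_neg, abs_of_nonneg ht] at e2
    rw [abs_of_nonneg ht] at e1
    rw [show spectralTerm η χ t + psiChar η χ t = (archTerm η (parityShift χ) t : ℂ) +
      ((-psiChar η χ⁻¹ (-t) + (archTerm η (parityShift χ⁻¹) (-t) : ℂ)) +
        ((Real.log N * η (-t) : ℝ) : ℂ)) by rw [spectralTerm, explicitTerm, explicitTerm]; ring]
    refine (norm_add_le _ _).trans ((add_le_add e1 ((norm_add_le _ _).trans (add_le_add
      ((norm_add_le _ _).trans (add_le_add ((norm_neg _).trans_le e3) e2)) e4))).trans ?_)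
    have e5 : 0 < Real.exp (-(1/4) * t) := Real.exp_pos _
    have e6 : 0 ≤ (D + C * T + D) * (Real.log N - 1) * Real.exp (-(1/4) * t) :=
      mul_nonneg (mul_nonneg (by positivity) (by linarith)) e5.le
    nlinarith
  refine ⟨D + C * T + D + C + C * T, by positivity, fun N _ χ hN => ⟨?_, fun t ht => ?_⟩⟩
  · have h0 := one_le_log_natCast hN
    have h1 := key N χ hN 0 le_rfl
    have h2 := hψ N χ 0 le_rfl
    simp only [mul_zero, Real.exp_zero, mul_one, neg_zero] at h1 h2
    have h3 := norm_sub_le (spectralTerm η χ 0 + psiChar η χ 0) (psiChar η χ 0)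
    rw [add_sub_cancel_right] at h3
    have : C * T * 1 ≤ C * T * Real.log N := mul_le_mul_of_nonneg_left h0 (by positivity)
    linarith
  · have h0 := one_le_log_natCast hN
    refine (key N χ hN t ht).trans ?_
    exact mul_le_mul_of_nonneg_right (mul_le_mul_of_nonneg_right
      (by linarith [mul_nonneg hC.le hT]) (by linarith)) (Real.exp_pos _).le

/-- The lower bound for the moment at a well-chosen integer `t` with `t₀ ≤ t < M`, when all the
twisted sums are polynomially bounded. -/
theorem MemS.exists_Mmom_lower_bound (hδ : 0 < δ) (hη : MemS δ η) {m : ℕ} (hm : 1 ≤ m) :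
    ∃ C > 0, ∀ (q A : ℕ), q.Prime → 3 ≤ q → C ≤ Real.log q * alphaSq η →
      (∀ χ : DirichletCharacter ℂ q, χ ≠ 1 → ∃ D, ∀ t : ℝ, 1 ≤ t → ‖psiChar η χ t‖ ≤ D * t ^ A) →
      ∀ M t₀ : ℕ, t₀ < M → ∃ t : ℕ, t₀ ≤ t ∧ t < M ∧
        (q.totient : ℝ) * ((((∏ j ∈ Finset.range m, (2 * j + 1)) *
          ∏ j ∈ Finset.range m, ((q.totient - 1) - 2 * j) : ℕ) : ℝ) *
            (Real.log q * alphaSq η - C) ^ m)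
          - 2 * t₀ * ((q.totient : ℝ) * (C * Real.log q)) ^ (2 * m) / M
          - q.totient * (q.totient * (C * Real.log q) * Real.exp (-(1/4) * t₀) * (2 * m : ℕ) *
            (2 * (q.totient * (C * Real.log q))) ^ (2 * m - 1))
          ≤ (q.totient : ℝ) ^ (2 * m + 1) * Mmom (2 * m) (Real.exp t) q η := by
  obtain ⟨K, hK, hKb⟩ := hη.exists_isPosAlmostPeriodic hδ
  obtain ⟨K', hK', hKb'⟩ := hη.exists_spectralTerm_bound hδ
  refine ⟨max K K', lt_max_of_lt_left hK, fun q A hq hq3 hCq hD M t₀ h0 => ?_⟩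
  have : NeZero q := ⟨hq.ne_zero⟩
  have hl := one_le_log_natCast hq3
  set C := max K K'
  have hC : 0 < C := lt_max_of_lt_left hK
  have hf : ∀ χ : DirichletCharacter ℂ q, χ ≠ 1 →
      IsPosAlmostPeriodic (spectralTerm η χ) (Real.log q * alphaSq η - C) := fun χ hχ => by
    obtain ⟨D, hD1⟩ := hD χ hχ
    obtain ⟨D', hD2⟩ := hD χ⁻¹ (inv_ne_one.2 hχ)
    obtain ⟨E, hE⟩ := exists_polyExpBound_psiChar hδ hη hD1
    obtain ⟨E', hE'⟩ := exists_polyExpBound_psiChar hδ hη hD2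
    obtain ⟨ι, c, γ, h1, h2, h3, h4⟩ := hKb q χ A E E' hχ
      (dirichletCharacter_isPrimitive_of_prime hq hχ) hE hE'
    exact ⟨ι, c, γ, h1, h2, h3, le_trans (by linarith [le_max_left K K']) h4⟩
  have hle : ∀ x, 0 ≤ x → K' * Real.log q * x ≤ C * Real.log q * x := fun x hx => by
    gcongr; exact le_max_right _ _
  have hL : ∀ χ : DirichletCharacter ℂ q, χ ≠ 1 → ‖spectralTerm η χ 0‖ ≤ C * Real.log q :=
    fun χ _ => by simpa using ((hKb' q χ hq3).1.trans (by simpa using hle 1 zero_le_one))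
  obtain ⟨t, ht0, htM, r, hr, hmain⟩ := exists_large_even_moment (spectralTerm η) (by linarith) hf
    (fun χ _ t => (conj_spectralTerm χ t).symm) hL m hm h0
  refine ⟨t, ht0, htM, ?_⟩
  have hq0 : (0 : ℝ) < q.totient := by exact_mod_cast Nat.totient_pos.2 (NeZero.pos q)
  set F : ℝ := q.totient * (C * Real.log q)
  have hF : 0 < F := by positivity
  have hcard : ((Finset.univ.erase 1 : Finset (DirichletCharacter ℂ q)).card : ℝ) ≤ q.totient := by
    have h1 : (Finset.univ : Finset (DirichletCharacter ℂ q)).card = q.totient := by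
      rw [Finset.card_univ, ← Nat.card_eq_fintype_card]
      exact DirichletCharacter.card_eq_totient_of_hasEnoughRootsOfUnity ℂ q
    exact_mod_cast h1 ▸ Finset.card_erase_le
  have hexp : Real.exp (-(1/4) * t) ≤ Real.exp (-(1/4) * t₀) := by
    have : (t₀ : ℝ) ≤ t := by exact_mod_cast ht0
    exact Real.exp_le_exp.2 (by linarith)
  have hexp1 : Real.exp (-(1/4) * t₀) ≤ 1 := by
    rw [Real.exp_le_one_iff]
    have : (0 : ℝ) ≤ t₀ := by positivity
    linarith
  have hsum : ∀ (g : DirichletCharacter ℂ q → ℂ) (b : ℝ), 0 ≤ b → (∀ χ, χ ≠ 1 → ‖g χ‖ ≤ b) →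
      ∀ a : (ZMod q)ˣ, ‖∑ χ ∈ Finset.univ.erase 1, χ a * g χ‖ ≤ q.totient * b := by
    intro g b hb hg a
    refine (norm_sum_le_of_le (f := fun χ => χ a * g χ) _ (n := fun _ => b) fun χ hχ => ?_).trans ?_
    · rw [norm_mul]
      exact (mul_le_of_le_one_left (norm_nonneg _) (χ.norm_le_one _)).trans
        (hg χ (Finset.ne_of_mem_erase hχ))
    · rw [Finset.sum_const, nsmul_eq_mul]
      exact mul_le_mul_of_nonneg_right hcard hb
  have hrF : ∀ a, |r a| ≤ F := fun a => by
    have := hsum (fun χ => spectralTerm η χ t) (C * Real.log q) (by positivity)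
      (fun χ hχ => ((hf χ hχ).norm_le t).trans (hL χ hχ)) a
    rwa [hr, Complex.norm_real] at this
  have hrE : ∀ a, |r a - -(q.totient * progressionError η q t a)| ≤
      F * Real.exp (-(1/4) * t₀) := fun a => by
    have := hsum (fun χ => spectralTerm η χ t + psiChar η χ t)
      (C * Real.log q * Real.exp (-(1/4) * t₀)) (by positivity)
      (fun χ hχ => ((hKb' q χ hq3).2 t (Nat.cast_nonneg _)).trans
        ((hle _ (Real.exp_pos _).le).trans (mul_le_mul_of_nonneg_left hexp (by positivity)))) a
    simp only [mul_add, Finset.sum_add_distrib] at this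
    rw [hr, sum_erase_mul_psiChar hδ hη, ← Complex.ofReal_add, Complex.norm_real] at this
    rw [sub_neg_eq_add]
    exact this.trans_eq (by ring)
  have hpow : ∀ a, r a ^ (2 * m) - F * Real.exp (-(1/4) * t₀) * (2 * m : ℕ) *
      (2 * F) ^ (2 * m - 1) ≤ (q.totient : ℝ) ^ (2 * m) * progressionError η q t a ^ (2 * m) :=
    fun a => by
    have h1 := abs_pow_sub_pow_le (r a) (-(q.totient * progressionError η q t a)) (2 * m)
    have h2 : |-(q.totient * progressionError η q t a)| ≤ 2 * F := by
      have h3 := abs_sub_abs_le_abs_sub (-(q.totient * progressionError η q t a)) (r a)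
      rw [abs_sub_comm] at h3
      have := hrE a
      have := hrF a
      have : F * Real.exp (-(1/4) * t₀) ≤ F := mul_le_of_le_one_right hF.le hexp1
      linarith
    have h4 : max |r a| |-(q.totient * progressionError η q t a)| ≤ 2 * F :=
      max_le ((hrF a).trans (by linarith)) h2
    have h5 : |r a - -(q.totient * progressionError η q t a)| * (2 * m : ℕ) *
        max |r a| |-(q.totient * progressionError η q t a)| ^ (2 * m - 1) ≤
        F * Real.exp (-(1/4) * t₀) * (2 * m : ℕ) * (2 * F) ^ (2 * m - 1) := by
      have := hrE a
      gcongr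
    have h6 := (abs_le.1 (h1.trans h5)).2
    rw [Even.neg_pow ⟨m, by ring⟩, mul_pow] at h6
    linarith
  have hsumE := Finset.sum_le_sum fun a (_ : a ∈ Finset.univ) => hpow a
  rw [Finset.sum_sub_distrib, Finset.sum_const, Finset.card_univ, ZMod.card_units_eq_totient,
    nsmul_eq_mul, ← Finset.mul_sum] at hsumE
  rw [Mmom_exp_eq, pow_succ]
  have : (q.totient : ℝ) ^ (2 * m) * q.totient * (1 / q.totient *
      ∑ a, progressionError η q t a ^ (2 * m)) =
      (q.totient : ℝ) ^ (2 * m) * ∑ a, progressionError η q t a ^ (2 * m) := by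
    field_simp
  rw [this]
  linarith

end

open Filter Topology in
theorem tendsto_prod_natSub_div_pow (m : ℕ) :
    Tendsto (fun n : ℕ => ((∏ j ∈ Finset.range m, ((n - 1) - 2 * j) : ℕ) : ℝ) / (n : ℝ) ^ m)
      atTop (𝓝 1) := by
  have h1 : ∀ j : ℕ, Tendsto (fun n : ℕ => (((n - 1) - 2 * j : ℕ) : ℝ) / n) atTop (𝓝 1) := by
    intro j
    have h2 : Tendsto (fun n : ℕ => 1 - (1 + 2 * j : ℝ) / n) atTop (𝓝 (1 - 0)) :=
      tendsto_const_nhds.sub (tendsto_const_div_atTop_nhds_zero_nat _)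
    rw [sub_zero] at h2
    refine h2.congr' ?_
    filter_upwards [eventually_ge_atTop (1 + 2 * j)] with n hn
    have hn0 : (n : ℝ) ≠ 0 := by
      have : n ≠ 0 := by omega
      exact_mod_cast this
    rw [Nat.sub_sub, Nat.cast_sub hn]
    push_cast
    field_simp
  have h2 := tendsto_finsetProd (Finset.range m) fun j _ => h1 j
  rw [Finset.prod_const_one] at h2
  refine h2.congr fun n => ?_
  rw [Finset.prod_div_distrib, Finset.prod_const, Finset.card_range, Nat.cast_prod]

theorem prod_range_two_mul_add_one (m : ℕ) :
    ((∏ j ∈ Finset.range m, (2 * j + 1) : ℕ) : ℝ) =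
      ((2 * m).factorial : ℝ) / (2 ^ m * (m.factorial : ℝ)) := by
  induction m with
  | zero => simp
  | succ n ih =>
    rw [Finset.prod_range_succ, Nat.cast_mul, ih, show 2 * (n + 1) = 2 * n + 1 + 1 by ring,
      Nat.factorial_succ, Nat.factorial_succ, Nat.factorial_succ]
    push_cast
    field_simp
    ring

/-- Numerical estimate for the error terms of the moment lower bound. -/
theorem moment_error_bound {m : ℕ} (hm : 1 ≤ m) {B C q φ l t₀ M : ℝ} (hC : 0 < C)
    (hq : 1 ≤ q) (hφ : 0 < φ) (hφq : φ ≤ q) (hl : 1 ≤ l) (hlq : l ≤ q) (hB : 0 < B)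
    (ht₀ : q ^ B ≤ t₀) (ht₀' : t₀ ≤ 2 * q ^ B)
    (hM : q ^ ((m : ℝ) - 1 + B) * l ^ (m + 2) ≤ M) :
    2 * t₀ * (φ * (C * l)) ^ (2 * m) / M + φ * (φ * (C * l) * Real.exp (-(1/4) * t₀) *
        (2 * m : ℕ) * (2 * (φ * (C * l))) ^ (2 * m - 1)) ≤
      φ ^ (m + 1) * l ^ m * (4 * C ^ (2 * m) * (l ^ 2)⁻¹ + (2 * m : ℕ) * 2 ^ (2 * m - 1) *
        C ^ (2 * m) * ((q ^ B) ^ (2 * m / B) * Real.exp (-(1/4) * q ^ B))) := by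
  obtain ⟨k, rfl⟩ : ∃ k, m = k + 1 := ⟨m - 1, by omega⟩
  have hq0 : 0 < q := by linarith
  have hl0 : 0 < l := by linarith
  have hy : 0 < q ^ B := by positivity
  rw [mul_add (φ ^ (k + 1 + 1) * l ^ (k + 1))]
  refine add_le_add ?_ ?_
  · rw [show ((k + 1 : ℕ) : ℝ) - 1 + B = k + B by push_cast; ring, Real.rpow_add hq0,
      Real.rpow_natCast] at hM
    rw [div_le_iff₀ (lt_of_lt_of_le (by positivity) hM)]
    calc 2 * t₀ * (φ * (C * l)) ^ (2 * (k + 1))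
        ≤ 2 * (2 * q ^ B) * (φ * (C * l)) ^ (2 * (k + 1)) := by gcongr
      _ = φ ^ (k + 1 + 1) * l ^ (k + 1) * (4 * C ^ (2 * (k + 1)) * (l ^ 2)⁻¹) *
          (φ ^ k * q ^ B * l ^ (k + 1 + 2)) := by
          field_simp
          ring
      _ ≤ φ ^ (k + 1 + 1) * l ^ (k + 1) * (4 * C ^ (2 * (k + 1)) * (l ^ 2)⁻¹) * M := by
          refine mul_le_mul_of_nonneg_left (le_trans ?_ hM) (by positivity)
          gcongr
  · have h1 : (q ^ B) ^ (2 * ((k + 1 : ℕ) : ℝ) / B) = q ^ (k + 1) * q ^ (k + 1) := by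
      rw [← Real.rpow_mul hq0.le, mul_div_cancel₀ _ hB.ne', ← pow_add, ← Real.rpow_natCast]
      congr 1; push_cast; ring
    rw [h1, show 2 * (k + 1) - 1 = 2 * k + 1 by omega]
    have hexp : Real.exp (-(1/4) * t₀) ≤ Real.exp (-(1/4) * q ^ B) :=
      Real.exp_le_exp.2 (by linarith)
    calc φ * (φ * (C * l) * Real.exp (-(1/4) * t₀) *
          (2 * (k + 1) : ℕ) * (2 * (φ * (C * l))) ^ (2 * k + 1))
        = φ ^ (k + 1 + 1) * l ^ (k + 1) * ((2 * (k + 1) : ℕ) * 2 ^ (2 * k + 1) *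
          C ^ (2 * (k + 1)) * ((φ ^ (k + 1) * l ^ (k + 1)) * Real.exp (-(1/4) * t₀))) := by ring
      _ ≤ _ := by gcongr

section
variable {δ : ℝ} {η : ℝ → ℝ}

open Filter Topology in
theorem MemS.exists_large_moment_of_polyBound (hδ : 0 < δ) (hη : MemS δ η) {m : ℕ} (hm : 2 ≤ m)
    {B : ℝ} (hB : 0 < B) {A : ℕ}
    (hA : ∀ (q : ℕ), q.Prime → 3 ≤ q → ∀ χ : DirichletCharacter ℂ q, χ ≠ 1 →
      ∃ D, ∀ t : ℝ, 1 ≤ t → ‖psiChar η χ t‖ ≤ D * t ^ A) {ε : ℝ} (hε : 0 < ε) (K : ℕ) :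
    ∃ (q t : ℕ), K ≤ q ∧ 3 ≤ q ∧ (q : ℝ) ^ B ≤ t ∧
      (t : ℝ) ≤ (q : ℝ) ^ ((m : ℝ) - 1 + B) * Real.log q ^ (m + 2) ∧
      (1 - ε) * (((2*m).factorial : ℝ) / (2^m * (m.factorial : ℝ))) *
        (alphaSq η * Real.log q) ^ m / (q.totient : ℝ) ^ m ≤ Mmom (2*m) (Real.exp t) q η := by
  obtain ⟨C, hC, hmain⟩ := hη.exists_Mmom_lower_bound hδ (m := m) (by omega)
  have hα := hη.alphaSq_pos hδ
  set μ : ℝ := ((2*m).factorial : ℝ) / (2^m * (m.factorial : ℝ))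
  have hμ : 0 < μ := by positivity
  have hlog : Tendsto (fun q : ℕ => Real.log q) atTop atTop :=
    Real.tendsto_log_atTop.comp tendsto_natCast_atTop_atTop
  have hpowB : Tendsto (fun q : ℕ => (q : ℝ) ^ B) atTop atTop :=
    (tendsto_rpow_atTop hB).comp tendsto_natCast_atTop_atTop
  have hlim : Tendsto (fun q : ℕ =>
      μ * (((∏ j ∈ Finset.range m, ((q - 1 - 1) - 2 * j) : ℕ) : ℝ) / ((q - 1 : ℕ) : ℝ) ^ m *
        (alphaSq η - C * (Real.log q)⁻¹) ^ m) -
      (4 * C ^ (2 * m) * (Real.log q ^ 2)⁻¹ + (2 * m : ℕ) * 2 ^ (2 * m - 1) *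
        C ^ (2 * m) * (((q : ℝ) ^ B) ^ (2 * m / B) * Real.exp (-(1/4) * (q : ℝ) ^ B)))) atTop
      (𝓝 (μ * (1 * (alphaSq η - C * 0) ^ m) - (4 * C ^ (2 * m) * 0 + (2 * m : ℕ) *
        2 ^ (2 * m - 1) * C ^ (2 * m) * 0))) := by
    have h1 := (tendsto_prod_natSub_div_pow m).comp (tendsto_sub_atTop_nat 1)
    have h2 := tendsto_inv_atTop_zero.comp hlog
    have h3 := tendsto_inv_atTop_zero.comp ((tendsto_pow_atTop two_ne_zero).comp hlog)
    have h4 := (tendsto_rpow_mul_exp_neg_mul_atTop_nhds_zero (2 * m / B) (1/4) (by norm_num)).comp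
      hpowB
    exact ((h1.mul ((tendsto_const_nhds.sub (h2.const_mul C)).pow m)).const_mul μ).sub
      ((h3.const_mul _).add (h4.const_mul _))
  have hev := hlim.eventually (lt_mem_nhds (a := (1 - ε) * μ * alphaSq η ^ m) (by
    have : 0 < ε * (μ * alphaSq η ^ m) := by positivity
    simp only [mul_zero, add_zero, sub_zero, one_mul]
    linarith))
  obtain ⟨q₀, hq₀⟩ := eventually_atTop.1 (hev.and (hlog.eventually_ge_atTop (C / alphaSq η)))
  obtain ⟨q, hq, hqp⟩ := Nat.exists_infinite_primes (max (max q₀ K) 3)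
  obtain ⟨hq1, hq3⟩ := max_le_iff.1 hq
  obtain ⟨hq2, hqK⟩ := max_le_iff.1 hq1
  obtain ⟨hG, hCl⟩ := hq₀ q hq2
  rw [div_le_iff₀ hα] at hCl
  have hl := one_le_log_natCast hq3
  have hl0 : 0 < Real.log q := by linarith
  have hqr : (3 : ℝ) ≤ q := by exact_mod_cast hq3
  have hy1 : 1 ≤ (q : ℝ) ^ B := Real.one_le_rpow (by linarith) hB.le
  set X : ℝ := (q : ℝ) ^ ((m : ℝ) - 1 + B) * Real.log q ^ (m + 2)
  have hX : (q : ℝ) ^ B + 1 ≤ X := by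
    have h1 : (q : ℝ) ^ (1 + B) ≤ (q : ℝ) ^ ((m : ℝ) - 1 + B) := by
      have : (2 : ℝ) ≤ m := by exact_mod_cast hm
      exact Real.rpow_le_rpow_of_exponent_le (by linarith) (by linarith)
    have h2 : 1 ≤ Real.log q ^ (m + 2) := one_le_pow₀ hl
    rw [Real.rpow_add (by linarith), Real.rpow_one] at h1
    calc (q : ℝ) ^ B + 1 ≤ q * (q : ℝ) ^ B := by nlinarith
      _ ≤ (q : ℝ) ^ ((m : ℝ) - 1 + B) * 1 := by linarith
      _ ≤ X := mul_le_mul_of_nonneg_left h2 (by positivity)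
  have hXM : X < (⌊X⌋₊ + 1 : ℕ) := by exact_mod_cast Nat.lt_floor_add_one X
  have hceil : (⌈(q : ℝ) ^ B⌉₊ : ℝ) < (q : ℝ) ^ B + 1 := Nat.ceil_lt_add_one (by linarith)
  obtain ⟨t, ht0, htM, hle⟩ := hmain q A hqp hq3 hCl (hA q hqp hq3) (⌊X⌋₊ + 1) ⌈(q : ℝ) ^ B⌉₊
    (by exact_mod_cast hceil.trans_le (hX.trans hXM.le))
  refine ⟨q, t, hqK, hq3, (Nat.le_ceil _).trans (by exact_mod_cast ht0),
    (Nat.cast_le.2 (Nat.lt_succ_iff.1 htM)).trans (Nat.floor_le (by linarith)), ?_⟩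
  have hφ : (0 : ℝ) < q.totient := by exact_mod_cast Nat.totient_pos.2 hqp.pos
  have herr := moment_error_bound (m := m) (by omega) hC (by linarith) hφ
    (by exact_mod_cast Nat.totient_le q) hl (Real.log_le_self (by linarith)) hB
    (Nat.le_ceil ((q : ℝ) ^ B)) (by linarith) hXM.le
  rw [← Nat.totient_prime hqp] at hG
  have hG2 := mul_le_mul_of_nonneg_left hG.le
    (by positivity : 0 ≤ (q.totient : ℝ) ^ (m + 1) * Real.log q ^ m)
  have hmaineq : (q.totient : ℝ) * ((((∏ j ∈ Finset.range m, (2 * j + 1)) *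
      ∏ j ∈ Finset.range m, ((q.totient - 1) - 2 * j) : ℕ) : ℝ) *
        (Real.log q * alphaSq η - C) ^ m) = (q.totient : ℝ) ^ (m + 1) * Real.log q ^ m *
      (μ * (((∏ j ∈ Finset.range m, ((q.totient - 1) - 2 * j) : ℕ) : ℝ) / (q.totient : ℝ) ^ m *
        (alphaSq η - C * (Real.log q)⁻¹) ^ m)) := by
    rw [Nat.cast_mul, prod_range_two_mul_add_one, show Real.log q * alphaSq η - C =
      Real.log q * (alphaSq η - C * (Real.log q)⁻¹) by field_simp, mul_pow]
    change _ * (μ * _ * _) = _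
    generalize (alphaSq η - C * (Real.log q)⁻¹) ^ m = y
    rw [pow_succ]
    field_simp
  rw [hmaineq] at hle
  rw [mul_sub] at hG2
  rw [div_le_iff₀ (by positivity)]
  have hfin : (q.totient : ℝ) ^ (m + 1) * ((1 - ε) * μ * (alphaSq η * Real.log q) ^ m) ≤
      (q.totient : ℝ) ^ (m + 1) * (Mmom (2*m) (Real.exp t) q η * (q.totient : ℝ) ^ m) := by
    calc _ = (q.totient : ℝ) ^ (m + 1) * Real.log q ^ m * ((1 - ε) * μ * alphaSq η ^ m) := by
          rw [mul_pow]; ring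
      _ ≤ (q.totient : ℝ) ^ (2 * m + 1) * Mmom (2 * m) (Real.exp t) q η := by linarith
      _ = _ := by ring
  exact le_of_mul_le_mul_left hfin (by positivity)

end

section
variable {δ : ℝ} {η : ℝ → ℝ}

open Filter Topology in
theorem MemS.exists_moduli_of_polyBound (hδ : 0 < δ) (hη : MemS δ η) {m : ℕ} (hm : 2 ≤ m)
    {B : ℝ} (hB : 0 < B) {A : ℕ}
    (hA : ∀ (q : ℕ), q.Prime → 3 ≤ q → ∀ χ : DirichletCharacter ℂ q, χ ≠ 1 →
      ∃ D, ∀ t : ℝ, 1 ≤ t → ‖psiChar η χ t‖ ≤ D * t ^ A) :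
    ∃ lam : ℝ, lam ∈ Set.Icc (1 / ((m : ℝ) - 1 + B)) (1 / B) ∧
      ∀ ε : ℝ, 0 < ε → ∃ (q : ℕ → ℕ) (x : ℕ → ℝ), Tendsto q atTop atTop ∧
        Tendsto (fun i => Real.log (q i) / Real.log (Real.log (x i))) atTop (𝓝 lam) ∧
        ∀ i : ℕ, (1 - ε) * (((2*m).factorial : ℝ) / (2^m * (m.factorial : ℝ))) *
          (alphaSq η * Real.log (q i)) ^ m / ((q i).totient : ℝ) ^ m ≤
            Mmom (2*m) (x i) (q i) η := by
  have hm' : (2 : ℝ) ≤ m := by exact_mod_cast hm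
  have hm1 : 0 < (m : ℝ) - 1 + B := by linarith
  choose q t hKq hq3 hqt htq hM using fun k : ℕ =>
    hη.exists_large_moment_of_polyBound hδ hm hB hA (ε := 1 / ((k : ℝ) + 1)) (by positivity) k
  have hqtop : Tendsto q atTop atTop := tendsto_atTop_mono hKq tendsto_id
  have hl : ∀ k, 1 ≤ Real.log (q k) := fun k => one_le_log_natCast (hq3 k)
  have hq0 : ∀ k, (0 : ℝ) < q k := fun k => by
    have := hq3 k
    exact_mod_cast (by omega : 0 < q k)
  have ht0 : ∀ k, (0 : ℝ) < t k := fun k => (Real.rpow_pos_of_pos (hq0 k) B).trans_le (hqt k)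
  have hlow : ∀ k, B * Real.log (q k) ≤ Real.log (t k) := fun k => by
    rw [← Real.log_rpow (hq0 k)]
    exact Real.log_le_log (Real.rpow_pos_of_pos (hq0 k) B) (hqt k)
  have hup : ∀ k, Real.log (t k) ≤
      ((m : ℝ) - 1 + B) * Real.log (q k) + (m + 2 : ℕ) * Real.log (Real.log (q k)) := fun k => by
    have h1 : 0 < Real.log (q k) := by linarith [hl k]
    have h2 := Real.rpow_pos_of_pos (hq0 k) ((m : ℝ) - 1 + B)
    rw [← Real.log_rpow (hq0 k), ← Real.log_pow, ← Real.log_mul h2.ne' (by positivity)]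
    exact Real.log_le_log (ht0 k) (htq k)
  have hlt : ∀ k, 0 < Real.log (t k) := fun k =>
    lt_of_lt_of_le (mul_pos hB (by linarith [hl k])) (hlow k)
  have hmem : ∀ k, Real.log (q k) / Real.log (t k) ∈ Set.Icc 0 (1 / B) := fun k => by
    refine ⟨div_nonneg (by linarith [hl k]) (hlt k).le, ?_⟩
    rw [div_le_div_iff₀ (hlt k) hB]
    linarith [hlow k]
  obtain ⟨lam, hlam, φ, hφ, hlim⟩ := isCompact_Icc.tendsto_subseq hmem
  have hlogq : Tendsto (fun k => Real.log (q k)) atTop atTop :=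
    Real.tendsto_log_atTop.comp (tendsto_natCast_atTop_atTop.comp hqtop)
  have hlim2 : Tendsto (fun k => (((m : ℝ) - 1 + B) + (m + 2 : ℕ) *
      (Real.log (Real.log (q k)) / Real.log (q k)))⁻¹) atTop
      (𝓝 (((m : ℝ) - 1 + B) + (m + 2 : ℕ) * 0)⁻¹) := by
    have h1 : Tendsto (fun x : ℝ => Real.log x / x) atTop (𝓝 0) :=
      Real.isLittleO_log_id_atTop.tendsto_div_nhds_zero
    exact ((h1.comp hlogq).const_mul _ |>.const_add _).inv₀ (by simpa using hm1.ne')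
  have hge : 1 / ((m : ℝ) - 1 + B) ≤ lam := by
    rw [mul_zero, add_zero] at hlim2
    rw [one_div]
    refine le_of_tendsto_of_tendsto' (hlim2.comp hφ.tendsto_atTop) hlim fun i => ?_
    have h1 : 0 < Real.log (q (φ i)) := by linarith [hl (φ i)]
    have h2 : ((m : ℝ) - 1 + B) + (m + 2 : ℕ) *
        (Real.log (Real.log (q (φ i))) / Real.log (q (φ i))) =
        (((m : ℝ) - 1 + B) * Real.log (q (φ i)) + (m + 2 : ℕ) * Real.log (Real.log (q (φ i)))) /
          Real.log (q (φ i)) := by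
      field_simp
    simp only [Function.comp]
    rw [h2, inv_div]
    exact div_le_div_of_nonneg_left h1.le (hlt _) (hup _)
  refine ⟨lam, ⟨hge, hlam.2⟩, fun ε hε => ?_⟩
  obtain ⟨n, hn⟩ := exists_nat_one_div_lt hε
  have hshift : Tendsto (fun i => φ (i + n)) atTop atTop :=
    hφ.tendsto_atTop.comp (tendsto_add_atTop_nat n)
  refine ⟨fun i => q (φ (i + n)), fun i => Real.exp (t (φ (i + n))), hqtop.comp hshift, ?_,
    fun i => le_trans ?_ (hM (φ (i + n)))⟩
  · simp only [Real.log_exp]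
    exact hlim.comp (tendsto_add_atTop_nat n)
  · have h1 : n ≤ φ (i + n) := (Nat.le_add_left n i).trans (hφ.id_le _)
    have h2 : 1 / ((φ (i + n) : ℝ) + 1) ≤ 1 / ((n : ℝ) + 1) := by gcongr
    have h3 := hη.alphaSq_pos hδ
    have h4 := hl (φ (i + n))
    gcongr
    linarith

theorem psiChar_changeLevel {p q : ℕ} (h : p ∣ q) (hpq : ∀ n : ℕ, n.Coprime p → n.Coprime q)
    (χ : DirichletCharacter ℂ p) (t : ℝ) :
    psiChar η (DirichletCharacter.changeLevel h χ) t = psiChar η χ t := by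
  rw [psiChar, psiChar]
  congr 1 with n
  congr 1
  by_cases hn : n.Coprime p
  · have := (ZMod.isUnit_iff_coprime n q).2 (hpq n hn)
    have h1 := DirichletCharacter.changeLevel_eq_cast_of_dvd χ h this.unit
    rwa [IsUnit.unit_spec, ZMod.cast_natCast h] at h1
  · have h1 := (ZMod.isUnit_iff_coprime n p).not.2 hn
    have h2 := (ZMod.isUnit_iff_coprime n q).not.2 fun h' => hn (h'.coprime_dvd_right h)
    rw [MulChar.map_nonunit _ h1, MulChar.map_nonunit _ h2]

open Filter Topology in
theorem MemS.exists_moduli_of_large_psiChar (hδ : 0 < δ) (hη : MemS δ η) {m : ℕ} (hm : 2 ≤ m)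
    {B : ℝ} (hB : 0 < B) {A p : ℕ} (hA1 : 1 ≤ A) (hA : 1 / B ≤ A) (hp : 3 ≤ p)
    {χ : DirichletCharacter ℂ p} (hχ : χ ≠ 1)
    (hlarge : ∀ D : ℝ, ∃ t : ℝ, 1 ≤ t ∧ D * t ^ A < ‖psiChar η χ t‖) :
    ∃ lam : ℝ, lam ∈ Set.Icc (1 / ((m : ℝ) - 1 + B)) (1 / B) ∧
      ∀ ε : ℝ, 0 < ε → ∃ (q : ℕ → ℕ) (x : ℕ → ℝ), Tendsto q atTop atTop ∧
        Tendsto (fun i => Real.log (q i) / Real.log (Real.log (x i))) atTop (𝓝 lam) ∧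
        ∀ i : ℕ, (1 - ε) * (((2*m).factorial : ℝ) / (2^m * (m.factorial : ℝ))) *
          (alphaSq η * Real.log (q i)) ^ m / ((q i).totient : ℝ) ^ m ≤
            Mmom (2*m) (x i) (q i) η := by
  have hm' : (2 : ℝ) ≤ m := by exact_mod_cast hm
  have hpr : (3 : ℝ) ≤ p := by exact_mod_cast hp
  have hlp := one_le_log_natCast hp
  have hlp0 : 0 < Real.log p := by linarith
  have hα := hη.alphaSq_pos hδ
  -- the twisted sum exceeds `t ^ A` at arbitrarily large `t`
  have hunb : ∀ n : ℕ, ∃ t : ℝ, (n : ℝ) ≤ t ∧ 1 ≤ t ∧ t ^ A < ‖psiChar η χ t‖ := by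
    intro n
    obtain ⟨S, hS⟩ := isCompact_Icc.exists_bound_of_continuousOn (s := Set.Icc (1 : ℝ) n)
      (continuous_psiChar χ hδ hη).continuousOn
    obtain ⟨t, ht1, ht⟩ := hlarge (max S 1)
    have hpow : 1 ≤ t ^ A := one_le_pow₀ ht1
    refine ⟨t, ?_, ht1, lt_of_le_of_lt ?_ ht⟩
    · by_contra! hlt
      have h1 := hS t ⟨ht1, hlt.le⟩
      have h2 : max S 1 * 1 ≤ max S 1 * t ^ A :=
        mul_le_mul_of_nonneg_left hpow (by positivity)
      linarith [le_max_left S 1]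
    · exact le_mul_of_one_le_left (by linarith) (le_max_right _ _)
  choose t htn ht1 htA using hunb
  have httop : Tendsto t atTop atTop := tendsto_atTop_mono htn tendsto_natCast_atTop_atTop
  have hlogt : Tendsto (fun n => Real.log (t n)) atTop atTop := Real.tendsto_log_atTop.comp httop
  set k : ℕ → ℕ := fun n => ⌊Real.log (t n) / (B * Real.log p)⌋₊
  have hkarg : Tendsto (fun n => Real.log (t n) / (B * Real.log p)) atTop atTop :=
    hlogt.atTop_div_const (by positivity)
  have hktop : Tendsto k atTop atTop := tendsto_nat_floor_atTop.comp hkarg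
  have hqtop : Tendsto (fun n => p ^ k n) atTop atTop :=
    (tendsto_pow_atTop_atTop_of_one_lt (by omega)).comp hktop
  have hlogq : ∀ n, Real.log ((p ^ k n : ℕ) : ℝ) = k n * Real.log p := fun n => by
    rw [Nat.cast_pow, Real.log_pow]
  have hrat : Tendsto (fun n => Real.log ((p ^ k n : ℕ) : ℝ) / Real.log (t n)) atTop
      (𝓝 (1 / B)) := by
    have h1 : Tendsto (fun n => ((k n : ℝ) / (Real.log (t n) / (B * Real.log p))) * (1 / B)) atTop
        (𝓝 (1 * (1 / B))) := (tendsto_nat_floor_div_atTop.comp hkarg).mul_const _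
    rw [one_mul] at h1
    refine h1.congr' ?_
    filter_upwards [hlogt.eventually_gt_atTop 0] with n hn
    rw [hlogq]
    field_simp
  have hev : ∀ᶠ n in atTop, 1 ≤ k n ∧ ((2*m).factorial : ℝ) / (2^m * (m.factorial : ℝ)) *
      (alphaSq η * Real.log ((p ^ k n : ℕ) : ℝ)) ^ m / ((p ^ k n).totient : ℝ) ^ m ≤
        Mmom (2*m) (Real.exp (t n)) (p ^ k n) η := by
    set μ : ℝ := ((2*m).factorial : ℝ) / (2^m * (m.factorial : ℝ))
    have hμ : 0 ≤ μ := by positivity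
    have hsmall : Tendsto (fun n => μ * (alphaSq η * (1 / B) * (Real.log (t n) / t n)) ^ m) atTop
        (𝓝 (μ * (alphaSq η * (1 / B) * 0) ^ m)) := by
      have h1 : Tendsto (fun x : ℝ => Real.log x / x) atTop (𝓝 0) :=
        Real.isLittleO_log_id_atTop.tendsto_div_nhds_zero
      exact (((h1.comp httop).const_mul _).pow m).const_mul μ
    rw [mul_zero, zero_pow (by omega), mul_zero] at hsmall
    filter_upwards [hktop.eventually_ge_atTop 1, hsmall.eventually (gt_mem_nhds one_pos)]
      with n hk hs
    refine ⟨hk, ?_⟩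
    have hpk : p ∣ p ^ k n := dvd_pow_self p (by omega)
    have : NeZero p := ⟨by omega⟩
    have : NeZero (p ^ k n) := ⟨pow_ne_zero _ (by omega)⟩
    have hχ' : DirichletCharacter.changeLevel hpk χ ≠ 1 := fun h =>
      hχ ((DirichletCharacter.changeLevel_eq_one_iff hpk).1 h)
    have hlow := pow_norm_psiChar_le_Mmom hδ hη (t n) hχ' m
    rw [psiChar_changeLevel hpk (fun j hj => hj.pow_right _)] at hlow
    refine le_trans ?_ hlow
    have ht0 : 0 < t n := by linarith [ht1 n]
    have hφ : (0 : ℝ) < (p ^ k n).totient := by exact_mod_cast Nat.totient_pos.2 (NeZero.pos _)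
    have hlt0 : 0 ≤ Real.log (t n) := Real.log_nonneg (ht1 n)
    have hlq : Real.log ((p ^ k n : ℕ) : ℝ) ≤ 1 / B * Real.log (t n) := by
      rw [hlogq]
      have := Nat.floor_le (div_nonneg hlt0 (by positivity : 0 ≤ B * Real.log p))
      rw [le_div_iff₀ (by positivity)] at this
      rw [one_div, inv_mul_eq_div, le_div_iff₀ hB]
      linarith
    have hlq0 : 0 ≤ Real.log ((p ^ k n : ℕ) : ℝ) := by rw [hlogq]; positivity
    have hqt : ((p ^ k n : ℕ) : ℝ) ≤ t n ^ A := by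
      have hq0 : (0 : ℝ) < (p ^ k n : ℕ) := by exact_mod_cast NeZero.pos _
      rw [← Real.log_le_log_iff hq0 (by positivity), Real.log_pow]
      exact hlq.trans (mul_le_mul_of_nonneg_right hA hlt0)
    have hφt : ((p ^ k n).totient : ℝ) ≤ t n ^ A :=
      le_trans (by exact_mod_cast Nat.totient_le _) hqt
    have htle : t n ≤ t n ^ A := le_self_pow₀ (ht1 n) (by omega)
    rw [div_pow, div_le_div_iff₀ (by positivity) (by positivity)]
    have hmain : μ * (alphaSq η * Real.log ((p ^ k n : ℕ) : ℝ)) ^ m ≤ t n ^ m := by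
      calc _ ≤ μ * (alphaSq η * (1 / B * Real.log (t n))) ^ m := by gcongr
        _ = μ * (alphaSq η * (1 / B) * (Real.log (t n) / t n)) ^ m * t n ^ m := by
          rw [mul_assoc μ, ← mul_pow]; field_simp
        _ ≤ 1 * t n ^ m := by gcongr
        _ = _ := one_mul _
    calc μ * (alphaSq η * Real.log ((p ^ k n : ℕ) : ℝ)) ^ m * ((p ^ k n).totient : ℝ) ^ (2 * m)
        ≤ (t n ^ A) ^ m * ((t n ^ A) ^ m * ((p ^ k n).totient : ℝ) ^ m) := by
          rw [two_mul, pow_add]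
          have := hmain.trans (pow_le_pow_left₀ ht0.le htle m)
          gcongr
      _ = (t n ^ A) ^ (2 * m) * ((p ^ k n).totient : ℝ) ^ m := by ring
      _ ≤ _ := by
          have := (htA n).le
          gcongr
  obtain ⟨n₀, hn₀⟩ := eventually_atTop.1 hev
  have hmB : 1 / ((m : ℝ) - 1 + B) ≤ 1 / B := one_div_le_one_div_of_le hB (by linarith)
  refine ⟨1 / B, ⟨hmB, le_rfl⟩, fun ε hε => ⟨fun i => p ^ k (i + n₀),
    fun i => Real.exp (t (i + n₀)), hqtop.comp (tendsto_add_atTop_nat n₀), ?_,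
    fun i => le_trans ?_ (hn₀ (i + n₀) (Nat.le_add_left _ _)).2⟩⟩
  · simp only [Real.log_exp]
    exact hrat.comp (tendsto_add_atTop_nat n₀)
  · have h1 : 0 ≤ Real.log ((p ^ k (i + n₀) : ℕ) : ℝ) := by rw [hlogq]; positivity
    gcongr
    exact mul_le_of_le_one_left (by positivity) (by linarith)

end

/-- **Theorem (unconditional Ω-result for higher moments).**
For any `B > 0` there is `λ ∈ [1/(m-1+B), 1/B]` such that for any `ε > 0` there are moduli
`q_i → ∞` and values `x_i` with `log q_i / log log x_i → λ` and
`M_{2m}(x_i,q_i;η) ≥ (1-ε) μ_{2m} (α(η̂²) log q_i)^m / φ(q_i)^m`. -/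
theorem moments_of_primes_stmt2
    (δ : ℝ) (hδ : 0 < δ) (η : ℝ → ℝ) (hη : MemS δ η)
    (m : ℕ) (hm : 2 ≤ m) (B : ℝ) (hB : 0 < B) :
    ∃ lam : ℝ, lam ∈ Set.Icc (1 / ((m : ℝ) - 1 + B)) (1 / B) ∧
      ∀ ε : ℝ, 0 < ε →
        ∃ (q : ℕ → ℕ) (x : ℕ → ℝ),
          Filter.Tendsto q Filter.atTop Filter.atTop ∧
          Filter.Tendsto (fun i => Real.log (q i) / Real.log (Real.log (x i)))
            Filter.atTop (nhds lam) ∧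
          ∀ i : ℕ,
            (1 - ε) * (((2*m).factorial : ℝ) / (2^m * (m.factorial : ℝ))) *
                (alphaSq η * Real.log (q i)) ^ m / ((q i).totient : ℝ) ^ m
              ≤ Mmom (2*m) (x i) (q i) η := by
  by_cases h : ∀ (q : ℕ), q.Prime → 3 ≤ q → ∀ χ : DirichletCharacter ℂ q, χ ≠ 1 →
      ∃ D, ∀ t : ℝ, 1 ≤ t → ‖psiChar η χ t‖ ≤ D * t ^ (⌈1 / B⌉₊ + 1)
  · exact hη.exists_moduli_of_polyBound hδ hm hB h
  · push Not at h
    obtain ⟨p, -, hp, χ, hχ, hlarge⟩ := h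
    refine hη.exists_moduli_of_large_psiChar hδ hm hB (by omega) ?_ hp hχ hlarge
    exact (Nat.le_ceil _).trans (by exact_mod_cast Nat.le_succ _)
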